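/- Fix a real constant C > 0. For an integral binary quartic form f define its height h_C(f) = max(|I(f)|, |J(f)|/C). Let N_C(V^{(0)};X) be the number of GL_2(ℤ)-equivalence classes of irreducible integral binary quartic forms f having 4 distinct real roots in P^1(ℂ) (equivalently, all four roots real) and h_C(f) < X. Then N_C(V^{(0)};X) = (C·ζ(2)/27)·X^2 + o(X^2) as X → ∞; that is, N_C(V^{(0)};X)/X^2 → C·ζ(2)/27. -/

import Mathlib

open Filter

/-- An integral binary quartic form `a x⁴ + b x³y + c x²y² + d xy³ + e y⁴`. -/
structure BQF where
  a : ℤ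
  b : ℤ
  c : ℤ
  d : ℤ
  e : ℤ

namespace BQF

/-- The invariant `I` of a binary quartic form. -/
def I (f : BQF) : ℤ := 12 * f.a * f.e - 3 * f.b * f.d + f.c ^ 2

/-- The invariant `J` of a binary quartic form. -/
def J (f : BQF) : ℤ :=
  72 * f.a * f.c * f.e + 9 * f.b * f.c * f.d - 27 * f.a * f.d ^ 2 -
    27 * f.e * f.b ^ 2 - 2 * f.c ^ 3

/-- Evaluation of the form at a pair of integers. -/
def evalZ (f : BQF) (x y : ℤ) : ℤ :=
  f.a * x ^ 4 + f.b * x ^ 3 * y + f.c * x ^ 2 * y ^ 2 + f.d * x * y ^ 3 + f.e * y ^ 4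

/-- Evaluation of the form at a pair of reals. -/
noncomputable def evalR (f : BQF) (x y : ℝ) : ℝ :=
  (f.a : ℝ) * x ^ 4 + (f.b : ℝ) * x ^ 3 * y + (f.c : ℝ) * x ^ 2 * y ^ 2 +
    (f.d : ℝ) * x * y ^ 3 + (f.e : ℝ) * y ^ 4

/-- `GL₂(ℤ)`-equivalence: `g = γ · f` where `(γ · f)(x,y) = f((x,y)γ)` for some
integer matrix `γ` with unit (i.e. `±1`) determinant. -/
def Equivalent (f g : BQF) : Prop :=
  ∃ γ : Matrix (Fin 2) (Fin 2) ℤ, IsUnit γ.det ∧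
    ∀ x y : ℤ, g.evalZ x y = f.evalZ (x * γ 0 0 + y * γ 1 0) (x * γ 0 1 + y * γ 1 1)

/-- Irreducibility of the form over `ℚ`: it has no factor of positive degree with
rational coefficients.  Equivalently, `a ≠ 0` (no root at infinity, i.e. no factor `y`)
and the dehomogenized quartic polynomial is irreducible over `ℚ`. -/
def Irred (f : BQF) : Prop :=
  f.a ≠ 0 ∧
    Irreducible (Polynomial.C (f.a : ℚ) * Polynomial.X ^ 4 +
      Polynomial.C (f.b : ℚ) * Polynomial.X ^ 3 +
      Polynomial.C (f.c : ℚ) * Polynomial.X ^ 2 +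
      Polynomial.C (f.d : ℚ) * Polynomial.X + Polynomial.C (f.e : ℚ))

/-- The set of real roots of `f`; for a form with `a ≠ 0` all roots of `f` in `ℙ¹(ℝ)`
have the shape `(z : 1)` with `z` real. -/
def realRoots (f : BQF) : Set ℝ := {z : ℝ | f.evalR z 1 = 0}

end BQF

/-- The number of `GL₂(ℤ)`-equivalence classes of integral binary quartic forms
satisfying the predicate `P`. -/
noncomputable def classCount (P : BQF → Prop) : ℕ :=
  Nat.card (Quot fun f g : {h : BQF // P h} => BQF.Equivalent f.1 g.1)




/-! Part 1: equidistribution -/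

noncomputable def ee (x : ℝ) : ℂ := Complex.exp (Complex.I * ((2 * Real.pi * x : ℝ) : ℂ))

lemma ee_add (x y : ℝ) : ee (x + y) = ee x * ee y := by
  unfold ee; rw [← Complex.exp_add]; congr 1; push_cast; ring

lemma norm_ee (x : ℝ) : ‖ee x‖ = 1 := by
  unfold ee; exact Complex.norm_exp_I_mul_ofReal _

lemma conj_ee (x : ℝ) : (starRingEnd ℂ) (ee x) = ee (-x) := by
  unfold ee; rw [← Complex.exp_conj]; congr 1
  rw [map_mul, Complex.conj_I, Complex.conj_ofReal]; push_cast; ring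

lemma ee_nat (θ : ℝ) (n : ℕ) : ee (θ * n) = ee θ ^ n := by
  unfold ee; rw [← Complex.exp_nat_mul]; congr 1; push_cast; ring

lemma ee_sub_one (θ : ℝ) (h : |θ| ≤ 1 / 2) : 4 * |θ| ≤ ‖ee θ - 1‖ := by
  unfold ee
  rw [Complex.norm_exp_I_mul_ofReal_sub_one]
  rw [norm_mul, show 2 * Real.pi * θ / 2 = Real.pi * θ by ring, Real.norm_eq_abs, Real.norm_eq_abs,
    abs_of_pos (by norm_num : (0:ℝ) < 2)]
  have h1 : |Real.sin (Real.pi * θ)| = |Real.sin (Real.pi * |θ|)| := by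
    rcases abs_cases θ with ⟨h, _⟩ | ⟨h, _⟩ <;> rw [h]
    rw [mul_neg, Real.sin_neg, abs_neg]
  rw [h1]
  have hp := Real.pi_pos
  have h2 := Real.mul_le_sin (x := Real.pi * |θ|) (by positivity) (by nlinarith)
  have h3 := le_abs_self (Real.sin (Real.pi * |θ|))
  have h4 : 2 / Real.pi * (Real.pi * |θ|) = 2 * |θ| := by field_simp
  linarith

lemma geom_ee (θ : ℝ) (h0 : θ ≠ 0) (h : |θ| ≤ 1 / 2) (n : ℕ) :
    ‖∑ j ∈ Finset.range n, ee (θ * j)‖ ≤ 1 / (2 * |θ|) := by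
  have hθ : 0 < |θ| := abs_pos.mpr h0
  have h1 := ee_sub_one θ h
  have hne : ee θ ≠ 1 := by
    intro h2; rw [h2, sub_self, norm_zero] at h1; linarith
  simp_rw [ee_nat]
  rw [geom_sum_eq hne, norm_div]
  have h2 : ‖ee θ ^ n - 1‖ ≤ 2 := by
    refine (norm_sub_le _ _).trans ?_
    rw [norm_pow, norm_ee]; norm_num
  rw [div_le_div_iff₀ (by linarith) (by positivity)]
  nlinarith

lemma normSq_expand (u : ℕ → ℂ) (N : ℕ) :
    ‖∑ j ∈ Finset.range N, u j‖ ^ 2 =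
      2 * (∑ j ∈ Finset.range N, ∑ h ∈ Finset.range (j + 1),
        u j * (starRingEnd ℂ) (u (j - h))).re - ∑ j ∈ Finset.range N, ‖u j‖ ^ 2 := by
  induction N with
  | zero => simp
  | succ N ih =>
    have h1 : ∑ h ∈ Finset.range (N + 1), u N * (starRingEnd ℂ) (u (N - h))
        = u N * (starRingEnd ℂ) (∑ j ∈ Finset.range N, u j) + u N * (starRingEnd ℂ) (u N) := by
      rw [← Finset.mul_sum, ← mul_add, ← map_sum, ← map_add, ← Finset.sum_range_succ]
      congr 2
      have := Finset.sum_range_reflect u (N + 1)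
      rw [← this]
      simp
    rw [Finset.sum_range_succ u, Finset.sum_range_succ (fun j => ‖u j‖ ^ 2),
      Finset.sum_range_succ (fun j => ∑ h ∈ Finset.range (j + 1),
        u j * (starRingEnd ℂ) (u (j - h))), h1]
    simp only [Complex.add_re]
    rw [Complex.mul_conj, Complex.ofReal_re]
    rw [Complex.sq_norm, Complex.normSq_add, ← Complex.sq_norm, ih, Complex.sq_norm (u N)]
    have h2 : (u N * (starRingEnd ℂ) (∑ j ∈ Finset.range N, u j)).re =
        ((∑ j ∈ Finset.range N, u j) * (starRingEnd ℂ) (u N)).re := by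
      simp only [Complex.mul_re, Complex.conj_re, Complex.conj_im]; ring
    rw [h2]; ring

lemma weyl_block (α β γ : ℝ) (N : ℕ) (h0 : α ≠ 0) (hN : 2 * |α| * N ≤ 1 / 2) :
    ‖∑ j ∈ Finset.range N, ee (α * (j:ℝ) ^ 2 + β * j + γ)‖ ^ 2 ≤
      N + (1 / (2 * |α|)) * (1 + Real.log N) := by
  have hα : 0 < |α| := abs_pos.mpr h0
  rw [normSq_expand]
  have hfl := Finset.sum_range_diag_flip N
    (fun h l => ee (α * ((l + h : ℕ):ℝ) ^ 2 + β * ((l + h : ℕ):ℝ) + γ) *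
      (starRingEnd ℂ) (ee (α * (l:ℝ) ^ 2 + β * l + γ)))
  have hfl2 : ∑ j ∈ Finset.range N, ∑ h ∈ Finset.range (j + 1),
      ee (α * (j:ℝ) ^ 2 + β * j + γ) *
        (starRingEnd ℂ) (ee (α * ((j - h : ℕ):ℝ) ^ 2 + β * ((j - h : ℕ):ℝ) + γ)) =
      ∑ h ∈ Finset.range N, ∑ l ∈ Finset.range (N - h),
        ee (α * ((l + h : ℕ):ℝ) ^ 2 + β * ((l + h : ℕ):ℝ) + γ) *
        (starRingEnd ℂ) (ee (α * (l:ℝ) ^ 2 + β * l + γ)) := by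
    rw [← hfl]
    refine Finset.sum_congr rfl fun j _ => Finset.sum_congr rfl fun h hh => ?_
    have : j - h + h = j := Nat.sub_add_cancel (Nat.lt_succ_iff.mp (Finset.mem_range.mp hh))
    simp only [this]
  rw [hfl2]
  simp only [norm_ee, one_pow, Finset.sum_const, Finset.card_range, nsmul_eq_mul, mul_one]
  have hin : ∀ h ∈ Finset.range N, h ≠ 0 → ‖∑ l ∈ Finset.range (N - h),
        ee (α * ((l + h : ℕ):ℝ) ^ 2 + β * ((l + h : ℕ):ℝ) + γ) *
        (starRingEnd ℂ) (ee (α * (l:ℝ) ^ 2 + β * l + γ))‖ ≤ 1 / (4 * |α|) * (1 / h) := by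
    intro h hh hne
    have hh' : h < N := Finset.mem_range.mp hh
    have hhpos : (0:ℝ) < h := by positivity
    have e1 : ∀ l : ℕ, ee (α * ((l + h : ℕ):ℝ) ^ 2 + β * ((l + h : ℕ):ℝ) + γ) *
        (starRingEnd ℂ) (ee (α * (l:ℝ) ^ 2 + β * l + γ)) =
        ee (α * h ^ 2 + β * h) * ee ((2 * α * h) * l) := by
      intro l
      rw [conj_ee, ← ee_add, ← ee_add]; congr 1; push_cast; ring
    simp_rw [e1]
    rw [← Finset.mul_sum, norm_mul, norm_ee, one_mul]
    have hab : |2 * α * h| = 2 * |α| * h := by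
      rw [abs_mul, abs_mul, abs_two, abs_of_pos hhpos]
    have hle : (h:ℝ) ≤ N := by exact_mod_cast hh'.le
    refine (geom_ee (2 * α * h) (by positivity) ?_ _).trans (le_of_eq ?_)
    · rw [hab]; exact le_trans (by gcongr) hN
    · rw [hab]; field_simp; norm_num
  rcases Nat.eq_zero_or_pos N with rfl | hNpos
  · simp
  obtain ⟨M, rfl⟩ : ∃ M, N = M + 1 := ⟨N - 1, by omega⟩
  rw [Finset.sum_range_succ', Complex.add_re]
  have hz : (∑ l ∈ Finset.range (M + 1 - 0),
        ee (α * ((l + 0 : ℕ):ℝ) ^ 2 + β * ((l + 0 : ℕ):ℝ) + γ) *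
        (starRingEnd ℂ) (ee (α * (l:ℝ) ^ 2 + β * l + γ))).re = (M + 1 : ℕ) := by
    have : ∀ l : ℕ, ee (α * ((l + 0 : ℕ):ℝ) ^ 2 + β * ((l + 0 : ℕ):ℝ) + γ) *
        (starRingEnd ℂ) (ee (α * (l:ℝ) ^ 2 + β * l + γ)) = 1 := by
      intro l
      rw [conj_ee, ← ee_add]; simp [ee]
    simp_rw [this]; simp
  rw [hz]
  have hb : (∑ k ∈ Finset.range M, ∑ l ∈ Finset.range (M + 1 - (k + 1)),
        ee (α * ((l + (k + 1) : ℕ):ℝ) ^ 2 + β * ((l + (k + 1) : ℕ):ℝ) + γ) *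
        (starRingEnd ℂ) (ee (α * (l:ℝ) ^ 2 + β * l + γ))).re ≤
        1 / (4 * |α|) * (1 + Real.log (M + 1 : ℕ)) := by
    refine (Complex.re_le_norm _).trans ((norm_sum_le _ _).trans ?_)
    refine (Finset.sum_le_sum fun k hk => hin (k + 1) ?_ (by omega)).trans ?_
    · simp at hk ⊢; exact hk
    rw [← Finset.mul_sum]
    gcongr
    have h1 := harmonic_le_one_add_log M
    have h2 : ∑ i ∈ Finset.range M, (1:ℝ) / ((i + 1 : ℕ):ℝ) = ((harmonic M : ℚ) : ℝ) := by
      unfold harmonic; push_cast; simp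
    rw [h2]
    refine h1.trans ?_
    have : Real.log (M:ℝ) ≤ Real.log ((M + 1 : ℕ):ℝ) := by
      rcases Nat.eq_zero_or_pos M with rfl | hM
      · simp
      · apply Real.log_le_log (by exact_mod_cast hM); push_cast; linarith
    linarith
  have e3 : 1 / (2 * |α|) = 2 * (1 / (4 * |α|)) := by field_simp; norm_num
  rw [e3]
  linarith



lemma log_nat_le (N : ℕ) : Real.log N ≤ 2 * Real.sqrt N := by
  rcases Nat.eq_zero_or_pos N with rfl | h
  · simp
  have h1 : (0:ℝ) < N := by exact_mod_cast h
  have h2 := Real.log_le_sub_one_of_pos (Real.sqrt_pos.mpr h1)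
  rw [Real.log_sqrt h1.le] at h2
  linarith

lemma weyl_split (B : ℕ) (hB : 0 < B) (α E : ℝ) (hE0 : 0 ≤ E)
    (hE : ∀ β γ : ℝ, ∀ N ≤ B, ‖∑ j ∈ Finset.range N, ee (α * (j:ℝ) ^ 2 + β * j + γ)‖ ≤ E) :
    ∀ N : ℕ, ∀ β γ : ℝ, ‖∑ j ∈ Finset.range N, ee (α * (j:ℝ) ^ 2 + β * j + γ)‖ ≤
      ((N:ℝ) / B + 1) * E := by
  intro N
  induction N using Nat.strong_induction_on with
  | _ N ih =>
    intro β γ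
    have hB' : (0:ℝ) < B := by exact_mod_cast hB
    by_cases hN : N ≤ B
    · refine (hE β γ N hN).trans ?_
      have : (0:ℝ) ≤ (N:ℝ) / B := by positivity
      nlinarith
    · push Not at hN
      have e1 : N = B + (N - B) := by omega
      have key : ∑ j ∈ Finset.range N, ee (α * (j:ℝ) ^ 2 + β * j + γ) =
          ∑ j ∈ Finset.range B, ee (α * (j:ℝ) ^ 2 + β * j + γ) +
          ∑ j ∈ Finset.range (N - B), ee (α * (j:ℝ) ^ 2 + (2 * α * B + β) * j +
            (α * B ^ 2 + β * B + γ)) := by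
        conv_lhs => rw [e1, Finset.sum_range_add]
        congr 1
        refine Finset.sum_congr rfl fun j _ => ?_
        congr 1; push_cast; ring
      rw [key]
      refine (norm_add_le _ _).trans ?_
      have h1 := hE β γ B le_rfl
      have h2 := ih (N - B) (by omega) (2 * α * B + β) (α * B ^ 2 + β * B + γ)
      have h3 : ((N - B : ℕ):ℝ) / B = (N:ℝ) / B - 1 := by
        rw [Nat.cast_sub hN.le]; field_simp
      rw [h3] at h2
      linarith

lemma weyl_unif (κ K M ε : ℝ) (hκ : 0 < κ) (hK : 0 < K) (hM : 0 < M) (hε : 0 < ε) :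
    ∃ T0 : ℝ, 0 < T0 ∧ ∀ T ≥ T0, ∀ α β γ : ℝ, κ / T ≤ |α| → |α| ≤ K / T → ∀ N : ℕ, (N:ℝ) ≤ M * T →
      ‖∑ j ∈ Finset.range N, ee (α * (j:ℝ) ^ 2 + β * j + γ)‖ ≤ ε * T := by
  set Q : ℝ := 8 * K * M + 1 with hQ
  have hQ0 : 0 < Q := by positivity
  set c1 : ℝ := 1 / (4 * K) + 1 / (2 * κ) with hc1
  set c2 : ℝ := 1 / (2 * κ) * (2 * Real.sqrt (1 / (4 * K))) with hc2
  set δ : ℝ := (ε / Q) ^ 2 with hδ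
  have hδ0 : 0 < δ := by positivity
  have hc10 : 0 < c1 := by positivity
  have hc20 : 0 < c2 := by positivity
  refine ⟨8 * K + 2 * c1 / δ + (2 * c2 / δ) ^ 2, by positivity, ?_⟩
  intro T hT α β γ hα1 hα2 N hN
  have p1 : 0 < 2 * c1 / δ := by positivity
  have p2 : 0 < (2 * c2 / δ) ^ 2 := by positivity
  have hT0 : 0 < T := by nlinarith
  have hT1 : 8 * K ≤ T := by linarith
  have hT2 : 2 * c1 / δ ≤ T := by linarith
  have hT3 : 2 * c2 / δ ≤ Real.sqrt T := Real.le_sqrt_of_sq_le (by linarith)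
  have hαpos : 0 < |α| := lt_of_lt_of_le (by positivity) hα1
  set B : ℕ := ⌊T / (4 * K)⌋₊ with hBdef
  have hB1 : (B:ℝ) ≤ T / (4 * K) := Nat.floor_le (by positivity)
  have hB2 : T / (8 * K) ≤ B := by
    have h1 := Nat.lt_floor_add_one (T / (4 * K))
    have h2 : 1 ≤ T / (8 * K) := by rw [le_div_iff₀ (by positivity)]; linarith
    have h3 : T / (4 * K) = 2 * (T / (8 * K)) := by field_simp; norm_num
    rw [← hBdef] at h1
    linarith
  have hB0 : 0 < (B:ℝ) := lt_of_lt_of_le (by positivity) hB2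
  have hblock : ∀ β γ : ℝ, ∀ N ≤ B,
      ‖∑ j ∈ Finset.range N, ee (α * (j:ℝ) ^ 2 + β * j + γ)‖ ≤ ε / Q * T := by
    intro β γ N hNB
    have hNB' : (N:ℝ) ≤ T / (4 * K) := le_trans (by exact_mod_cast hNB) hB1
    have h1 := weyl_block α β γ N (abs_pos.mp hαpos) (by
      calc 2 * |α| * N ≤ 2 * (K / T) * (T / (4 * K)) := by gcongr
        _ = 1 / 2 := by field_simp; norm_num)
    refine (pow_le_pow_iff_left₀ (norm_nonneg _) (by positivity) two_ne_zero).mp ?_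
    refine h1.trans ?_
    have h2 : 1 / (2 * |α|) ≤ 1 / (2 * κ) * T := by
      rw [div_mul_eq_mul_div, one_mul, div_le_div_iff₀ (by positivity) (by positivity)]
      rw [div_le_iff₀ hT0] at hα1; nlinarith
    have h3 : Real.log N ≤ 2 * (Real.sqrt (1 / (4 * K)) * Real.sqrt T) := by
      refine (log_nat_le N).trans ?_
      rw [← Real.sqrt_mul (by positivity)]
      gcongr
      refine hNB'.trans (le_of_eq (by ring))
    have h4 : 0 ≤ 1 + Real.log N := by have := Real.log_natCast_nonneg N; linarith
    calc (N:ℝ) + 1 / (2 * |α|) * (1 + Real.log N)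
        ≤ T / (4 * K) + (1 / (2 * κ) * T) * (1 + 2 * (Real.sqrt (1 / (4 * K)) * Real.sqrt T)) := by
          gcongr
      _ = c1 * T + c2 * Real.sqrt T * T := by rw [hc1, hc2]; ring
      _ ≤ (δ / 2 * T) * T + (δ / 2 * Real.sqrt T) * Real.sqrt T * T := by
          gcongr
          · rw [div_le_iff₀ hδ0] at hT2; linarith
          · rw [div_le_iff₀ hδ0] at hT3; linarith
      _ = δ / 2 * T * T + δ / 2 * (Real.sqrt T * Real.sqrt T) * T := by ring
      _ = (ε / Q * T) ^ 2 := by rw [Real.mul_self_sqrt hT0.le, hδ]; ring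
  have h5 := weyl_split B (by exact_mod_cast hB0) α (ε / Q * T) (by positivity) hblock N β γ
  refine h5.trans ?_
  have h6 : (N:ℝ) / B + 1 ≤ Q := by
    rw [hQ]
    have : (N:ℝ) / B ≤ M * T / (T / (8 * K)) := by gcongr
    have h7 : M * T / (T / (8 * K)) = 8 * K * M := by field_simp
    linarith
  calc ((N:ℝ) / B + 1) * (ε / Q * T) ≤ Q * (ε / Q * T) := by gcongr
    _ = ε * T := by field_simp



noncomputable def B2 (t : ℝ) : ℝ := Int.fract t ^ 2 - Int.fract t + 1 / 6

lemma hasSum_B2 (t : ℝ) : HasSum (fun n : ℕ => 1 / (n:ℝ) ^ 2 * Real.cos (2 * Real.pi * n * t))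
    (Real.pi ^ 2 * B2 t) := by
  have h := hasSum_one_div_nat_pow_mul_cos (k := 1) one_ne_zero (x := Int.fract t)
    ⟨Int.fract_nonneg t, (Int.fract_lt_one t).le⟩
  have e1 : ∀ n : ℕ, Real.cos (2 * Real.pi * n * Int.fract t) =
      Real.cos (2 * Real.pi * n * t) := by
    intro n
    have : 2 * Real.pi * n * Int.fract t = 2 * Real.pi * n * t -
        ((n * ⌊t⌋ : ℤ):ℝ) * (2 * Real.pi) := by
      push_cast; unfold Int.fract; ring
    rw [this, Real.cos_sub_int_mul_two_pi]
  simp_rw [e1] at h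
  convert h using 1
  simp [Polynomial.bernoulli_def, Finset.sum_range_succ, B2, Nat.factorial, bernoulli_one]
  norm_num [Nat.choose, bernoulli_eq_bernoulli'_of_ne_one, bernoulli'_two]
  ring

lemma B2_approx (ε : ℝ) (hε : 0 < ε) : ∃ R : ℕ, ∀ t : ℝ,
    |B2 t - (∑ n ∈ Finset.range R, 1 / (n:ℝ) ^ 2 * Real.cos (2 * Real.pi * n * t)) / Real.pi ^ 2|
      ≤ ε := by
  have hu : Summable (fun n : ℕ => 1 / (n:ℝ) ^ 2) := by
    simp
  have h := tendstoUniformly_tsum_nat (f := fun (n : ℕ) (t : ℝ) =>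
    1 / (n:ℝ) ^ 2 * Real.cos (2 * Real.pi * n * t)) hu (by
      intro n x
      rw [norm_mul, Real.norm_eq_abs, Real.norm_eq_abs, abs_of_nonneg (by positivity)]
      have := Real.abs_cos_le_one (2 * Real.pi * n * x)
      have h2 : (0:ℝ) ≤ 1 / (n:ℝ) ^ 2 := by positivity
      nlinarith)
  rw [Metric.tendstoUniformly_iff] at h
  obtain ⟨R, hR⟩ := (h ε hε).exists
  refine ⟨R, fun t => ?_⟩
  have h1 := hR t
  rw [(hasSum_B2 t).tsum_eq, Real.dist_eq] at h1
  have hp : 1 ≤ Real.pi ^ 2 := by nlinarith [Real.pi_gt_three]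
  have hp0 : 0 < Real.pi ^ 2 := by positivity
  have e : B2 t - (∑ n ∈ Finset.range R, 1 / (n:ℝ) ^ 2 * Real.cos (2 * Real.pi * n * t))
      / Real.pi ^ 2 = (Real.pi ^ 2 * B2 t -
      ∑ n ∈ Finset.range R, 1 / (n:ℝ) ^ 2 * Real.cos (2 * Real.pi * n * t)) / Real.pi ^ 2 := by
    rw [sub_div, mul_div_cancel_left₀ _ hp0.ne']
  rw [e, abs_div, abs_of_pos hp0, div_le_iff₀ hp0]
  nlinarith

lemma ee_re (x : ℝ) : (ee x).re = Real.cos (2 * Real.pi * x) := by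
  unfold ee; rw [mul_comm, Complex.exp_ofReal_mul_I_re]

lemma eq_B2 (κ K M ε : ℝ) (hκ : 0 < κ) (hK : 0 < K) (hM : 0 < M) (hε : 0 < ε) :
    ∃ T0 : ℝ, 0 < T0 ∧ ∀ T ≥ T0, ∀ α β γ : ℝ, κ / T ≤ |α| → |α| ≤ K / T → ∀ N : ℕ, (N:ℝ) ≤ M * T →
      |∑ j ∈ Finset.range N, B2 (α * (j:ℝ) ^ 2 + β * j + γ)| ≤ ε * T := by
  obtain ⟨R, hR⟩ := B2_approx (ε / (2 * M)) (by positivity)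
  obtain ⟨T0, hT0, h⟩ := weyl_unif κ (K * (R + 1)) M (ε / (2 * (R + 1))) hκ (by positivity) hM
    (by positivity)
  refine ⟨T0, hT0, ?_⟩
  intro T hT α β γ hα1 hα2 N hN
  have hTp : 0 < T := lt_of_lt_of_le hT0 hT
  set P : ℕ → ℝ := fun j => α * (j:ℝ) ^ 2 + β * j + γ with hP
  have h1 : |∑ j ∈ Finset.range N, (B2 (P j) -
      (∑ n ∈ Finset.range R, 1 / (n:ℝ) ^ 2 * Real.cos (2 * Real.pi * n * P j)) / Real.pi ^ 2)|
      ≤ ε / 2 * T := by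
    refine (Finset.abs_sum_le_sum_abs _ _).trans ((Finset.sum_le_sum fun j _ => hR (P j)).trans ?_)
    rw [Finset.sum_const, Finset.card_range, nsmul_eq_mul]
    calc (N:ℝ) * (ε / (2 * M)) ≤ M * T * (ε / (2 * M)) := by gcongr
      _ = ε / 2 * T := by field_simp
  have h2 : ∀ n ∈ Finset.range R, |∑ j ∈ Finset.range N,
      1 / (n:ℝ) ^ 2 * Real.cos (2 * Real.pi * n * P j)| ≤ ε / (2 * (R + 1)) * T := by
    intro n hn
    rcases Nat.eq_zero_or_pos n with rfl | hn0
    · simp; positivity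
    have hn1 : (1:ℝ) ≤ n := by exact_mod_cast hn0
    have hnR : (n:ℝ) ≤ R + 1 := by
      have : n < R := Finset.mem_range.mp hn
      have : (n:ℝ) < R := by exact_mod_cast this
      linarith
    have h3 := h T hT (n * α) (n * β) (n * γ)
      (by rw [abs_mul, Nat.abs_cast]; nlinarith [abs_nonneg α])
      (by rw [abs_mul, Nat.abs_cast]
          calc (n:ℝ) * |α| ≤ (R + 1) * (K / T) := by gcongr
            _ = K * (R + 1) / T := by ring) N hN
    rw [← Finset.mul_sum, abs_mul]
    have h4 : |∑ j ∈ Finset.range N, Real.cos (2 * Real.pi * n * P j)| ≤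
        ‖∑ j ∈ Finset.range N, ee (n * α * (j:ℝ) ^ 2 + n * β * j + n * γ)‖ := by
      refine le_trans (le_of_eq ?_) (Complex.abs_re_le_norm _)
      rw [Complex.re_sum]
      congr 1
      refine Finset.sum_congr rfl fun j _ => ?_
      rw [ee_re]; congr 1; rw [hP]; ring
    have h5 : |1 / (n:ℝ) ^ 2| ≤ 1 := by
      rw [abs_of_nonneg (by positivity), div_le_one (by positivity)]; nlinarith
    calc _ ≤ 1 * (ε / (2 * (R + 1)) * T) := by gcongr; exact h4.trans h3
      _ = _ := one_mul _
  have h6 : |∑ j ∈ Finset.range N,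
      (∑ n ∈ Finset.range R, 1 / (n:ℝ) ^ 2 * Real.cos (2 * Real.pi * n * P j)) / Real.pi ^ 2|
      ≤ ε / 2 * T := by
    rw [← Finset.sum_div, Finset.sum_comm, abs_div, abs_of_pos (by positivity : 0 < Real.pi ^ 2)]
    have hp : 1 ≤ Real.pi ^ 2 := by nlinarith [Real.pi_gt_three]
    refine (div_le_self (abs_nonneg _) hp).trans ?_
    refine (Finset.abs_sum_le_sum_abs _ _).trans ((Finset.sum_le_sum h2).trans ?_)
    rw [Finset.sum_const, Finset.card_range, nsmul_eq_mul]
    calc (R:ℝ) * (ε / (2 * (R + 1)) * T) ≤ (R + 1) * (ε / (2 * (R + 1)) * T) := by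
          gcongr; linarith
      _ = _ := by field_simp
  rw [Finset.sum_sub_distrib] at h1
  have := abs_add_le (∑ j ∈ Finset.range N, B2 (P j) - ∑ j ∈ Finset.range N,
      (∑ n ∈ Finset.range R, 1 / (n:ℝ) ^ 2 * Real.cos (2 * Real.pi * n * P j)) / Real.pi ^ 2)
      (∑ j ∈ Finset.range N,
      (∑ n ∈ Finset.range R, 1 / (n:ℝ) ^ 2 * Real.cos (2 * Real.pi * n * P j)) / Real.pi ^ 2)
  rw [sub_add_cancel] at this
  linarith

lemma B2_up (t h : ℝ) (h0 : 0 < h) (h1 : h < 1) :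
    B2 (t + h) - B2 t ≤ 2 * h * (Int.fract t - 1 / 2) + h ^ 2 := by
  have hu0 := Int.fract_nonneg t
  have hu1 := Int.fract_lt_one t
  unfold B2
  by_cases hc : Int.fract t + h < 1
  · have : Int.fract (t + h) = Int.fract t + h := by
      rw [Int.fract_eq_iff]; exact ⟨by linarith, hc, ⌊t⌋, by unfold Int.fract; ring⟩
    rw [this]; apply le_of_eq; ring
  · have : Int.fract (t + h) = Int.fract t + h - 1 := by
      rw [Int.fract_eq_iff]
      exact ⟨by linarith, by linarith, ⌊t⌋ + 1, by unfold Int.fract; push_cast; ring⟩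
    rw [this]; nlinarith

lemma B2_down (t h : ℝ) (h0 : 0 < h) (h1 : h < 1) :
    2 * h * (Int.fract t - 1 / 2) - h ^ 2 ≤ B2 t - B2 (t - h) := by
  have hu0 := Int.fract_nonneg t
  have hu1 := Int.fract_lt_one t
  unfold B2
  by_cases hc : h ≤ Int.fract t
  · have : Int.fract (t - h) = Int.fract t - h := by
      rw [Int.fract_eq_iff]; exact ⟨by linarith, by linarith, ⌊t⌋, by unfold Int.fract; ring⟩
    rw [this]; apply le_of_eq; ring
  · have : Int.fract (t - h) = Int.fract t - h + 1 := by
      rw [Int.fract_eq_iff]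
      exact ⟨by linarith, by linarith, ⌊t⌋ - 1, by unfold Int.fract; push_cast; ring⟩
    rw [this]; nlinarith

lemma eq_B1 (κ K M ε : ℝ) (hκ : 0 < κ) (hK : 0 < K) (hM : 0 < M) (hε : 0 < ε) :
    ∃ T0 : ℝ, 0 < T0 ∧ ∀ T ≥ T0, ∀ α β γ : ℝ, κ / T ≤ |α| → |α| ≤ K / T → ∀ N : ℕ, (N:ℝ) ≤ M * T →
      |∑ j ∈ Finset.range N, (Int.fract (α * (j:ℝ) ^ 2 + β * j + γ) - 1 / 2)| ≤ ε * T := by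
  set h : ℝ := min (1 / 2) (ε / M) with hh
  have h0 : 0 < h := by positivity
  have h1 : h < 1 := lt_of_le_of_lt (min_le_left _ _) (by norm_num)
  have h2 : M * h ≤ ε := by
    have := min_le_right (1 / 2) (ε / M)
    calc M * h ≤ M * (ε / M) := by gcongr
      _ = ε := by field_simp
  obtain ⟨T0, hT0, H⟩ := eq_B2 κ K M (h * ε / 2) hκ hK hM (by positivity)
  refine ⟨T0, hT0, ?_⟩
  intro T hT α β γ hα1 hα2 N hN
  have hTp : 0 < T := lt_of_lt_of_le hT0 hT
  have a1 := abs_le.mp (H T hT α β γ hα1 hα2 N hN)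
  have a2 := abs_le.mp (H T hT α β (γ + h) hα1 hα2 N hN)
  have a3 := abs_le.mp (H T hT α β (γ - h) hα1 hα2 N hN)
  have b1 := Finset.sum_le_sum fun j (_ : j ∈ Finset.range N) =>
    B2_up (α * (j:ℝ) ^ 2 + β * j + γ) h h0 h1
  have b2 := Finset.sum_le_sum fun j (_ : j ∈ Finset.range N) =>
    B2_down (α * (j:ℝ) ^ 2 + β * j + γ) h h0 h1
  simp only [add_assoc, add_sub_assoc] at a1 a2 a3 b1 b2 ⊢
  rw [Finset.sum_sub_distrib, Finset.sum_add_distrib, ← Finset.mul_sum, Finset.sum_const,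
    Finset.card_range, nsmul_eq_mul] at b1
  rw [Finset.sum_sub_distrib, Finset.sum_sub_distrib, ← Finset.mul_sum, Finset.sum_const,
    Finset.card_range, nsmul_eq_mul] at b2
  have c1 : (N:ℝ) * h ^ 2 ≤ h * (ε * T) := by
    calc (N:ℝ) * h ^ 2 ≤ M * T * h ^ 2 := by gcongr
      _ = h * (M * h * T) := by ring
      _ ≤ h * (ε * T) := by gcongr
  set S := ∑ j ∈ Finset.range N, (Int.fract (α * (j:ℝ) ^ 2 + (β * j + γ)) - 1 / 2)
  rw [abs_le]
  constructor
  · by_contra hcon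
    push Not at hcon
    nlinarith
  · by_contra hcon
    push Not at hcon
    nlinarith



/-! Part 2: counting `e` and vague convergence -/

lemma abel_id (w u : ℕ → ℝ) (N : ℕ) : ∑ j ∈ Finset.range N, w j * u j =
    w N * (∑ j ∈ Finset.range N, u j) -
      ∑ j ∈ Finset.range N, (w (j + 1) - w j) * ∑ i ∈ Finset.range (j + 1), u i := by
  induction N with
  | zero => simp
  | succ N ih =>
    rw [Finset.sum_range_succ, ih, Finset.sum_range_succ (fun j => (w (j + 1) - w j) * _),
      Finset.sum_range_succ u]
    ring

lemma abel_bd (w u : ℕ → ℝ) (N : ℕ) (U W δ : ℝ) (hU : ∀ k ≤ N, |∑ j ∈ Finset.range k, u j| ≤ U)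
    (hW : ∀ j, |w j| ≤ W) (hδ : ∀ j, |w (j + 1) - w j| ≤ δ) :
    |∑ j ∈ Finset.range N, w j * u j| ≤ (W + N * δ) * U := by
  rw [abel_id]
  have hU0 : 0 ≤ U := (abs_nonneg _).trans (hU 0 (Nat.zero_le _))
  have h1 : |w N * (∑ j ∈ Finset.range N, u j)| ≤ W * U := by
    rw [abs_mul]
    exact mul_le_mul (hW N) (hU N le_rfl) (abs_nonneg _) ((abs_nonneg _).trans (hW 0))
  have h2 : |∑ j ∈ Finset.range N, (w (j + 1) - w j) * ∑ i ∈ Finset.range (j + 1), u i|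
      ≤ N * (δ * U) := by
    refine (Finset.abs_sum_le_sum_abs _ _).trans ?_
    refine (Finset.sum_le_sum (g := fun _ => δ * U) fun j hj => ?_).trans (by simp)
    rw [abs_mul]
    have := Finset.mem_range.mp hj
    exact mul_le_mul (hδ j) (hU _ (by omega)) (abs_nonneg _) ((abs_nonneg _).trans (hδ 0))
  have := abs_sub (w N * (∑ j ∈ Finset.range N, u j))
    (∑ j ∈ Finset.range N, (w (j + 1) - w j) * ∑ i ∈ Finset.range (j + 1), u i)
  linarith

def Hf (a b c : ℝ) : ℝ := 72 * a * c - 27 * b ^ 2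
def Gf (a b c d : ℝ) : ℝ := 27 * a * d ^ 2 - 9 * b * c * d + 2 * c ^ 3

noncomputable def ecount (Z : ℝ) (a b c d : ℤ) : ℕ :=
  Set.ncard {e : ℤ | |(e:ℝ) * Hf a b c - Gf a b c d| < Z}

lemma eset_eq (Z H G : ℝ) (hH : H ≠ 0) : {e : ℤ | |(e:ℝ) * H - G| < Z} =
    Set.Ioo ⌊G / H - Z / |H|⌋ ⌈G / H + Z / |H|⌉ := by
  ext e
  have hH' : 0 < |H| := abs_pos.mpr hH
  have : (e:ℝ) * H - G = ((e:ℝ) - G / H) * H := by field_simp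
  rw [Set.mem_ofPred_eq, this, abs_mul, ← lt_div_iff₀ hH', abs_lt, Set.mem_Ioo, Int.floor_lt,
    Int.lt_ceil]
  constructor
  · rintro ⟨h1, h2⟩; constructor <;> linarith
  · rintro ⟨h1, h2⟩; constructor <;> linarith

lemma ecount_eq (Z : ℝ) (hZ : 0 < Z) (a b c d : ℤ) (hH : Hf a b c ≠ 0) :
    (ecount Z a b c d : ℝ) = 2 * Z / |Hf a b c| +
      ((Int.fract (-(Gf a b c d / Hf a b c) - Z / |Hf a b c|) - 1 / 2) +
       (Int.fract (Gf a b c d / Hf a b c - Z / |Hf a b c|) - 1 / 2)) := by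
  unfold ecount
  rw [eset_eq _ _ _ hH]
  have hH' : 0 < |Hf a b c| := abs_pos.mpr hH
  set t := Gf a b c d / Hf a b c
  have hL : 0 < Z / |Hf a b c| := by positivity
  set L := Z / |Hf a b c| with hLdef
  have h1 : Set.Ioo ⌊t - L⌋ ⌈t + L⌉ = ((Finset.Ioo ⌊t - L⌋ ⌈t + L⌉ : Finset ℤ) : Set ℤ) := by simp
  rw [h1, Set.ncard_coe_finset, Int.card_Ioo]
  have h2 : (⌊t - L⌋:ℝ) ≤ t - L := Int.floor_le _
  have h3 : t + L ≤ (⌈t + L⌉:ℝ) := Int.le_ceil _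
  have h4 : ⌊t - L⌋ < ⌈t + L⌉ := by
    have : (⌊t - L⌋:ℝ) < (⌈t + L⌉:ℝ) := by linarith
    exact_mod_cast this
  have h5 : ((⌈t + L⌉ - ⌊t - L⌋ - 1).toNat : ℤ) = ⌈t + L⌉ - ⌊t - L⌋ - 1 :=
    Int.toNat_of_nonneg (by omega)
  have h6 : (((⌈t + L⌉ - ⌊t - L⌋ - 1).toNat : ℕ) : ℝ) = (⌈t + L⌉:ℝ) - ⌊t - L⌋ - 1 := by
    exact_mod_cast h5
  rw [h6]
  have h7 : -t - L = -(t + L) := by ring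
  rw [h7]
  have h8 : (⌈t + L⌉:ℝ) = -(⌊-(t + L)⌋:ℝ) := by rw [Int.floor_neg]; push_cast; ring
  rw [h8]; unfold Int.fract
  have : 2 * Z / |Hf a b c| = 2 * L := by rw [hLdef]; ring
  rw [this]; ring

lemma ecount_le (Z : ℝ) (hZ : 0 < Z) (a b c d : ℤ) (hH : Hf a b c ≠ 0) :
    (ecount Z a b c d : ℝ) ≤ 2 * Z / |Hf a b c| + 1 := by
  rw [ecount_eq Z hZ a b c d hH]
  have := (Int.fract_lt_one (-(Gf a b c d / Hf a b c) - Z / |Hf a b c|)).le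
  have := (Int.fract_lt_one (Gf a b c d / Hf a b c - Z / |Hf a b c|)).le
  linarith

lemma sum_Icc_shift (m : ℕ) (F : ℤ → ℝ) : ∑ d ∈ Finset.Icc (-(m:ℤ)) m, F d =
    ∑ j ∈ Finset.range (2 * m + 1), F ((j:ℤ) - m) := by
  symm
  refine Finset.sum_bij (fun j _ => (j:ℤ) - m) ?_ ?_ ?_ ?_
  · intro j hj; simp at hj ⊢; omega
  · intro i _ j _ h; simp at h; exact h
  · intro d hd; simp at hd; exact ⟨(d + m).toNat, by simp; omega, by omega⟩
  · intros; rfl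

lemma fibre (C κ h ε W : ℝ) (M : ℕ) (hM : 0 < M) (hC : 0 < C) (hκ : 0 < κ) (hh : 0 < h) (hε : 0 < ε)
    (hW : 0 < W) :
    ∃ n0 : ℕ, ∀ n ≥ n0, 0 < n ∧ ∀ a b c : ℤ, κ * n ≤ |(a:ℝ)| → |(a:ℝ)| ≤ M * n → |(b:ℝ)| ≤ M * n →
      |(c:ℝ)| ≤ M * n → h * (n:ℝ) ^ 2 ≤ |Hf a b c| → ∀ w : ℤ → ℝ, (∀ d, |w d| ≤ W) →
      (∀ d, |w (d + 1) - w d| ≤ W / n) →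
      |∑ d ∈ Finset.Icc (-((M * n : ℕ):ℤ)) ((M * n : ℕ):ℤ),
        w d * ((ecount (C * (n:ℝ) ^ 2) a b c d : ℝ) - 2 * (C * (n:ℝ) ^ 2) / |Hf a b c|)| ≤ ε * n := by
  have hM' : (0:ℝ) < M := by exact_mod_cast hM
  set ε' := ε / (2 * (W + 3 * M * W)) with hε'
  have hε0 : 0 < ε' := by positivity
  obtain ⟨T0, hT0, H⟩ := eq_B1 (27 * κ / (99 * M ^ 2)) (27 * M / h) (3 * M) ε' (by positivity)
    (by positivity) (by positivity) hε0
  refine ⟨⌈T0⌉₊, fun n hn => ?_⟩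
  have hnT : T0 ≤ n := Nat.ceil_le.mp hn
  have hn0 : (0:ℝ) < n := lt_of_lt_of_le hT0 hnT
  have hn1 : 0 < n := by exact_mod_cast hn0
  refine ⟨hn1, ?_⟩
  intro a b c ha1 ha2 hb hc hHl w hw1 hw2
  have hHpos : 0 < |Hf a b c| := lt_of_lt_of_le (by positivity) hHl
  have hHne : Hf a b c ≠ 0 := abs_pos.mp hHpos
  have hHu : |Hf a b c| ≤ 99 * (M:ℝ) ^ 2 * n ^ 2 := by
    unfold Hf
    have e1 : |72 * (a:ℝ) * c - 27 * (b:ℝ) ^ 2| ≤ 72 * (|(a:ℝ)| * |(c:ℝ)|) + 27 * |(b:ℝ)| ^ 2 := by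
      refine (abs_sub _ _).trans ?_
      rw [abs_mul, abs_mul, abs_mul, abs_pow]; norm_num; linarith
    have e2 : |(a:ℝ)| * |(c:ℝ)| ≤ (M * n) * (M * n) := by gcongr
    have e3 : |(b:ℝ)| ^ 2 ≤ (M * n) ^ 2 := by gcongr
    nlinarith
  have hα : |27 * (a:ℝ) / Hf a b c| = 27 * |(a:ℝ)| / |Hf a b c| := by
    rw [abs_div, abs_mul]; norm_num
  have hα1 : 27 * κ / (99 * (M:ℝ) ^ 2) / n ≤ |27 * (a:ℝ) / Hf a b c| := by
    rw [hα, div_div, div_le_div_iff₀ (by positivity) hHpos]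
    calc 27 * κ * |Hf a b c| ≤ 27 * κ * (99 * (M:ℝ) ^ 2 * n ^ 2) := by gcongr
      _ = 27 * (κ * n) * (99 * (M:ℝ) ^ 2 * n) := by ring
      _ ≤ 27 * |(a:ℝ)| * (99 * (M:ℝ) ^ 2 * n) := by gcongr
  have hα2 : |27 * (a:ℝ) / Hf a b c| ≤ 27 * M / h / n := by
    rw [hα, div_div, div_le_div_iff₀ hHpos (by positivity)]
    calc 27 * |(a:ℝ)| * (h * n) ≤ 27 * (M * n) * (h * n) := by gcongr
      _ = 27 * M * (h * n ^ 2) := by ring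
      _ ≤ 27 * M * |Hf a b c| := by gcongr
  set m := M * n with hm
  set L := C * (n:ℝ) ^ 2 / |Hf a b c| with hL
  have hN : ∀ k ≤ 2 * m + 1, (k:ℝ) ≤ 3 * M * n := by
    intro k hk
    have h1 : k ≤ 3 * M * n := by
      have : 0 < M * n := Nat.mul_pos hM hn1
      rw [hm] at hk; nlinarith
    exact_mod_cast h1
  have P1 : ∀ k ≤ 2 * m + 1, |∑ j ∈ Finset.range k,
      ((Int.fract (-(Gf a b c ((j:ℤ) - m : ℤ) / Hf a b c) - L) - 1 / 2) +
       (Int.fract (Gf a b c ((j:ℤ) - m : ℤ) / Hf a b c - L) - 1 / 2))| ≤ 2 * (ε' * n) := by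
    intro k hk
    rw [Finset.sum_add_distrib]
    refine (abs_add_le _ _).trans ?_
    have q1 := H n hnT (27 * a / Hf a b c) ((-54 * a * m - 9 * b * c) / Hf a b c)
      ((27 * a * m ^ 2 + 9 * b * c * m + 2 * c ^ 3) / Hf a b c - L) hα1 hα2 k (hN k hk)
    have q2 := H n hnT (-(27 * a / Hf a b c)) (-((-54 * a * m - 9 * b * c) / Hf a b c))
      (-((27 * a * m ^ 2 + 9 * b * c * m + 2 * c ^ 3) / Hf a b c) - L) (by rwa [abs_neg])
      (by rwa [abs_neg]) k (hN k hk)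
    have r1 : ∀ j : ℕ, Gf a b c ((j:ℤ) - m : ℤ) / Hf a b c - L =
        27 * a / Hf a b c * (j:ℝ) ^ 2 + (-54 * a * m - 9 * b * c) / Hf a b c * j +
        ((27 * a * m ^ 2 + 9 * b * c * m + 2 * c ^ 3) / Hf a b c - L) := by
      intro j; unfold Gf; push_cast; ring
    have r2 : ∀ j : ℕ, -(Gf a b c ((j:ℤ) - m : ℤ) / Hf a b c) - L =
        -(27 * a / Hf a b c) * (j:ℝ) ^ 2 + -((-54 * a * m - 9 * b * c) / Hf a b c) * j +
        (-((27 * a * m ^ 2 + 9 * b * c * m + 2 * c ^ 3) / Hf a b c) - L) := by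
      intro j; unfold Gf; push_cast; ring
    simp_rw [r1, r2]
    linarith
  rw [sum_Icc_shift]
  have key := abel_bd (fun j => w ((j:ℤ) - m))
    (fun j => ((Int.fract (-(Gf a b c ((j:ℤ) - m : ℤ) / Hf a b c) - L) - 1 / 2) +
       (Int.fract (Gf a b c ((j:ℤ) - m : ℤ) / Hf a b c - L) - 1 / 2))) (2 * m + 1)
    (2 * (ε' * n)) W (W / n) P1 (fun j => hw1 _) (by
      intro j
      have := hw2 ((j:ℤ) - m)
      rw [show ((j + 1 : ℕ):ℤ) - m = (j:ℤ) - m + 1 by push_cast; ring]; exact this)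
  have e1 : ∀ j : ℕ, (ecount (C * (n:ℝ) ^ 2) a b c ((j:ℤ) - m) : ℝ) -
      2 * (C * (n:ℝ) ^ 2) / |Hf a b c| =
      ((Int.fract (-(Gf a b c ((j:ℤ) - m : ℤ) / Hf a b c) - L) - 1 / 2) +
       (Int.fract (Gf a b c ((j:ℤ) - m : ℤ) / Hf a b c - L) - 1 / 2)) := by
    intro j
    rw [ecount_eq _ (by positivity) _ _ _ _ hHne, ← hL]; ring
  simp_rw [e1]
  refine key.trans ?_
  have h9 : ((2 * m + 1 : ℕ):ℝ) * (W / n) ≤ 3 * M * W := by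
    have := hN _ le_rfl
    calc ((2 * m + 1 : ℕ):ℝ) * (W / n) ≤ 3 * M * n * (W / n) := by gcongr
      _ = 3 * M * W := by field_simp
  calc (W + ((2 * m + 1 : ℕ):ℝ) * (W / n)) * (2 * (ε' * n)) ≤ (W + 3 * M * W) * (2 * (ε' * n)) := by
        gcongr
    _ = ε * n := by rw [hε']; field_simp



open MeasureTheory Pointwise in
lemma riemann4 (F : (Fin 4 → ℝ) → ℝ) (hF : Continuous F) (M : ℕ)
    (hM : ∀ v, F v ≠ 0 → ∀ i, |v i| ≤ M) :
    Tendsto (fun n : ℕ => (∑ a ∈ Finset.Icc (-((M * n : ℕ):ℤ)) ((M * n : ℕ):ℤ),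
      ∑ b ∈ Finset.Icc (-((M * n : ℕ):ℤ)) ((M * n : ℕ):ℤ),
      ∑ c ∈ Finset.Icc (-((M * n : ℕ):ℤ)) ((M * n : ℕ):ℤ),
      ∑ d ∈ Finset.Icc (-((M * n : ℕ):ℤ)) ((M * n : ℕ):ℤ),
        F ![(a:ℝ) / n, (b:ℝ) / n, (c:ℝ) / n, (d:ℝ) / n]) / (n:ℝ) ^ 4) atTop (nhds (∫ v, F v)) := by
  set s : Set (Fin 4 → ℝ) := Set.Icc (fun _ => -(M:ℝ)) (fun _ => (M:ℝ)) with hs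
  have h := tendsto_tsum_div_pow_atTop_integral s F hF (Metric.isBounded_Icc _ _)
    measurableSet_Icc ((convex_Icc _ _).addHaar_frontier volume)
  have h1 : ∫ v in s, F v = ∫ v, F v := by
    apply setIntegral_eq_integral_of_forall_compl_eq_zero
    intro x hx
    by_contra hne
    apply hx
    have := hM x hne
    rw [hs, Set.mem_Icc]
    exact ⟨fun i => (abs_le.mp (this i)).1, fun i => (abs_le.mp (this i)).2⟩
  rw [h1] at h
  refine h.congr' ?_
  filter_upwards [eventually_gt_atTop 0] with n hn
  have hn0 : (0:ℝ) < n := by exact_mod_cast hn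
  rw [Fintype.card_fin]
  congr 1
  set I := Finset.Icc (-((M * n : ℕ):ℤ)) ((M * n : ℕ):ℤ) with hI
  set φ : ℤ × ℤ × ℤ × ℤ → (Fin 4 → ℝ) := fun p =>
    ![(p.1:ℝ) / n, (p.2.1:ℝ) / n, (p.2.2.1:ℝ) / n, (p.2.2.2:ℝ) / n] with hφ
  have hinj : Function.Injective φ := by
    intro p q hpq
    have h0 := congrFun hpq 0
    have h1 := congrFun hpq 1
    have h2 := congrFun hpq 2
    have h3 := congrFun hpq 3
    simp [hφ, hn0.ne', div_left_inj'] at h0 h1 h2 h3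
    ext <;> assumption
  rw [tsum_subtype (s ∩ (n:ℝ)⁻¹ • (Submodule.span ℤ (Set.range (Pi.basisFun ℝ (Fin 4))) : Set (Fin 4 → ℝ))) F]
  have hIa : ∀ z : ℤ, z ∈ I ↔ |(z:ℝ) / n| ≤ M := by
    intro z
    rw [abs_div, Nat.abs_cast, div_le_iff₀ hn0, hI, Finset.mem_Icc, abs_le]
    constructor
    · rintro ⟨h1, h2⟩; exact ⟨by exact_mod_cast h1, by exact_mod_cast h2⟩
    · rintro ⟨h1, h2⟩; exact ⟨by exact_mod_cast h1, by exact_mod_cast h2⟩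
  have hmem : ∀ x : Fin 4 → ℝ, x ∈ s ∩ (n:ℝ)⁻¹ • (Submodule.span ℤ (Set.range (Pi.basisFun ℝ (Fin 4))) : Set (Fin 4 → ℝ))
      ↔ x ∈ (I ×ˢ I ×ˢ I ×ˢ I).image φ := by
    intro x
    rw [Set.mem_inter_iff, Set.mem_smul_set_iff_inv_smul_mem₀ (by positivity), inv_inv,
      SetLike.mem_coe, (Pi.basisFun ℝ (Fin 4)).mem_span_iff_repr_mem ℤ, Finset.mem_image]
    have hs' : x ∈ s ↔ ∀ i, |x i| ≤ M := by
      rw [hs, Set.mem_Icc]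
      exact ⟨fun h i => abs_le.mpr ⟨h.1 i, h.2 i⟩, fun h => ⟨fun i => (abs_le.mp (h i)).1,
        fun i => (abs_le.mp (h i)).2⟩⟩
    rw [hs']
    constructor
    · rintro ⟨h1, h2⟩
      choose z hz using h2
      have hz' : ∀ i, (z i : ℝ) / n = x i := by
        intro i; have := hz i
        simp at this; rw [this]; field_simp
      refine ⟨(z 0, z 1, z 2, z 3), ?_, ?_⟩
      · simp only [Finset.mem_product, hIa, hz']
        exact ⟨h1 0, h1 1, h1 2, h1 3⟩
      · ext i; fin_cases i <;> simp [hφ, hz']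
    · rintro ⟨p, hp, rfl⟩
      simp only [Finset.mem_product, hIa] at hp
      constructor
      · intro i; fin_cases i
        exacts [hp.1, hp.2.1, hp.2.2.1, hp.2.2.2]
      · intro i; fin_cases i
        · exact ⟨p.1, by simp [hφ]; field_simp⟩
        · exact ⟨p.2.1, by simp [hφ]; field_simp⟩
        · exact ⟨p.2.2.1, by simp [hφ]; field_simp⟩
        · exact ⟨p.2.2.2, by simp [hφ]; field_simp⟩
  rw [tsum_eq_sum (s := (I ×ˢ I ×ˢ I ×ˢ I).image φ)]
  · rw [Finset.sum_congr rfl (g := F)]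
    · rw [Finset.sum_image hinj.injOn]
      simp only [Finset.sum_product, hφ]
    · intro x hx
      rw [Set.indicator_of_mem ((hmem x).mpr hx)]
  · intro x hx
    rw [Set.indicator_of_notMem (fun h => hx ((hmem x).mp h))]

open MeasureTheory in
lemma vague (C : ℝ) (hC : 0 < C) (w : (Fin 4 → ℝ) → ℝ) (Kw : NNReal) (hw : LipschitzWith Kw w)
    (M : ℕ) (hM0 : 0 < M) (hM : ∀ v, w v ≠ 0 → ∀ i, |v i| ≤ M) (κ h : ℝ) (hκ : 0 < κ) (hh : 0 < h)
    (hsupp : ∀ v, w v ≠ 0 → κ ≤ |v 0| ∧ h ≤ |Hf (v 0) (v 1) (v 2)|) :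
    Tendsto (fun n : ℕ => (∑ a ∈ Finset.Icc (-((M * n : ℕ):ℤ)) ((M * n : ℕ):ℤ),
      ∑ b ∈ Finset.Icc (-((M * n : ℕ):ℤ)) ((M * n : ℕ):ℤ),
      ∑ c ∈ Finset.Icc (-((M * n : ℕ):ℤ)) ((M * n : ℕ):ℤ),
      ∑ d ∈ Finset.Icc (-((M * n : ℕ):ℤ)) ((M * n : ℕ):ℤ),
        w ![(a:ℝ) / n, (b:ℝ) / n, (c:ℝ) / n, (d:ℝ) / n] * (ecount (C * (n:ℝ) ^ 2) a b c d : ℝ))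
          / (n:ℝ) ^ 4) atTop (nhds (∫ v, w v * (2 * C / |Hf (v 0) (v 1) (v 2)|))) := by
  -- bounded
  have hM' : (0:ℝ) < M := by exact_mod_cast hM0
  obtain ⟨W0, hW0⟩ : ∃ W0 : ℝ, ∀ v, |w v| ≤ W0 := by
    refine ⟨|w 0| + Kw * M, fun v => ?_⟩
    by_cases hv : w v = 0
    · rw [hv, abs_zero]; positivity
    have h1 := hw.dist_le_mul v 0
    have h2 : dist v 0 ≤ M := by
      rw [dist_zero_right]
      exact (pi_norm_le_iff_of_nonneg hM'.le).mpr fun i => hM v hv i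
    rw [Real.dist_eq] at h1
    have h3 := abs_sub_abs_le_abs_sub (w v) (w 0)
    have : (Kw:ℝ) * dist v 0 ≤ Kw * M := by gcongr
    linarith
  set W := W0 + Kw + 1 with hW
  have hW00 : 0 ≤ W0 := (abs_nonneg _).trans (hW0 0)
  have hWpos : 0 < W := by positivity
  -- continuity
  set F : (Fin 4 → ℝ) → ℝ := fun v => w v * (2 * C / max h |Hf (v 0) (v 1) (v 2)|) with hF
  have hFe : ∀ v, w v * (2 * C / |Hf (v 0) (v 1) (v 2)|) = F v := by
    intro v
    by_cases hv : w v = 0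
    · simp [hF, hv]
    · simp only [hF]; rw [max_eq_right (hsupp v hv).2]
  have hFc : Continuous F := by
    refine hw.continuous.mul (Continuous.div continuous_const ?_ ?_)
    · unfold Hf; fun_prop
    · intro v; exact (lt_of_lt_of_le hh (le_max_left _ _)).ne'
  have hFM : ∀ v, F v ≠ 0 → ∀ i, |v i| ≤ M := fun v hv => hM v (left_ne_zero_of_mul hv)
  have hR := riemann4 F hFc M hFM
  simp_rw [hFe]
  rw [← tendsto_sub_nhds_zero_iff] at hR ⊢
  rw [Metric.tendsto_atTop] at hR ⊢
  intro ε hε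
  obtain ⟨n1, hn1⟩ := hR (ε / 2) (by positivity)
  obtain ⟨n0, hn0⟩ := fibre C κ h (ε / (4 * (3 * M) ^ 3)) W M hM0 hC hκ hh (by positivity) hWpos
  refine ⟨max n0 n1, fun n hn => ?_⟩
  obtain ⟨hnpos, hfib⟩ := hn0 n (le_trans (le_max_left _ _) hn)
  have hR1 := hn1 n (le_trans (le_max_right _ _) hn)
  have hnp : (0:ℝ) < n := by exact_mod_cast hnpos
  set I := Finset.Icc (-((M * n : ℕ):ℤ)) ((M * n : ℕ):ℤ) with hI
  have hcard : (I.card : ℝ) ≤ 3 * M * n := by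
    rw [hI, Int.card_Icc]
    have : ((((M * n : ℕ):ℤ) + 1 - -((M * n : ℕ):ℤ)).toNat) = 2 * (M * n) + 1 := by omega
    rw [this]
    have : 0 < M * n := Nat.mul_pos hM0 hnpos
    have h2 : 2 * (M * n) + 1 ≤ 3 * M * n := by nlinarith
    exact_mod_cast h2
  have hIa : ∀ z : ℤ, z ∈ I ↔ |(z:ℝ)| ≤ M * n := by
    intro z
    rw [hI, Finset.mem_Icc, abs_le]
    constructor
    · rintro ⟨h1, h2⟩; exact ⟨by exact_mod_cast h1, by exact_mod_cast h2⟩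
    · rintro ⟨h1, h2⟩; exact ⟨by exact_mod_cast h1, by exact_mod_cast h2⟩
  have hterm : ∀ a ∈ I, ∀ b ∈ I, ∀ c ∈ I,
      |∑ d ∈ I, (w ![(a:ℝ) / n, (b:ℝ) / n, (c:ℝ) / n, (d:ℝ) / n] *
        (ecount (C * (n:ℝ) ^ 2) a b c d : ℝ) - F ![(a:ℝ) / n, (b:ℝ) / n, (c:ℝ) / n, (d:ℝ) / n])|
        ≤ ε / (4 * (3 * M) ^ 3) * n := by
    intro a ha b hb c hc
    by_cases hz : ∀ d : ℤ, w ![(a:ℝ) / n, (b:ℝ) / n, (c:ℝ) / n, (d:ℝ) / n] = 0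
    · simp only [hF, hz]; simp; positivity
    push Not at hz
    obtain ⟨d0, hd0⟩ := hz
    obtain ⟨k1, k2⟩ := hsupp _ hd0
    simp only [Matrix.cons_val_zero, Matrix.cons_val_one, Matrix.cons_val] at k1 k2
    have hHs : Hf ((a:ℝ) / n) ((b:ℝ) / n) ((c:ℝ) / n) = Hf a b c / (n:ℝ) ^ 2 := by
      unfold Hf; field_simp
    rw [hHs, abs_div, abs_of_pos (by positivity : (0:ℝ) < (n:ℝ) ^ 2),
      le_div_iff₀ (by positivity)] at k2
    rw [abs_div, Nat.abs_cast, le_div_iff₀ hnp] at k1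
    have := hfib a b c k1 ((hIa a).mp ha) ((hIa b).mp hb) ((hIa c).mp hc) k2
      (fun d => w ![(a:ℝ) / n, (b:ℝ) / n, (c:ℝ) / n, (d:ℝ) / n])
      (fun d => (hW0 _).trans (by rw [hW]; have := Kw.coe_nonneg; linarith)) (by
        intro d
        have h1 := hw.dist_le_mul ![(a:ℝ) / n, (b:ℝ) / n, (c:ℝ) / n, ((d + 1 : ℤ):ℝ) / n]
          ![(a:ℝ) / n, (b:ℝ) / n, (c:ℝ) / n, (d:ℝ) / n]
        have h2 : dist ![(a:ℝ) / n, (b:ℝ) / n, (c:ℝ) / n, ((d + 1 : ℤ):ℝ) / n]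
          ![(a:ℝ) / n, (b:ℝ) / n, (c:ℝ) / n, (d:ℝ) / n] ≤ 1 / n := by
          rw [dist_pi_le_iff (by positivity)]
          intro i
          fin_cases i
          · simp
          · simp
          · simp
          · simp only [Real.dist_eq]
            simp
            rw [← sub_div, add_sub_cancel_left, abs_of_pos (by positivity), one_div]
        rw [Real.dist_eq] at h1
        refine h1.trans ?_
        calc (Kw:ℝ) * _ ≤ Kw * (1 / n) := by gcongr
          _ = Kw / n := by ring
          _ ≤ W / n := by gcongr; linarith)
    refine le_trans (le_of_eq ?_) this
    congr 1
    refine Finset.sum_congr rfl fun d _ => ?_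
    rw [mul_sub]
    congr 1
    rw [← hFe]
    simp only [Matrix.cons_val_zero, Matrix.cons_val_one, Matrix.cons_val]
    rw [hHs, abs_div, abs_of_pos (by positivity : (0:ℝ) < (n:ℝ) ^ 2)]
    congr 1
    have : |Hf a b c| ≠ 0 := (lt_of_lt_of_le (by positivity) k2).ne'
    field_simp
  have hbig : |∑ a ∈ I, ∑ b ∈ I, ∑ c ∈ I,
      ∑ d ∈ I, (w ![(a:ℝ) / n, (b:ℝ) / n, (c:ℝ) / n, (d:ℝ) / n] *
        (ecount (C * (n:ℝ) ^ 2) a b c d : ℝ) - F ![(a:ℝ) / n, (b:ℝ) / n, (c:ℝ) / n, (d:ℝ) / n])|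
        ≤ ε / 4 * n ^ 4 := by
    have g : ∀ (f : ℤ → ℝ) (U : ℝ), (∀ x ∈ I, |f x| ≤ U) → 0 ≤ U → |∑ x ∈ I, f x| ≤ 3 * M * n * U := by
      intro f U hf hU
      refine (Finset.abs_sum_le_sum_abs _ _).trans ((Finset.sum_le_sum hf).trans ?_)
      rw [Finset.sum_const, nsmul_eq_mul]; gcongr
    have p : 0 ≤ ε / (4 * (3 * M) ^ 3) * n := by positivity
    refine (g _ _ (fun a ha => g _ _ (fun b hb => g _ _ (fun c hc => hterm a ha b hb c hc) p)
      (by positivity)) (by positivity)).trans (le_of_eq ?_)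
    field_simp
  simp only [Finset.sum_sub_distrib] at hbig
  rw [Real.dist_eq, sub_zero] at hR1 ⊢
  set S1 := ∑ a ∈ I, ∑ b ∈ I, ∑ c ∈ I,
      ∑ d ∈ I, w ![(a:ℝ) / n, (b:ℝ) / n, (c:ℝ) / n, (d:ℝ) / n] *
        (ecount (C * (n:ℝ) ^ 2) a b c d : ℝ)
  set S2 := ∑ a ∈ I, ∑ b ∈ I, ∑ c ∈ I,
      ∑ d ∈ I, F ![(a:ℝ) / n, (b:ℝ) / n, (c:ℝ) / n, (d:ℝ) / n]
  have q : |S1 / (n:ℝ) ^ 4 - S2 / (n:ℝ) ^ 4| ≤ ε / 4 := by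
    rw [← sub_div, abs_div, abs_of_pos (by positivity : (0:ℝ) < (n:ℝ) ^ 4),
      div_le_iff₀ (by positivity)]
    exact hbig
  have := abs_add_le (S1 / (n:ℝ) ^ 4 - S2 / (n:ℝ) ^ 4) (S2 / (n:ℝ) ^ 4 - ∫ v, F v)
  rw [sub_add_sub_cancel] at this
  linarith



/-! Part 3: parametrisation and reduction -/

structure Par (a b c d e x s b0 β : ℝ) : Prop where
  hs : 0 < s
  hD : 0 < 16 * a ^ 2 * s - 32 * a * β + b0 ^ 2
  hb : b = b0 + 4 * a * x
  hc : c = (8 * β - 6 * a * s) + 3 * b0 * x + 6 * a * x ^ 2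
  hd : d = -b0 * s + 2 * (8 * β - 6 * a * s) * x + 3 * b0 * x ^ 2 + 4 * a * x ^ 3
  he : e = a * s ^ 2 - b0 * s * x + (8 * β - 6 * a * s) * x ^ 2 + b0 * x ^ 3 + a * x ^ 4

def If (a b c d e : ℝ) : ℝ := 12 * a * e - 3 * b * d + c ^ 2

namespace Par
variable {a b c d e x s b0 β : ℝ}

lemma I_eq (h : Par a b c d e x s b0 β) :
    If a b c d e = 3 * s * (16 * a ^ 2 * s - 32 * a * β + b0 ^ 2) + 64 * β ^ 2 := by
  unfold If; rw [h.hb, h.hc, h.hd, h.he]; ring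

lemma J_eq (h : Par a b c d e x s b0 β) :
    e * Hf a b c - Gf a b c d = 512 * β ^ 3 - 24 * If a b c d e * β := by
  rw [h.I_eq]; unfold Hf Gf; rw [h.hb, h.hc, h.hd, h.he]; ring

lemma H_eq (h : Par a b c d e x s b0 β) :
    Hf a b c + 288 * a * β = -27 * (16 * a ^ 2 * s - 32 * a * β + b0 ^ 2) := by
  unfold Hf; rw [h.hb, h.hc]; ring

lemma x_eq (h : Par a b c d e x s b0 β) :
    x * (Hf a b c + 288 * a * β) = 54 * a * d - 9 * b * c + 72 * β * b := by
  unfold Hf; rw [h.hb, h.hc, h.hd]; ring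

lemma s_eq (h : Par a b c d e x s b0 β) :
    6 * a * s = 8 * β - (c - 3 * b * x + 6 * a * x ^ 2) := by
  rw [h.hb, h.hc]; ring

lemma beta_lt (h : Par a b c d e x s b0 β) : 64 * β ^ 2 < If a b c d e := by
  rw [h.I_eq]; have := mul_pos h.hs h.hD; nlinarith

lemma unique {x' s' b0' β' : ℝ} (ha : a ≠ 0) (h : Par a b c d e x s b0 β)
    (h' : Par a b c d e x' s' b0' β') : x = x' ∧ s = s' := by
  have h1 := h.beta_lt
  have h2 := h'.beta_lt
  have hβ : β = β' := by
    have e1 : (β - β') * (512 * (β ^ 2 + β * β' + β' ^ 2) - 24 * If a b c d e) = 0 := by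
      have := h.J_eq; have := h'.J_eq; linear_combination h'.J_eq - h.J_eq
    rcases mul_eq_zero.mp e1 with h3 | h3
    · linarith
    · nlinarith [sq_nonneg (β - β')]
  subst hβ
  have hD := h.hD
  have hne : Hf a b c + 288 * a * β ≠ 0 := by rw [h.H_eq]; nlinarith
  have hx : x = x' := mul_right_cancel₀ hne (h.x_eq.trans h'.x_eq.symm)
  subst hx
  refine ⟨rfl, ?_⟩
  have := h.s_eq.trans h'.s_eq.symm
  exact mul_left_cancel₀ (by simpa using ha : 6 * a ≠ 0) this

lemma factor (ha : a ≠ 0) (h : Par a b c d e x s b0 β) : ∃ R1 R2 : ℝ, R1 ≠ R2 ∧ ∀ z : ℝ,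
    a * z ^ 4 + b * z ^ 3 + c * z ^ 2 + d * z + e =
      a * ((z + x) ^ 2 + R1 * (z + x) - s) * ((z + x) ^ 2 + R2 * (z + x) - s) := by
  set q := Real.sqrt (16 * a ^ 2 * s - 32 * a * β + b0 ^ 2) with hq
  have hq0 : 0 < q := Real.sqrt_pos.mpr h.hD
  have hq2 : q ^ 2 = 16 * a ^ 2 * s - 32 * a * β + b0 ^ 2 := Real.sq_sqrt h.hD.le
  refine ⟨(b0 + q) / (2 * a), (b0 - q) / (2 * a), ?_, fun z => ?_⟩
  · intro hcon
    rw [div_left_inj' (by simpa using ha)] at hcon; linarith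
  · rw [h.hb, h.hc, h.hd, h.he]
    have : a * ((z + x) ^ 2 + (b0 + q) / (2 * a) * (z + x) - s) *
        ((z + x) ^ 2 + (b0 - q) / (2 * a) * (z + x) - s) =
        a * ((z + x) ^ 2 - s) ^ 2 + b0 * (z + x) * ((z + x) ^ 2 - s) +
          (b0 ^ 2 - q ^ 2) / (4 * a) * (z + x) ^ 2 := by field_simp; ring
    rw [this, hq2]
    have : (b0 ^ 2 - (16 * a ^ 2 * s - 32 * a * β + b0 ^ 2)) / (4 * a) = 8 * β - 4 * a * s := by
      field_simp; ring
    rw [this]; ring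

lemma ncard_roots (ha : a ≠ 0) (h : Par a b c d e x s b0 β) :
    Set.ncard {z : ℝ | a * z ^ 4 + b * z ^ 3 + c * z ^ 2 + d * z + e = 0} = 4 := by
  obtain ⟨R1, R2, hR, hf⟩ := h.factor ha
  have hs := h.hs
  have key : ∀ R z : ℝ, (z + x) ^ 2 + R * (z + x) - s = 0 ↔
      z = -x + (-R + Real.sqrt (R ^ 2 + 4 * s)) / 2 ∨
      z = -x + (-R - Real.sqrt (R ^ 2 + 4 * s)) / 2 := by
    intro R z
    have h2 := Real.sq_sqrt (by positivity : 0 ≤ R ^ 2 + 4 * s)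
    set q := Real.sqrt (R ^ 2 + 4 * s)
    have : (z + x) ^ 2 + R * (z + x) - s =
        (z - (-x + (-R + q) / 2)) * (z - (-x + (-R - q) / 2)) := by
      linear_combination (1 / 4) * h2
    rw [this, mul_eq_zero, sub_eq_zero, sub_eq_zero]
  set z1 := -x + (-R1 + Real.sqrt (R1 ^ 2 + 4 * s)) / 2 with hz1
  set z2 := -x + (-R1 - Real.sqrt (R1 ^ 2 + 4 * s)) / 2 with hz2
  set z3 := -x + (-R2 + Real.sqrt (R2 ^ 2 + 4 * s)) / 2 with hz3
  set z4 := -x + (-R2 - Real.sqrt (R2 ^ 2 + 4 * s)) / 2 with hz4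
  have hset : {z : ℝ | a * z ^ 4 + b * z ^ 3 + c * z ^ 2 + d * z + e = 0} = {z1, z2, z3, z4} := by
    ext z
    rw [Set.mem_ofPred_eq, hf, mul_eq_zero, mul_eq_zero, key, key]
    simp only [Set.mem_insert_iff, Set.mem_singleton_iff, ha, false_or]
    tauto
  rw [hset]
  have hp : ∀ R : ℝ, 0 < Real.sqrt (R ^ 2 + 4 * s) := fun R => Real.sqrt_pos.mpr (by positivity)
  have hdis : ∀ z, (z + x) ^ 2 + R1 * (z + x) - s = 0 → (z + x) ^ 2 + R2 * (z + x) - s = 0 → False := by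
    intro z k1 k2
    have : (R1 - R2) * (z + x) = 0 := by linear_combination k1 - k2
    rcases mul_eq_zero.mp this with h | h
    · exact hR (by linarith)
    · rw [h] at k1; nlinarith
  have n12 : z1 ≠ z2 := by rw [hz1, hz2]; have := hp R1; intro h; linarith
  have n34 : z3 ≠ z4 := by rw [hz3, hz4]; have := hp R2; intro h; linarith
  have r1 := (key R1 z1).mpr (Or.inl rfl)
  have r2 := (key R1 z2).mpr (Or.inr rfl)
  have r3 := (key R2 z3).mpr (Or.inl rfl)
  have r4 := (key R2 z4).mpr (Or.inr rfl)
  have n13 : z1 ≠ z3 := fun h => hdis z1 r1 (h ▸ r3)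
  have n14 : z1 ≠ z4 := fun h => hdis z1 r1 (h ▸ r4)
  have n23 : z2 ≠ z3 := fun h => hdis z2 r2 (h ▸ r3)
  have n24 : z2 ≠ z4 := fun h => hdis z2 r2 (h ▸ r4)
  rw [Set.ncard_insert_of_notMem (by simp [n12, n13, n14]) (Set.toFinite _),
    Set.ncard_insert_of_notMem (by simp [n23, n24]) (Set.toFinite _), Set.ncard_pair n34]

end Par

lemma par_of_beta {a b c d e β x s : ℝ} (ha : a ≠ 0)
    (hJ : e * Hf a b c - Gf a b c d = 512 * β ^ 3 - 24 * If a b c d e * β)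
    (hH : Hf a b c + 288 * a * β < 0)
    (hx : x * (Hf a b c + 288 * a * β) = 54 * a * d - 9 * b * c + 72 * β * b)
    (hs : 6 * a * s = 8 * β - (c - 3 * b * x + 6 * a * x ^ 2)) (hs0 : 0 < s) :
    Par a b c d e x s (b - 4 * a * x) β := by
  have hcc : c = (8 * β - 6 * a * s) + 3 * (b - 4 * a * x) * x + 6 * a * x ^ 2 := by
    linear_combination hs
  set b0 := b - 4 * a * x with hb0
  have hbb : b = b0 + 4 * a * x := by rw [hb0]; ring
  have hDD : Hf a b c + 288 * a * β = -27 * (16 * a ^ 2 * s - 32 * a * β + b0 ^ 2) := by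
    unfold Hf; rw [hcc, hbb]; ring
  have hdd : d = -b0 * s + 2 * (8 * β - 6 * a * s) * x + 3 * b0 * x ^ 2 + 4 * a * x ^ 3 := by
    have : (54 * a) * d = (54 * a) *
        (-b0 * s + 2 * (8 * β - 6 * a * s) * x + 3 * b0 * x ^ 2 + 4 * a * x ^ 3) := by
      rw [hDD] at hx
      rw [hcc, hbb] at hx
      linear_combination -hx
    exact mul_left_cancel₀ (by simpa using ha) this
  refine ⟨hs0, by nlinarith, hbb, hcc, hdd, ?_⟩
  have : (Hf a b c + 288 * a * β) * e = (Hf a b c + 288 * a * β) *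
      (a * s ^ 2 - b0 * s * x + (8 * β - 6 * a * s) * x ^ 2 + b0 * x ^ 3 + a * x ^ 4) := by
    have e1 : (Hf a b c + 288 * a * β) * e =
      Gf a b c d + 512 * β ^ 3 - 24 * β * (c ^ 2 - 3 * b * d) := by
      unfold If at hJ; linear_combination hJ
    rw [e1, hDD]
    unfold Gf
    rw [hdd, hcc, hbb]; ring
  exact mul_left_cancel₀ hH.ne this

lemma par_of_roots {a b c d e : ℝ} (ha : a ≠ 0)
    (h : Set.ncard {z : ℝ | a * z ^ 4 + b * z ^ 3 + c * z ^ 2 + d * z + e = 0} = 4) :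
    ∃ x s b0 β, Par a b c d e x s b0 β := by
  set S := {z : ℝ | a * z ^ 4 + b * z ^ 3 + c * z ^ 2 + d * z + e = 0} with hS
  have hfin : S.Finite := Set.finite_of_ncard_ne_zero (by rw [h]; norm_num)
  have hcard : hfin.toFinset.card = 4 := by rw [← Set.ncard_eq_toFinset_card S hfin, h]
  set θ := hfin.toFinset.orderEmbOfFin hcard with hθ
  have hmem : ∀ i, a * θ i ^ 4 + b * θ i ^ 3 + c * θ i ^ 2 + d * θ i + e = 0 := by
    intro i
    have := Finset.orderEmbOfFin_mem hfin.toFinset hcard i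
    rw [Set.Finite.mem_toFinset] at this
    exact this
  have l12 : θ 0 < θ 1 := θ.strictMono (by decide)
  have l23 : θ 1 < θ 2 := θ.strictMono (by decide)
  have l34 : θ 2 < θ 3 := θ.strictMono (by decide)
  have f1 := hmem 0
  have f2 := hmem 1
  have f3 := hmem 2
  have f4 := hmem 3
  generalize θ 0 = p at *
  generalize θ 1 = q at *
  generalize θ 2 = r at *
  generalize θ 3 = t at *
  have dd : ∀ y, y - p ≠ 0 → a * y ^ 4 + b * y ^ 3 + c * y ^ 2 + d * y + e = 0 →
      a * (y ^ 3 + y ^ 2 * p + y * p ^ 2 + p ^ 3) + b * (y ^ 2 + y * p + p ^ 2) + c * (y + p) + d = 0 := by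
    intro y hy hf
    apply mul_left_cancel₀ hy
    linear_combination hf - f1
  have d2 := dd q (by linarith : 0 < q - p).ne' f2
  have d3 := dd r (by linarith : 0 < r - p).ne' f3
  have d4 := dd t (by linarith : 0 < t - p).ne' f4
  have ddd : ∀ y, y - q ≠ 0 →
      a * (y ^ 3 + y ^ 2 * p + y * p ^ 2 + p ^ 3) + b * (y ^ 2 + y * p + p ^ 2) + c * (y + p) + d = 0 →
      a * (y ^ 2 + y * q + q ^ 2 + p * (y + q) + p ^ 2) + b * (y + q + p) + c = 0 := by
    intro y hy hf
    apply mul_left_cancel₀ hy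
    linear_combination hf - d2
  have t3 := ddd r (by linarith : 0 < r - q).ne' d3
  have t4 := ddd t (by linarith : 0 < t - q).ne' d4
  have hb : b = -a * (p + q + r + t) := by
    have : (t - r) * (a * (p + q + r + t) + b) = (t - r) * 0 := by linear_combination t4 - t3
    have := mul_left_cancel₀ (by linarith : 0 < t - r).ne' this
    linarith
  have hc : c = a * (p * q + p * r + p * t + q * r + q * t + r * t) := by
    rw [hb] at t3; linear_combination t3
  have hd : d = -a * (p * q * r + p * q * t + p * r * t + q * r * t) := by
    rw [hb, hc] at d2; linear_combination d2
  have he : e = a * (p * q * r * t) := by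
    rw [hb, hc, hd] at f1; linear_combination f1
  set m := q + t - p - r with hm
  have hm0 : 0 < m := by rw [hm]; linarith
  obtain ⟨x, hx⟩ : ∃ x, x * m = p * r - q * t := ⟨(p * r - q * t) / m, by field_simp⟩
  have hx1 : (x + p) * (x + r) = (x + q) * (x + t) := by rw [hm] at hx; linear_combination -hx
  have k1 : x + p < 0 := by
    have : (x + p) * m = -((q - p) * (t - p)) := by rw [hm] at hx ⊢; linear_combination hx
    have h2 : 0 < (q - p) * (t - p) := mul_pos (by linarith) (by linarith)
    by_contra hcon
    push Not at hcon
    nlinarith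
  have k2 : 0 < x + r := by
    have : (x + r) * m = (r - q) * (t - r) := by rw [hm] at hx ⊢; linear_combination hx
    have h2 : 0 < (r - q) * (t - r) := mul_pos (by linarith) (by linarith)
    by_contra hcon
    push Not at hcon
    nlinarith
  obtain ⟨s, hs⟩ : ∃ s, s = -((x + p) * (x + r)) := ⟨_, rfl⟩
  obtain ⟨R1, hR1⟩ : ∃ R, R = -(2 * x + p + r) := ⟨_, rfl⟩
  obtain ⟨R2, hR2⟩ : ∃ R, R = -(2 * x + q + t) := ⟨_, rfl⟩
  have g1 : p + r = -R1 - 2 * x := by rw [hR1]; ring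
  have g2 : q + t = -R2 - 2 * x := by rw [hR2]; ring
  have g3 : p * r = -s + x ^ 2 + x * R1 := by rw [hs, hR1]; ring
  have g4 : q * t = -s + x ^ 2 + x * R2 := by rw [hs, hx1, hR2]; ring
  have hs0 : 0 < s := by rw [hs]; exact neg_pos.mpr (mul_neg_of_neg_of_pos k1 k2)
  have hRm : R1 - R2 = m := by rw [hR1, hR2, hm]; ring
  have hb' : b = -a * ((p + r) + (q + t)) := by rw [hb]; ring
  have hc' : c = a * (p * r + q * t + (p + r) * (q + t)) := by rw [hc]; ring
  have hd' : d = -a * (p * r * (q + t) + q * t * (p + r)) := by rw [hd]; ring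
  have he' : e = a * ((p * r) * (q * t)) := by rw [he]; ring
  rw [g1, g2] at hb'
  rw [g1, g2, g3, g4] at hc' hd'
  rw [g3, g4] at he'
  refine ⟨x, s, a * (R1 + R2), a * (4 * s + R1 * R2) / 8, hs0, ?_, ?_, ?_, ?_, ?_⟩
  · have : 16 * a ^ 2 * s - 32 * a * (a * (4 * s + R1 * R2) / 8) + (a * (R1 + R2)) ^ 2 =
      (a * m) ^ 2 := by rw [← hRm]; ring
    rw [this]; positivity
  · rw [hb']; ring
  · rw [hc']; ring
  · rw [hd']; ring
  · rw [he']; ring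



namespace BQF

@[ext] lemma ext' {f g : BQF} (ha : f.a = g.a) (hb : f.b = g.b) (hc : f.c = g.c) (hd : f.d = g.d)
    (he : f.e = g.e) : f = g := by
  cases f; cases g; simp_all

def act (f : BQF) (p q r t : ℤ) : BQF where
  a := f.a * p ^ 4 + f.b * p ^ 3 * q + f.c * p ^ 2 * q ^ 2 + f.d * p * q ^ 3 + f.e * q ^ 4
  b := 4 * f.a * p ^ 3 * r + f.b * (3 * p ^ 2 * r * q + p ^ 3 * t) +
    f.c * (2 * p * r * q ^ 2 + 2 * p ^ 2 * q * t) + f.d * (r * q ^ 3 + 3 * p * q ^ 2 * t) +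
    4 * f.e * q ^ 3 * t
  c := 6 * f.a * p ^ 2 * r ^ 2 + f.b * (3 * p * r ^ 2 * q + 3 * p ^ 2 * r * t) +
    f.c * (r ^ 2 * q ^ 2 + 4 * p * r * q * t + p ^ 2 * t ^ 2) +
    f.d * (3 * r * q ^ 2 * t + 3 * p * q * t ^ 2) + 6 * f.e * q ^ 2 * t ^ 2
  d := 4 * f.a * r ^ 3 * p + f.b * (3 * r ^ 2 * p * t + r ^ 3 * q) +
    f.c * (2 * r * p * t ^ 2 + 2 * r ^ 2 * t * q) + f.d * (p * t ^ 3 + 3 * r * t ^ 2 * q) +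
    4 * f.e * t ^ 3 * q
  e := f.a * r ^ 4 + f.b * r ^ 3 * t + f.c * r ^ 2 * t ^ 2 + f.d * r * t ^ 3 + f.e * t ^ 4

lemma evalZ_act (f : BQF) (p q r t x y : ℤ) :
    (f.act p q r t).evalZ x y = f.evalZ (x * p + y * r) (x * q + y * t) := by
  unfold evalZ act; ring

lemma evalR_act (f : BQF) (p q r t : ℤ) (x y : ℝ) :
    (f.act p q r t).evalR x y = f.evalR (x * p + y * r) (x * q + y * t) := by
  unfold evalR act; push_cast; ring

lemma eq_of_evalZ {f g : BQF} (h : ∀ x y, f.evalZ x y = g.evalZ x y) : f = g := by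
  have h1 := h 1 0
  have h2 := h 0 1
  have h3 := h 1 1
  have h4 := h 1 (-1)
  have h5 := h 2 1
  unfold evalZ at *
  norm_num at *
  apply ext' <;> linarith

lemma equivalent_iff (f g : BQF) : Equivalent f g ↔ ∃ γ : Matrix (Fin 2) (Fin 2) ℤ, IsUnit γ.det ∧
    g = f.act (γ 0 0) (γ 0 1) (γ 1 0) (γ 1 1) := by
  constructor
  · rintro ⟨γ, h1, h2⟩
    refine ⟨γ, h1, eq_of_evalZ fun x y => ?_⟩
    rw [h2, evalZ_act]
  · rintro ⟨γ, h1, rfl⟩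
    exact ⟨γ, h1, fun x y => evalZ_act _ _ _ _ _ _ _⟩

lemma equiv_refl (f : BQF) : Equivalent f f :=
  ⟨1, by simp, fun x y => by simp⟩

lemma equiv_trans {f g h : BQF} (h1 : Equivalent f g) (h2 : Equivalent g h) : Equivalent f h := by
  obtain ⟨γ, u, hg⟩ := h1
  obtain ⟨δ, v, hh⟩ := h2
  refine ⟨δ * γ, by rw [Matrix.det_mul]; exact v.mul u, fun x y => ?_⟩
  rw [hh, hg]
  simp only [Matrix.mul_apply, Fin.sum_univ_two]
  congr 1 <;> ring

lemma equiv_symm {f g : BQF} (h1 : Equivalent f g) : Equivalent g f := by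
  obtain ⟨γ, u, hg⟩ := h1
  refine ⟨γ⁻¹, (Matrix.isUnit_nonsing_inv_det_iff).mpr u, fun x y => ?_⟩
  rw [hg]
  have h := Matrix.nonsing_inv_mul γ u
  have h00 := congrFun (congrFun h 0) 0
  have h01 := congrFun (congrFun h 0) 1
  have h10 := congrFun (congrFun h 1) 0
  have h11 := congrFun (congrFun h 1) 1
  simp [Matrix.mul_apply, Fin.sum_univ_two, -Matrix.inv_subsingleton] at h00 h01 h10 h11
  congr 1
  · linear_combination -x * h00 - y * h10
  · linear_combination -x * h01 - y * h11

def CP (f : BQF) (z : UpperHalfPlane) : Prop := ∃ (α : ℂ) (β : ℝ), |β| < ‖α‖ ∧ ∀ X Y : ℝ,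
  f.evalR X Y = (α * ((X:ℂ) + (z:ℂ) * Y) ^ 4).re + β * (Complex.normSq ((X:ℂ) + (z:ℂ) * Y)) ^ 2

lemma CP.act {f : BQF} {z : UpperHalfPlane} (h : f.CP z) (m : Matrix.SpecialLinearGroup (Fin 2) ℤ) :
    (f.act (m 1 1) (m 1 0) (m 0 1) (m 0 0)).CP (m • z) := by
  obtain ⟨α, β, h1, h2⟩ := h
  set j : ℂ := (m 1 0 : ℂ) * z + (m 1 1 : ℂ) with hj
  have hj0 : j ≠ 0 := UpperHalfPlane.denom_ne_zero (m : GL (Fin 2) ℝ) z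
  have hjn : 0 < ‖j‖ := norm_pos_iff.mpr hj0
  refine ⟨α * j ^ 4, β * Complex.normSq j ^ 2, ?_, fun X Y => ?_⟩
  · rw [abs_mul, norm_mul, norm_pow, Complex.normSq_eq_norm_sq,
      abs_of_nonneg (by positivity : (0:ℝ) ≤ (‖j‖ ^ 2) ^ 2), ← pow_mul]
    exact mul_lt_mul_of_pos_right h1 (by positivity)
  · rw [evalR_act, h2]
    have e : (((X * (m 1 1 : ℤ) + Y * (m 0 1 : ℤ) : ℝ) : ℂ) +
        (z:ℂ) * ((X * (m 1 0 : ℤ) + Y * (m 0 0 : ℤ) : ℝ) : ℂ)) =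
        j * ((X:ℂ) + ((m • z : UpperHalfPlane) : ℂ) * Y) := by
      rw [UpperHalfPlane.coe_specialLinearGroup_apply]
      simp only [algebraMap_int_eq, eq_intCast, Complex.ofReal_intCast]
      rw [← hj]
      have : j * ((X:ℂ) + (((m 0 0 : ℤ):ℂ) * z + ((m 0 1 : ℤ):ℂ)) / j * Y) =
        j * X + (((m 0 0 : ℤ):ℂ) * z + ((m 0 1 : ℤ):ℂ)) * Y := by field_simp
      rw [this, hj]; push_cast; ring
    rw [e, mul_pow, map_mul]
    ring_nf

def refl (f : BQF) : BQF := ⟨f.a, -f.b, f.c, -f.d, f.e⟩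

lemma refl_equiv (f : BQF) : Equivalent f f.refl := by
  refine ⟨!![1, 0; 0, -1], by simp [Matrix.det_fin_two], fun x y => ?_⟩
  unfold evalZ refl; simp; try ring

noncomputable def rz (z : UpperHalfPlane) : UpperHalfPlane := ⟨⟨-z.re, z.im⟩, z.im_pos⟩

lemma CP.refl {f : BQF} {z : UpperHalfPlane} (h : f.CP z) : f.refl.CP (rz z) := by
  obtain ⟨α, β, h1, h2⟩ := h
  refine ⟨(starRingEnd ℂ) α, β, by simpa using h1, fun X Y => ?_⟩
  have e1 : f.refl.evalR X Y = f.evalR X (-Y) := by unfold evalR BQF.refl; push_cast; ring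
  have e2 : ((X:ℂ) + (rz z : ℂ) * Y) = (starRingEnd ℂ) ((X:ℂ) + (z:ℂ) * ((-Y : ℝ) : ℂ)) := by
    apply Complex.ext <;> simp [rz]
  rw [e1, h2, e2, Complex.normSq_conj, ← map_pow (starRingEnd ℂ), ← map_mul (starRingEnd ℂ), Complex.conj_re]

lemma CP.par {f : BQF} {z : UpperHalfPlane} (h : f.CP z) :
    ∃ b0 β, Par f.a f.b f.c f.d f.e z.re (z.im ^ 2) b0 β := by
  obtain ⟨α, β, h1, h2⟩ := h
  have hy := z.im_pos
  have hne : ∀ X Y : ℝ, f.evalR X Y = α.re * ((X + z.re * Y) ^ 4 -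
      6 * (X + z.re * Y) ^ 2 * (z.im * Y) ^ 2 + (z.im * Y) ^ 4) -
      α.im * (4 * (X + z.re * Y) ^ 3 * (z.im * Y) - 4 * (X + z.re * Y) * (z.im * Y) ^ 3) +
      β * ((X + z.re * Y) ^ 2 + (z.im * Y) ^ 2) ^ 2 := by
    intro X Y
    rw [h2]
    have e : (X:ℂ) + (z:ℂ) * Y = ⟨X + z.re * Y, z.im * Y⟩ := by
      apply Complex.ext <;> simp
    rw [e, Complex.normSq_mk]
    simp only [pow_succ, pow_zero, one_mul, Complex.mul_re, Complex.mul_im]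
    ring
  have q1 := hne 1 0
  have q2 := hne 0 1
  have q3 := hne 1 1
  have q4 := hne 1 (-1)
  have q5 := hne 2 1
  have hαβ : β ^ 2 < α.re ^ 2 + α.im ^ 2 := by
    have : ‖α‖ ^ 2 = α.re ^ 2 + α.im ^ 2 := by
      rw [← Complex.normSq_eq_norm_sq, Complex.normSq_apply]; ring
    rw [← this, ← sq_abs]; gcongr
  unfold evalR at q1 q2 q3 q4 q5
  generalize z.re = x at *
  generalize z.im = y at *
  norm_num at q1 q2 q3 q4 q5
  refine ⟨-4 * α.im * y, β * y ^ 2, by positivity, ?_, ?_, ?_, ?_, ?_⟩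
  · rw [q1]
    have : 16 * (α.re + β) ^ 2 * y ^ 2 - 32 * (α.re + β) * (β * y ^ 2) + (-4 * α.im * y) ^ 2 =
      16 * y ^ 2 * (α.re ^ 2 + α.im ^ 2 - β ^ 2) := by ring
    rw [this]; have : 0 < α.re ^ 2 + α.im ^ 2 - β ^ 2 := by linarith
    positivity
  · rw [q1]
    linear_combination (1/6) * (q5 - 4 * ((q3 + q4) / 2 - q1 - q2) - 16 * q1 - q2 - (q3 - q4))
  · rw [q1]; linear_combination (q3 + q4) / 2 - q1 - q2
  · rw [q1]
    linear_combination (q3 - q4) / 2 - (1/6) * (q5 - 4 * ((q3 + q4) / 2 - q1 - q2) - 16 * q1 - q2 - (q3 - q4))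
  · rw [q1]; linear_combination q2

lemma cp_of_par {f : BQF} {x s b0 β : ℝ} (h : Par f.a f.b f.c f.d f.e x s b0 β) :
    f.CP ⟨⟨x, √s⟩, Real.sqrt_pos.mpr h.hs⟩ := by
  have hy : 0 < √s := Real.sqrt_pos.mpr h.hs
  have hy2 : √s ^ 2 = s := Real.sq_sqrt h.hs.le
  set y := √s with hyd
  have hD := h.hD
  refine ⟨⟨f.a - β / s, - b0 / (4 * y)⟩, β / s, ?_, fun X Y => ?_⟩
  · rw [← abs_of_nonneg (norm_nonneg (_ : ℂ)), ← sq_lt_sq, ← Complex.normSq_eq_norm_sq,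
      Complex.normSq_mk]
    have e : (f.a - β / s) * (f.a - β / s) + -b0 / (4 * y) * (-b0 / (4 * y)) - (β / s) ^ 2 =
      (16 * f.a ^ 2 * s - 32 * f.a * β + b0 ^ 2) / (16 * s) := by
      rw [← hy2]; field_simp; ring
    have : 0 < (16 * (f.a:ℝ) ^ 2 * s - 32 * f.a * β + b0 ^ 2) / (16 * s) := div_pos hD (by linarith [h.hs])
    linarith
  · have e : (X:ℂ) + ((⟨⟨x, y⟩, hy⟩ : UpperHalfPlane) : ℂ) * Y = ⟨X + x * Y, y * Y⟩ := by
      apply Complex.ext <;> simp [UpperHalfPlane.coe_mk]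
    rw [e, Complex.normSq_mk]
    simp only [pow_succ, pow_zero, one_mul, Complex.mul_re, Complex.mul_im]
    unfold evalR
    rw [h.hb, h.hc, h.hd, h.he, ← hy2]
    field_simp
    ring

end BQF



namespace BQF

lemma I_act (f : BQF) (p q r t : ℤ) : (f.act p q r t).I = f.I * (p * t - q * r) ^ 4 := by
  unfold I act; ring

lemma J_act (f : BQF) (p q r t : ℤ) : (f.act p q r t).J = f.J * (p * t - q * r) ^ 6 := by
  unfold J act; ring

lemma I_J_equiv {f g : BQF} (h : Equivalent f g) : g.I = f.I ∧ g.J = f.J := by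
  obtain ⟨γ, u, rfl⟩ := (equivalent_iff f g).mp h
  rw [I_act, J_act]
  rw [Matrix.det_fin_two] at u
  have h2 : (γ 0 0 * γ 1 1 - γ 0 1 * γ 1 0) ^ 2 = 1 := by
    rcases Int.isUnit_iff.mp u with h | h <;> rw [h] <;> norm_num
  constructor
  · rw [show (γ 0 0 * γ 1 1 - γ 0 1 * γ 1 0) ^ 4 = ((γ 0 0 * γ 1 1 - γ 0 1 * γ 1 0) ^ 2) ^ 2 by ring, h2]
    ring
  · rw [show (γ 0 0 * γ 1 1 - γ 0 1 * γ 1 0) ^ 6 = ((γ 0 0 * γ 1 1 - γ 0 1 * γ 1 0) ^ 2) ^ 3 by ring, h2]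
    ring

lemma irred_evalZ_ne {f : BQF} (hf : f.Irred) {p q : ℤ} (h : p ≠ 0 ∨ q ≠ 0) : f.evalZ p q ≠ 0 := by
  obtain ⟨ha, hi⟩ := hf
  intro h0
  by_cases hq : q = 0
  · subst hq
    have hp : p ≠ 0 := by simpa using h
    unfold evalZ at h0
    simp at h0
    tauto
  · have hdeg : (Polynomial.C (f.a : ℚ) * Polynomial.X ^ 4 +
      Polynomial.C (f.b : ℚ) * Polynomial.X ^ 3 +
      Polynomial.C (f.c : ℚ) * Polynomial.X ^ 2 +
      Polynomial.C (f.d : ℚ) * Polynomial.X + Polynomial.C (f.e : ℚ)).degree = 4 := by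
      have ha' : (f.a:ℚ) ≠ 0 := by exact_mod_cast ha
      compute_degree!
    have hroot : Polynomial.IsRoot (Polynomial.C (f.a : ℚ) * Polynomial.X ^ 4 +
      Polynomial.C (f.b : ℚ) * Polynomial.X ^ 3 +
      Polynomial.C (f.c : ℚ) * Polynomial.X ^ 2 +
      Polynomial.C (f.d : ℚ) * Polynomial.X + Polynomial.C (f.e : ℚ)) ((p:ℚ) / q) := by
      rw [Polynomial.IsRoot]
      simp only [Polynomial.eval_add, Polynomial.eval_mul, Polynomial.eval_C, Polynomial.eval_pow,
        Polynomial.eval_X]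
      have hq' : (q:ℚ) ≠ 0 := by exact_mod_cast hq
      have : ((f.evalZ p q : ℤ) : ℚ) = 0 := by rw [h0]; simp
      unfold evalZ at this
      push_cast at this
      field_simp
      linarith
    have := Polynomial.degree_eq_one_of_irreducible_of_root hi hroot
    rw [hdeg] at this
    norm_num at this

lemma irred_equiv_a {f g : BQF} (hf : f.Irred) (h : Equivalent f g) : g.a ≠ 0 := by
  obtain ⟨γ, u, rfl⟩ := (equivalent_iff f g).mp h
  have : (f.act (γ 0 0) (γ 0 1) (γ 1 0) (γ 1 1)).a = f.evalZ (γ 0 0) (γ 0 1) := rfl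
  rw [this]
  apply irred_evalZ_ne hf
  by_contra hcon
  push Not at hcon
  rw [Matrix.det_fin_two, hcon.1, hcon.2] at u
  simp at u

lemma cp_unique {f : BQF} (ha : f.a ≠ 0) {z z' : UpperHalfPlane} (h : f.CP z) (h' : f.CP z') :
    z = z' := by
  obtain ⟨_, _, h1⟩ := h.par
  obtain ⟨_, _, h2⟩ := h'.par
  obtain ⟨e1, e2⟩ := Par.unique (by exact_mod_cast ha) h1 h2
  have := z.im_pos
  have := z'.im_pos
  have e3 : z.im = z'.im := by nlinarith
  exact UpperHalfPlane.ext (Complex.ext e1 e3)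

lemma equiv_act_sl (f : BQF) (m : Matrix.SpecialLinearGroup (Fin 2) ℤ) :
    Equivalent f (f.act (m 1 1) (m 1 0) (m 0 1) (m 0 0)) := by
  rw [equivalent_iff]
  refine ⟨!![m 1 1, m 1 0; m 0 1, m 0 0], ?_, by simp⟩
  have := m.det_coe
  rw [Matrix.det_fin_two] at this
  rw [Matrix.det_fin_two]
  simp
  rw [show m 1 1 * m 0 0 - m 1 0 * m 0 1 = m 0 0 * m 1 1 - m 0 1 * m 1 0 by ring, this]
  exact isUnit_one

lemma exists_reduced {f : BQF} {z : UpperHalfPlane} (h : f.CP z) : ∃ g z', Equivalent f g ∧ g.CP z' ∧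
    0 ≤ z'.re ∧ z'.re ≤ 1 / 2 ∧ 1 ≤ z'.re ^ 2 + z'.im ^ 2 := by
  obtain ⟨m, hm⟩ := ModularGroup.exists_smul_mem_fd z
  have h1 := h.act m
  have h2 := f.equiv_act_sl m
  set g := f.act (m 1 1) (m 1 0) (m 0 1) (m 0 0)
  set z1 := m • z
  obtain ⟨h3, h4⟩ := hm
  rw [Complex.normSq_apply] at h3
  change 1 ≤ z1.re * z1.re + z1.im * z1.im at h3
  rcases le_total 0 z1.re with h5 | h5
  · exact ⟨g, z1, h2, h1, h5, by rwa [abs_of_nonneg h5] at h4, by nlinarith⟩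
  · refine ⟨g.refl, rz z1, equiv_trans h2 g.refl_equiv, h1.refl, ?_, ?_, ?_⟩
    · change 0 ≤ -z1.re; linarith
    · change -z1.re ≤ 1/2; rwa [abs_of_nonpos h5] at h4
    · change 1 ≤ (-z1.re)^2 + z1.im ^ 2; nlinarith

lemma sl_case {f : BQF} {z z' : UpperHalfPlane} (p q r t : ℤ) (hdet : p * t - q * r = 1)
    (ha : (f.act p q r t).a ≠ 0)
    (h : f.CP z) (h' : (f.act p q r t).CP z')
    (hz : z ∈ ModularGroup.fdo) (hz' : z' ∈ ModularGroup.fdo) : f.act p q r t = f ∧ z = z' := by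
  let m : Matrix.SpecialLinearGroup (Fin 2) ℤ := ⟨!![t, r; q, p], by
    rw [Matrix.det_fin_two]; simp; linarith⟩
  have h1 := h.act m
  have e : f.act (m 1 1) (m 1 0) (m 0 1) (m 0 0) = f.act p q r t := by simp [m]
  rw [e] at h1
  have e2 := cp_unique ha h' h1
  rw [e2] at hz'
  rcases ModularGroup.eq_one_or_neg_one_of_mem_fdo_mem_fdo hz hz' with hm | hm
  · rw [e2, ← e, hm]
    refine ⟨?_, by simp⟩
    apply ext' <;> simp [act]
  · rw [e2, ← e, hm]
    refine ⟨?_, by simp⟩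
    apply ext' <;> simp [act]

lemma reduced_unique {f g : BQF} (hfa : g.a ≠ 0) (h : Equivalent f g) {z z' : UpperHalfPlane}
    (hz : f.CP z) (hz' : g.CP z') (h1 : 0 < z.re) (h2 : z.re < 1/2) (h3 : 1 < z.re ^ 2 + z.im ^ 2)
    (h1' : 0 < z'.re) (h2' : z'.re < 1/2) (h3' : 1 < z'.re ^ 2 + z'.im ^ 2) : f = g := by
  have hfd : z ∈ ModularGroup.fdo := by
    refine ⟨?_, by rwa [abs_of_pos h1]⟩
    rw [Complex.normSq_apply]
    change 1 < z.re * z.re + z.im * z.im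
    nlinarith
  have hfd' : z' ∈ ModularGroup.fdo := by
    refine ⟨?_, by rwa [abs_of_pos h1']⟩
    rw [Complex.normSq_apply]
    change 1 < z'.re * z'.re + z'.im * z'.im
    nlinarith
  have hfd'' : rz z' ∈ ModularGroup.fdo := by
    refine ⟨?_, ?_⟩
    · rw [Complex.normSq_apply]
      change 1 < (-z'.re) * (-z'.re) + z'.im * z'.im
      nlinarith
    · change |-z'.re| < 1/2
      rwa [abs_neg, abs_of_pos h1']
  obtain ⟨γ, u, hg⟩ := (equivalent_iff f g).mp h
  rw [Matrix.det_fin_two] at u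
  rcases Int.isUnit_iff.mp u with hd | hd
  · rw [hg] at hfa hz' ⊢
    exact (sl_case _ _ _ _ hd hfa hz hz' hfd hfd').1.symm
  · exfalso
    have e : g.refl = f.act (γ 0 0) (γ 0 1) (-γ 1 0) (-γ 1 1) := by
      rw [hg]; apply ext' <;> simp [act, refl] <;> ring
    have hr := hz'.refl
    have hra : g.refl.a ≠ 0 := hfa
    rw [e] at hr hra
    have := (sl_case _ _ _ _ (by linarith) hra hz hr hfd hfd'').2
    have h4 : z.re = -z'.re := by rw [this]; rfl
    linarith

def Good (C X : ℝ) (f : BQF) : Prop := f.Irred ∧ f.realRoots.ncard = 4 ∧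
  max |(f.I : ℝ)| (|(f.J : ℝ)| / C) < X

def Usc (C X : ℝ) : Set BQF := {f | f.a ≠ 0 ∧ |(f.I:ℝ)| < X ∧ |(f.J:ℝ)| < C * X ∧
  ∃ x s b0 β, Par f.a f.b f.c f.d f.e x s b0 β ∧ 0 ≤ x ∧ x ≤ 1 / 2 ∧ 1 ≤ x ^ 2 + s}

def Lsc (C X : ℝ) : Set BQF := {f | f.Irred ∧ |(f.I:ℝ)| < X ∧ |(f.J:ℝ)| < C * X ∧
  ∃ x s b0 β, Par f.a f.b f.c f.d f.e x s b0 β ∧ 0 < x ∧ x < 1 / 2 ∧ 1 < x ^ 2 + s}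

abbrev Qt (P : BQF → Prop) := Quot fun f g : {h : BQF // P h} => BQF.Equivalent f.1 g.1

lemma qt_eq {P : BQF → Prop} {f g : {h : BQF // P h}}
    (h : (Quot.mk _ f : Qt P) = Quot.mk _ g) : Equivalent f.1 g.1 := by
  have := Quot.eqvGen_exact h
  have he : Equivalence (fun f g : {h : BQF // P h} => Equivalent f.1 g.1) :=
    ⟨fun f => equiv_refl _, equiv_symm, equiv_trans⟩
  rwa [he.eqvGen_iff] at this

lemma realRoots_eq (f : BQF) : f.realRoots =
    {z : ℝ | (f.a:ℝ) * z ^ 4 + f.b * z ^ 3 + f.c * z ^ 2 + f.d * z + f.e = 0} := by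
  unfold realRoots evalR; simp

lemma good_rep {C X : ℝ} (hC : 0 < C) {f : BQF} (h : Good C X f) :
    ∃ g ∈ Usc C X, Equivalent f g := by
  obtain ⟨h1, h2, h3⟩ := h
  rw [realRoots_eq] at h2
  obtain ⟨x, s, b0, β, hp⟩ := par_of_roots (by exact_mod_cast h1.1) h2
  obtain ⟨g, z', he, hg, r1, r2, r3⟩ := exists_reduced (cp_of_par hp)
  obtain ⟨b1, β1, hp'⟩ := hg.par
  obtain ⟨eI, eJ⟩ := I_J_equiv he
  obtain ⟨h4, h5⟩ := max_lt_iff.mp h3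
  refine ⟨g, ⟨irred_equiv_a h1 he, by rwa [eI], ?_, _, _, _, _, hp', r1, r2, r3⟩, he⟩
  rw [eJ]; rwa [div_lt_iff₀' hC] at h5

lemma exists_inj {C X : ℝ} (hC : 0 < C) : ∃ φ : Qt (Good C X) → Usc C X, Function.Injective φ := by
  choose g hg he using fun f : {h : BQF // Good C X h} => good_rep hC f.2
  refine ⟨fun q => ⟨g q.out, hg _⟩, fun q q' h => ?_⟩
  have h' : g q.out = g q'.out := congrArg Subtype.val h
  rw [← Quot.out_eq q, ← Quot.out_eq q']
  apply Quot.sound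
  have e1 := he q.out
  rw [h'] at e1
  exact equiv_trans e1 (equiv_symm (he q'.out))

lemma qt_finite {C X : ℝ} (hC : 0 < C) (hfin : (Usc C X).Finite) : Finite (Qt (Good C X)) := by
  obtain ⟨φ, hφ⟩ := exists_inj (X := X) hC
  have := hfin.to_subtype
  exact Finite.of_injective φ hφ

lemma count_le {C X : ℝ} (hC : 0 < C) (hfin : (Usc C X).Finite) :
    classCount (Good C X) ≤ (Usc C X).ncard := by
  obtain ⟨φ, hφ⟩ := exists_inj (X := X) hC
  have := hfin.to_subtype
  exact Nat.card_le_card_of_injective φ hφ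

lemma count_mono {C X Y : ℝ} (hC : 0 < C) (hXY : X ≤ Y) (hfin : (Usc C Y).Finite) :
    classCount (Good C X) ≤ classCount (Good C Y) := by
  have := qt_finite hC hfin
  have himp : ∀ f, Good C X f → Good C Y f := fun f h => ⟨h.1, h.2.1, h.2.2.trans_le hXY⟩
  let φ : Qt (Good C X) → Qt (Good C Y) :=
    Quot.map (fun f => ⟨f.1, himp _ f.2⟩) (fun f g h => h)
  apply Nat.card_le_card_of_injective φ
  intro q q'
  induction q using Quot.ind with | _ f
  induction q' using Quot.ind with | _ g
  intro h
  have h2 : (Quot.mk _ ⟨f.1, himp _ f.2⟩ : Qt (Good C Y)) = Quot.mk _ ⟨g.1, himp _ g.2⟩ := h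
  have h3 := qt_eq h2
  exact Quot.sound h3

lemma count_ge {C X : ℝ} (hC : 0 < C) (hfin : (Usc C X).Finite) :
    (Lsc C X).ncard ≤ classCount (Good C X) := by
  have := qt_finite hC hfin
  have hgood : ∀ f ∈ Lsc C X, Good C X f := by
    rintro f ⟨h1, h2, h3, x, s, b0, β, hp, -⟩
    refine ⟨h1, ?_, max_lt h2 (by rwa [div_lt_iff₀' hC])⟩
    rw [realRoots_eq]
    exact hp.ncard_roots (by exact_mod_cast h1.1)
  let φ : Lsc C X → Qt (Good C X) := fun f => Quot.mk _ ⟨f.1, hgood _ f.2⟩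
  apply Nat.card_le_card_of_injective φ
  rintro ⟨f, hf⟩ ⟨g, hg⟩ h
  have he := qt_eq h
  obtain ⟨h1, h2, h3, x, s, b0, β, hp, hx1, hx2, hs⟩ := hf
  obtain ⟨h1', h2', h3', x', s', b0', β', hp', hx1', hx2', hs'⟩ := hg
  have : f = g := reduced_unique h1'.1 he (cp_of_par hp) (cp_of_par hp') hx1 hx2
    (by change 1 < x ^ 2 + (√s) ^ 2; rwa [Real.sq_sqrt hp.hs.le]) hx1' hx2'
    (by change 1 < x' ^ 2 + (√s') ^ 2; rwa [Real.sq_sqrt hp'.hs.le])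
  exact Subtype.ext this

end BQF



namespace Par
variable {a b c d e x s b0 β : ℝ}

set_option maxHeartbeats 1000000 in
lemma bounds (h : Par a b c d e x s b0 β) (hx0 : 0 ≤ x) (hx1 : x ≤ 1 / 2) (hs : 1 ≤ x ^ 2 + s) :
    ∃ A y : ℝ, 0 < A ∧ 1 / 2 ≤ y ∧ y ^ 2 = s ∧ A ^ 2 = (a * s - β) ^ 2 + b0 ^ 2 * s / 16 ∧
    |β| < A ∧ If a b c d e = 48 * A ^ 2 + 16 * β ^ 2 ∧
    e * Hf a b c - Gf a b c d = 128 * β * (β ^ 2 - 9 * A ^ 2) ∧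
    |a| * y ^ 2 ≤ 2 * A ∧ |b| * y ≤ 12 * A ∧ |c| ≤ 50 * A ∧ |d| ≤ 64 * A * y ∧ |e| ≤ 50 * A * y ^ 2 := by
  have hI := h.I_eq
  have hJ := h.J_eq
  have hD := h.hD
  have hs0 := h.hs
  have hs1 : 3 / 4 ≤ s := by nlinarith
  set A := √((a * s - β) ^ 2 + b0 ^ 2 * s / 16) with hA
  set y := √s with hy
  have hA2 : A ^ 2 = (a * s - β) ^ 2 + b0 ^ 2 * s / 16 := Real.sq_sqrt (by positivity)
  have hy2 : y ^ 2 = s := Real.sq_sqrt hs0.le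
  have hy0 : 0 < y := Real.sqrt_pos.mpr hs0
  have hy1 : 1 / 2 ≤ y := by nlinarith
  have hA0 : 0 ≤ A := Real.sqrt_nonneg _
  have hβA : β ^ 2 < A ^ 2 := by rw [hA2]; nlinarith [mul_pos hs0 hD]
  have hβ : |β| < A := abs_lt_of_sq_lt_sq hβA hA0
  have hApos : 0 < A := lt_of_le_of_lt (abs_nonneg _) hβ
  have h1 : |a * s - β| ≤ A := abs_le_of_sq_le_sq (by rw [hA2]; nlinarith [mul_nonneg (sq_nonneg b0) hs0.le]) hA0
  have h2 : |b0 * y| ≤ 4 * A := by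
    apply abs_le_of_sq_le_sq _ (by positivity)
    rw [mul_pow, mul_pow, hA2, hy2]; nlinarith [sq_nonneg (a * s - β)]
  have ha : |a| * y ^ 2 ≤ 2 * A := by
    have : |a| * y ^ 2 = |(a * s - β) + β| := by rw [hy2, ← abs_of_pos hs0, ← abs_mul, abs_of_pos hs0]; ring_nf
    rw [this]; linarith [abs_add_le (a * s - β) β]
  rw [abs_mul, abs_of_pos hy0] at h2
  have ha1 : |a| * y ≤ 4 * A := by
    linarith [mul_le_mul_of_nonneg_left hy1 (mul_nonneg (abs_nonneg a) hy0.le)]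
  have ha0 : |a| ≤ 8 * A := by linarith [mul_le_mul_of_nonneg_left hy1 (abs_nonneg a)]
  have hb1 : |b0| ≤ 8 * A := by linarith [mul_le_mul_of_nonneg_left hy1 (abs_nonneg b0)]
  have hAy : A ≤ 2 * (A * y) := by linarith [mul_le_mul_of_nonneg_left hy1 hA0]
  have hAy2 : A * y ≤ 2 * (A * y ^ 2) := by
    linarith [mul_le_mul_of_nonneg_left hy1 (mul_pos hApos hy0).le]
  have has : |a * s| ≤ 2 * A := by rw [abs_mul, abs_of_pos hs0, ← hy2]; exact ha
  have hc0 : |8 * β - 6 * a * s| ≤ 20 * A := by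
    have q1 := abs_le.mp has
    have q2 := abs_lt.mp hβ
    rw [abs_le]; constructor <;> linarith
  have hx2 : x ^ 2 ≤ 1 / 4 := (pow_le_pow_left₀ hx0 hx1 2).trans (by norm_num)
  have hx3 : x ^ 3 ≤ 1 / 8 := (pow_le_pow_left₀ hx0 hx1 3).trans (by norm_num)
  have hx4 : x ^ 4 ≤ 1 / 16 := (pow_le_pow_left₀ hx0 hx1 4).trans (by norm_num)
  have mulb : ∀ u v U V : ℝ, |u| ≤ U → 0 ≤ v → v ≤ V → |u * v| ≤ U * V := by
    intro u v U V hu hv hV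
    rw [abs_mul, abs_of_nonneg hv]
    exact mul_le_mul hu hV hv ((abs_nonneg u).trans hu)
  have t1 := mulb a x _ _ ha0 hx0 hx1
  have t2 := mulb a (x^2) _ _ ha0 (by positivity) hx2
  have t3 := mulb a (x^3) _ _ ha0 (by positivity) hx3
  have t4 := mulb a (x^4) _ _ ha0 (by positivity) hx4
  have u1 := mulb b0 x _ _ hb1 hx0 hx1
  have u2 := mulb b0 (x^2) _ _ hb1 (by positivity) hx2
  have u3 := mulb b0 (x^3) _ _ hb1 (by positivity) hx3
  have v1 := mulb (8 * β - 6 * a * s) x _ _ hc0 hx0 hx1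
  have v2 := mulb (8 * β - 6 * a * s) (x^2) _ _ hc0 (by positivity) hx2
  have hbs : |b0 * s| ≤ 4 * (A * y) := by
    rw [abs_mul, abs_of_pos hs0, ← hy2]; linarith [mul_le_mul_of_nonneg_right h2 hy0.le]
  have hbsx := mulb (b0 * s) x _ _ hbs hx0 hx1
  have hass : |a * s ^ 2| ≤ 2 * (A * y ^ 2) := by
    rw [abs_mul, abs_of_nonneg (sq_nonneg s), ← hy2]; linarith [mul_le_mul_of_nonneg_right ha (sq_nonneg y)]
  refine ⟨A, y, hApos, hy1, hy2, hA2, hβ, ?_, ?_, ha, ?_, ?_, ?_, ?_⟩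
  · rw [hI, hA2]; ring
  · rw [hJ, hI, hA2]; ring
  · have e1 : |b| * y = |b0 * y + 4 * (a * y * x)| := by
      rw [← abs_of_pos hy0, ← abs_mul, abs_of_pos hy0, h.hb]; congr 1; ring
    have e2 := mulb (a * y) x (4 * A) _ (by rw [abs_mul, abs_of_pos hy0]; exact ha1) hx0 hx1
    rw [e1]
    have e3 : |b0 * y| ≤ 4 * A := by rw [abs_mul, abs_of_pos hy0]; exact h2
    rw [abs_le] at *
    constructor <;> linarith
  · rw [h.hc]
    rw [abs_le] at *
    constructor <;> linarith
  · rw [h.hd]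
    rw [abs_le] at *
    constructor <;> linarith
  · rw [h.he]
    rw [abs_le] at *
    constructor <;> linarith

end Par

namespace BQF

lemma I_cast (f : BQF) : (f.I : ℝ) = If f.a f.b f.c f.d f.e := by
  unfold I If; push_cast; ring

lemma J_cast (f : BQF) : (f.J : ℝ) = f.e * Hf f.a f.b f.c - Gf f.a f.b f.c f.d := by
  unfold J Hf Gf; push_cast; ring

def tup (f : BQF) : ℤ × ℤ × ℤ × ℤ × ℤ := (f.a, f.b, f.c, f.d, f.e)

lemma tup_inj : Function.Injective tup := by
  intro f g h
  simp only [tup, Prod.mk.injEq] at h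
  exact ext' h.1 h.2.1 h.2.2.1 h.2.2.2.1 h.2.2.2.2

lemma finite_of_bdd (S : Set BQF) (M : ℝ) (h : ∀ f ∈ S, |(f.a:ℝ)| ≤ M ∧ |(f.b:ℝ)| ≤ M ∧ |(f.c:ℝ)| ≤ M ∧
    |(f.d:ℝ)| ≤ M ∧ |(f.e:ℝ)| ≤ M) : S.Finite := by
  obtain ⟨N, hN⟩ := exists_nat_ge M
  have hf : (Set.Icc (-(N:ℤ)) N ×ˢ Set.Icc (-(N:ℤ)) N ×ˢ Set.Icc (-(N:ℤ)) N ×ˢ Set.Icc (-(N:ℤ)) N ×ˢ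
    Set.Icc (-(N:ℤ)) N).Finite := by
    have := Set.finite_Icc (-(N:ℤ)) N
    exact this.prod (this.prod (this.prod (this.prod this)))
  refine Set.Finite.of_finite_image (hf.subset ?_) (tup_inj.injOn (s := S))
  rintro _ ⟨f, hf, rfl⟩
  have key : ∀ k : ℤ, |(k:ℝ)| ≤ M → k ∈ Set.Icc (-(N:ℤ)) N := by
    intro k hk
    have := abs_le.mp (hk.trans hN)
    exact ⟨by exact_mod_cast this.1, by exact_mod_cast this.2⟩
  obtain ⟨h1, h2, h3, h4, h5⟩ := h f hf
  exact ⟨key _ h1, key _ h2, key _ h3, key _ h4, key _ h5⟩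

lemma Usc_finite (C X : ℝ) : (Usc C X).Finite := by
  apply finite_of_bdd _ (400 * (1 + X) ^ 2)
  rintro f ⟨ha, hI, hJ, x, s, b0, β, hp, hx0, hx1, hs⟩
  obtain ⟨A, y, hA, hy, hys, hA2, hβ, eI, eJ, ba, bb, bc, bd, be⟩ := hp.bounds hx0 hx1 hs
  have ha1 : (1:ℝ) ≤ |(f.a:ℝ)| := by exact_mod_cast Int.one_le_abs ha
  rw [I_cast, eI, abs_of_nonneg (by positivity)] at hI
  have hX : 0 < X := by nlinarith [sq_nonneg β]
  have hAX : A ≤ 1 + X := by nlinarith [sq_nonneg β, sq_nonneg (A - 1)]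
  have hA1 : A ^ 2 ≤ (1 + X) ^ 2 := by gcongr
  have hX1 : 1 + X ≤ (1 + X) ^ 2 := by nlinarith
  have hy2 : y ^ 2 ≤ 2 * A := by
    have := mul_le_mul_of_nonneg_right ha1 (sq_nonneg y)
    linarith
  have hy3 : A * y ^ 2 ≤ 2 * (1 + X) ^ 2 := by
    have := mul_le_mul_of_nonneg_left hy2 hA.le
    linarith
  have hy4 : A * y ≤ 2 * (A * y ^ 2) := by nlinarith [mul_pos hA (by linarith : 0 < y)]
  have hb : |(f.b:ℝ)| ≤ 24 * A := by
    have := mul_le_mul_of_nonneg_left hy (abs_nonneg (f.b:ℝ))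
    linarith
  have ha' : |(f.a:ℝ)| ≤ 8 * A := by
    have : (1/2:ℝ) ^ 2 ≤ y ^ 2 := by gcongr
    have := mul_le_mul_of_nonneg_left this (abs_nonneg (f.a:ℝ))
    linarith
  refine ⟨?_, ?_, ?_, ?_, ?_⟩ <;> linarith

end BQF



lemma int_card (s : Finset ℤ) (m l : ℝ) (hl : 0 ≤ l) (h : ∀ k ∈ s, |(k:ℝ) - m| ≤ l) :
    (s.card : ℝ) ≤ 2 * l + 1 := by
  have hsub : s ⊆ Finset.Icc ⌈m - l⌉ ⌊m + l⌋ := by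
    intro k hk
    have := abs_le.mp (h k hk)
    rw [Finset.mem_Icc, Int.ceil_le, Int.le_floor]
    constructor <;> linarith
  have h1 := Finset.card_le_card hsub
  rw [Int.card_Icc] at h1
  have h2 := Int.floor_le (m + l)
  have h3 := Int.le_ceil (m - l)
  have h4 : (s.card : ℝ) ≤ ((⌊m + l⌋ + 1 - ⌈m - l⌉).toNat : ℝ) := by exact_mod_cast h1
  rcases le_total 0 (⌊m + l⌋ + 1 - ⌈m - l⌉) with h5 | h5
  · have h6 : (((⌊m + l⌋ + 1 - ⌈m - l⌉).toNat : ℤ) : ℝ) = ((⌊m + l⌋ + 1 - ⌈m - l⌉ : ℤ) : ℝ) := by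
      rw [Int.toNat_of_nonneg h5]
    rw [Int.cast_natCast] at h6
    rw [h6] at h4; push_cast at h4; linarith
  · rw [Int.toNat_of_nonpos h5] at h4; push_cast at h4; linarith

lemma sum_rpow_nat (p : ℝ) (hp0 : 0 ≤ p) (hp : p < 1) (N : ℕ) :
    ∑ k ∈ Finset.range N, (1 + (k:ℝ)) ^ (-p) ≤ (1 / (1 - p)) * (N:ℝ) ^ (1 - p) := by
  have hq : 0 < 1 - p := by linarith
  induction N with
  | zero => simp; positivity
  | succ N ih =>
    rw [Finset.sum_range_succ]
    have hN : (0:ℝ) < 1 + N := by positivity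
    have key : (N:ℝ) ^ (1 - p) ≤ (1 + (N:ℝ)) ^ (1 - p) - (1 - p) * (1 + (N:ℝ)) ^ (-p) := by
      have h1 := rpow_one_add_le_one_add_mul_self (s := -1 / (1 + (N:ℝ))) (p := 1 - p)
        (by rw [le_div_iff₀ hN]; linarith [(Nat.cast_nonneg N : (0:ℝ) ≤ N)]) hq.le (by linarith)
      have h2 : (N:ℝ) = (1 + N) * (1 + -1 / (1 + (N:ℝ))) := by field_simp; ring
      have h3 : (0:ℝ) ≤ 1 + -1 / (1 + (N:ℝ)) := by
        have : 1 + -1 / (1 + (N:ℝ)) = N / (1 + N) := by field_simp; ring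
        rw [this]; positivity
      have h4 : (1 + (N:ℝ)) ^ (-p) = (1 + (N:ℝ)) ^ (1 - p) / (1 + N) := by
        rw [← Real.rpow_sub_one hN.ne']; congr 1; ring
      conv_lhs => rw [h2, Real.mul_rpow hN.le h3]
      calc _ ≤ (1 + (N:ℝ)) ^ (1 - p) * (1 + (1 - p) * (-1 / (1 + (N:ℝ)))) := by gcongr
        _ = _ := by rw [h4]; ring
    have h5 : (1 / (1 - p)) * (N:ℝ) ^ (1 - p) ≤ (1 / (1 - p)) * ((1 + (N:ℝ)) ^ (1 - p) - (1 - p) * (1 + (N:ℝ)) ^ (-p)) := by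
      gcongr
    have h6 : (1 / (1 - p)) * ((1 + (N:ℝ)) ^ (1 - p) - (1 - p) * (1 + (N:ℝ)) ^ (-p)) =
      (1 / (1 - p)) * (1 + (N:ℝ)) ^ (1 - p) - (1 + (N:ℝ)) ^ (-p) := by field_simp
    push_cast
    rw [add_comm (N:ℝ) 1]
    linarith

lemma sum_rpow_int (p : ℝ) (hp0 : 0 ≤ p) (hp : p < 1) (M : ℝ) (hM : 1 ≤ M) :
    ∑ k ∈ Finset.Icc (-⌊M⌋) ⌊M⌋, (1 + |(k:ℝ)|) ^ (-p) ≤ (4 / (1 - p)) * M ^ (1 - p) := by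
  have hq : 0 < 1 - p := by linarith
  obtain ⟨N, hN⟩ := Int.eq_ofNat_of_zero_le (Int.floor_nonneg.mpr (by linarith : (0:ℝ) ≤ M))
  rw [hN]
  have h1 : ∑ k ∈ Finset.Icc (-(N:ℤ)) N, (1 + |(k:ℝ)|) ^ (-p) ≤
      ∑ j ∈ Finset.range (N + 1), 2 * (1 + (j:ℝ)) ^ (-p) := by
    have hmaps : ∀ k ∈ Finset.Icc (-(N:ℤ)) N, k.natAbs ∈ Finset.range (N + 1) := by
      intro k hk; rw [Finset.mem_Icc] at hk; rw [Finset.mem_range]; omega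
    rw [← Finset.sum_fiberwise_of_maps_to hmaps]
    apply Finset.sum_le_sum
    intro j _
    have : ∀ k ∈ (Finset.Icc (-(N:ℤ)) N).filter (fun k => k.natAbs = j),
        (1 + |(k:ℝ)|) ^ (-p) = (1 + (j:ℝ)) ^ (-p) := by
      intro k hk
      rw [Finset.mem_filter] at hk
      rw [← hk.2, Nat.cast_natAbs, Int.cast_abs]
    rw [Finset.sum_congr rfl this, Finset.sum_const, nsmul_eq_mul]
    have hc : ((Finset.Icc (-(N:ℤ)) N).filter (fun k => k.natAbs = j)).card ≤ 2 := by
      refine (Finset.card_le_card (t := {(j:ℤ), -(j:ℤ)}) ?_).trans Finset.card_le_two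
      intro k hk
      rw [Finset.mem_filter] at hk
      rw [Finset.mem_insert, Finset.mem_singleton]
      omega
    gcongr
    exact_mod_cast hc
  rw [← Finset.mul_sum] at h1
  have h2 := sum_rpow_nat p hp0 hp (N + 1)
  have hNM : (N:ℝ) ≤ M := by
    have := Int.floor_le M
    rw [hN] at this; exact_mod_cast this
  have h3 : ((N + 1 : ℕ):ℝ) ^ (1 - p) ≤ 2 * M ^ (1 - p) := by
    calc ((N + 1 : ℕ):ℝ) ^ (1 - p) ≤ (2 * M) ^ (1 - p) := by
          apply Real.rpow_le_rpow (by positivity) _ hq.le; push_cast; linarith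
      _ = 2 ^ (1 - p) * M ^ (1 - p) := Real.mul_rpow (by norm_num) (by linarith)
      _ ≤ 2 ^ (1:ℝ) * M ^ (1 - p) := by
          gcongr
          · norm_num
          · linarith
      _ = _ := by rw [Real.rpow_one]
  calc _ ≤ 2 * ((1 / (1 - p)) * ((N + 1 : ℕ):ℝ) ^ (1 - p)) := by linarith
    _ ≤ 2 * ((1 / (1 - p)) * (2 * M ^ (1 - p))) := by gcongr
    _ = _ := by ring

lemma fib_sum {α β : Type*} [DecidableEq β] (s : Finset α) (g : α → β) (t : Finset β)
    (hg : ∀ x ∈ s, g x ∈ t) (F : β → ℝ) (hF : ∀ y ∈ t, ((s.filter (fun x => g x = y)).card : ℝ) ≤ F y) :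
    (s.card : ℝ) ≤ ∑ y ∈ t, F y := by
  rw [Finset.card_eq_sum_card_fiberwise hg]
  push_cast
  exact Finset.sum_le_sum hF

namespace BQF

lemma fib_de (S : Finset BQF) (a b c : ℤ) (hS : ∀ f ∈ S, f.a = a ∧ f.b = b ∧ f.c = c) (m P Q : ℝ)
    (μ : ℤ → ℝ) (hP : 1 ≤ P) (hQ : 1 ≤ Q) (hd : ∀ f ∈ S, |(f.d:ℝ) - m| ≤ P)
    (he : ∀ f ∈ S, |(f.e:ℝ) - μ f.d| ≤ Q) : (S.card : ℝ) ≤ 9 * (P * Q) := by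
  classical
  have h1 := fib_sum S (fun f => f.d) (S.image (fun f => f.d))
    (fun f hf => Finset.mem_image_of_mem _ hf) (fun _ => 3 * Q) (by
      intro y _
      have hinj : Set.InjOn (fun f : BQF => f.e) (S.filter (fun f => f.d = y)) := by
        intro f hf g hg hfg
        rw [Finset.mem_coe, Finset.mem_filter] at hf hg
        obtain ⟨a1, a2, a3⟩ := hS f hf.1
        obtain ⟨b1, b2, b3⟩ := hS g hg.1
        exact ext' (a1.trans b1.symm) (a2.trans b2.symm) (a3.trans b3.symm) (hf.2.trans hg.2.symm) hfg
      rw [← Finset.card_image_of_injOn hinj]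
      have := int_card ((S.filter (fun f => f.d = y)).image (fun f => f.e)) (μ y) Q (by linarith) (by
        intro k hk
        rw [Finset.mem_image] at hk
        obtain ⟨f, hf, rfl⟩ := hk
        rw [Finset.mem_filter] at hf
        rw [← hf.2]; exact he f hf.1)
      linarith)
  rw [Finset.sum_const, nsmul_eq_mul] at h1
  have h2 := int_card (S.image (fun f => f.d)) m P (by linarith) (by
        intro k hk
        rw [Finset.mem_image] at hk
        obtain ⟨f, hf, rfl⟩ := hk
        exact hd f hf)
  have h3 : ((S.image (fun f => f.d)).card : ℝ) * (3 * Q) ≤ (3 * P) * (3 * Q) := by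
    gcongr; linarith
  linarith

lemma master (p1 p2 p3 : ℝ) (h10 : 0 ≤ p1) (h11 : p1 < 1) (h20 : 0 ≤ p2) (h21 : p2 < 1)
    (h30 : 0 ≤ p3) (h31 : p3 < 1) : ∃ K : ℝ, 0 < K ∧ ∀ (S : Finset BQF) (G M1 M2 M3 : ℝ)
    (m P Q : ℤ → ℤ → ℤ → ℝ) (μ : ℤ → ℤ → ℤ → ℤ → ℝ), 0 ≤ G → 1 ≤ M1 → 1 ≤ M2 → 1 ≤ M3 →
    (∀ f ∈ S, |(f.a:ℝ)| ≤ M1 ∧ |(f.b:ℝ)| ≤ M2 ∧ |(f.c:ℝ)| ≤ M3 ∧ 1 ≤ P f.a f.b f.c ∧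
      1 ≤ Q f.a f.b f.c ∧ |(f.d:ℝ) - m f.a f.b f.c| ≤ P f.a f.b f.c ∧
      |(f.e:ℝ) - μ f.a f.b f.c f.d| ≤ Q f.a f.b f.c ∧
      P f.a f.b f.c * Q f.a f.b f.c ≤
        G * ((1 + |(f.a:ℝ)|) ^ (-p1) * (1 + |(f.b:ℝ)|) ^ (-p2) * (1 + |(f.c:ℝ)|) ^ (-p3))) →
    (S.card : ℝ) ≤ K * (G * (M1 ^ (1 - p1) * M2 ^ (1 - p2) * M3 ^ (1 - p3))) := by
  classical
  have hq1 : 0 < 1 - p1 := by linarith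
  have hq2 : 0 < 1 - p2 := by linarith
  have hq3 : 0 < 1 - p3 := by linarith
  refine ⟨9 * ((4 / (1 - p1)) * (4 / (1 - p2)) * (4 / (1 - p3))), by positivity, ?_⟩
  intro S G M1 M2 M3 m P Q μ hG hM1 hM2 hM3 hS
  have key : ∀ (k : ℤ) (M : ℝ), |(k:ℝ)| ≤ M → k ∈ Finset.Icc (-⌊M⌋) ⌊M⌋ := by
    intro k M hk
    have := abs_le.mp hk
    rw [Finset.mem_Icc]
    have h1 : k ≤ ⌊M⌋ := Int.le_floor.mpr this.2
    have h2 : -k ≤ ⌊M⌋ := Int.le_floor.mpr (by push_cast; linarith)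
    omega
  have h1 := fib_sum S (fun f => (f.a, f.b, f.c))
    (Finset.Icc (-⌊M1⌋) ⌊M1⌋ ×ˢ (Finset.Icc (-⌊M2⌋) ⌊M2⌋ ×ˢ Finset.Icc (-⌊M3⌋) ⌊M3⌋))
    (by
      intro f hf
      obtain ⟨a1, a2, a3, -⟩ := hS f hf
      rw [Finset.mem_product, Finset.mem_product]
      exact ⟨key _ _ a1, key _ _ a2, key _ _ a3⟩)
    (fun y => 9 * (G * ((1 + |(y.1:ℝ)|) ^ (-p1) * (1 + |(y.2.1:ℝ)|) ^ (-p2) * (1 + |(y.2.2:ℝ)|) ^ (-p3))))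
    (by
      rintro ⟨a, b, c⟩ -
      rcases (S.filter (fun f => (f.a, f.b, f.c) = (a, b, c))).eq_empty_or_nonempty with h0 | ⟨f, hf⟩
      · rw [h0]; simp only [Finset.card_empty, Nat.cast_zero]; positivity
      · have hall : ∀ g ∈ S.filter (fun f => (f.a, f.b, f.c) = (a, b, c)),
            g.a = a ∧ g.b = b ∧ g.c = c ∧ g ∈ S := by
          intro g hg
          rw [Finset.mem_filter, Prod.mk.injEq, Prod.mk.injEq] at hg
          exact ⟨hg.2.1, hg.2.2.1, hg.2.2.2, hg.1⟩
        obtain ⟨fa, fb, fc, fS⟩ := hall f hf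
        obtain ⟨-, -, -, c1, c2, -, -, c3⟩ := hS f fS
        rw [fa, fb, fc] at c1 c2 c3
        have := fib_de _ a b c (fun g hg => ⟨(hall g hg).1, (hall g hg).2.1, (hall g hg).2.2.1⟩)
          (m a b c) (P a b c) (Q a b c) (μ a b c) c1 c2
          (by
            intro g hg
            obtain ⟨ga, gb, gc, gS⟩ := hall g hg
            obtain ⟨-, -, -, -, -, c4, -, -⟩ := hS g gS
            rwa [ga, gb, gc] at c4)
          (by
            intro g hg
            obtain ⟨ga, gb, gc, gS⟩ := hall g hg
            obtain ⟨-, -, -, -, -, -, c4, -⟩ := hS g gS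
            rwa [ga, gb, gc] at c4)
        dsimp only
        linarith)
  refine h1.trans ?_
  rw [← Finset.mul_sum, ← Finset.mul_sum, Finset.sum_product]
  simp only [Finset.sum_product, mul_assoc]
  simp only [← Finset.mul_sum, ← Finset.sum_mul]
  have s1 := sum_rpow_int p1 h10 h11 M1 hM1
  have s2 := sum_rpow_int p2 h20 h21 M2 hM2
  have s3 := sum_rpow_int p3 h30 h31 M3 hM3
  have n2 : 0 ≤ ∑ k ∈ Finset.Icc (-⌊M2⌋) ⌊M2⌋, (1 + |(k:ℝ)|) ^ (-p2) :=
    Finset.sum_nonneg fun k _ => by positivity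
  have n3 : 0 ≤ ∑ k ∈ Finset.Icc (-⌊M3⌋) ⌊M3⌋, (1 + |(k:ℝ)|) ^ (-p3) :=
    Finset.sum_nonneg fun k _ => by positivity
  calc _ ≤ 9 * (G * (((4 / (1 - p1)) * M1 ^ (1 - p1)) * (((4 / (1 - p2)) * M2 ^ (1 - p2)) *
        ((4 / (1 - p3)) * M3 ^ (1 - p3))))) := by gcongr
    _ = _ := by ring

end BQF



structure Bd (a b c d e A y : ℝ) : Prop where
  hA : 0 < A
  hy : 1 / 2 ≤ y
  ba : |a| * y ^ 2 ≤ 2 * A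
  bb : |b| * y ≤ 12 * A
  bc : |c| ≤ 50 * A
  bd : |d| ≤ 64 * A * y
  be : |e| ≤ 50 * A * y ^ 2

lemma Bd.ha8 {a b c d e A y : ℝ} (h : Bd a b c d e A y) : |a| ≤ 8 * A := by
  have : (1/2:ℝ) ^ 2 ≤ y ^ 2 := by have := h.hy; gcongr
  have := mul_le_mul_of_nonneg_left this (abs_nonneg a)
  linarith [h.ba]

lemma Bd.hb24 {a b c d e A y : ℝ} (h : Bd a b c d e A y) : |b| ≤ 24 * A := by
  have := mul_le_mul_of_nonneg_left h.hy (abs_nonneg b)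
  linarith [h.bb]

lemma Bd.hd' {a b c d e A y R : ℝ} (h : Bd a b c d e A y) (hu : 1 ≤ |a|) (hR : A ≤ R) :
    |d| ≤ 128 * R * √(R / |a|) := by
  have hA := h.hA
  have h1 : y ^ 2 ≤ 4 * (R / |a|) := by
    rw [mul_div_assoc', le_div_iff₀ (by linarith)]; linarith [h.ba]
  have h2 : y ≤ 2 * √(R / |a|) := by
    have : y ≤ √(4 * (R / |a|)) := Real.le_sqrt_of_sq_le h1
    rwa [Real.sqrt_mul (by norm_num), show (4:ℝ) = 2 ^ 2 by norm_num, Real.sqrt_sq (by norm_num)] at this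
  have hy := h.hy
  calc |d| ≤ 64 * A * y := h.bd
    _ ≤ 64 * R * (2 * √(R / |a|)) := by gcongr; nlinarith
    _ = _ := by ring

lemma P_ge {R u : ℝ} (hR : 1 ≤ R) (hu : 1 ≤ u) (h8 : u ≤ 8 * R) : 1 ≤ 128 * R * √(R / u) := by
  have : (1/3:ℝ) ≤ √(R / u) := by
    apply Real.le_sqrt_of_sq_le
    rw [le_div_iff₀ (by linarith)]; linarith
  nlinarith

lemma rp1 {u s : ℝ} (hu : 1 ≤ u) (hs0 : 0 ≤ s) (hs1 : s ≤ 1) : u ^ (-s) ≤ 2 * (1 + u) ^ (-s) := by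
  have h0 : 0 < u := by linarith
  have h1 : (1 + u) ^ s ≤ 2 * u ^ s := by
    calc (1 + u) ^ s ≤ (2 * u) ^ s := by apply Real.rpow_le_rpow <;> linarith
      _ = 2 ^ s * u ^ s := Real.mul_rpow (by norm_num) h0.le
      _ ≤ 2 ^ (1:ℝ) * u ^ s := by
        gcongr
        norm_num
      _ = _ := by rw [Real.rpow_one]
  rw [Real.rpow_neg h0.le, Real.rpow_neg (by linarith), inv_eq_one_div, ← div_eq_mul_inv,
    div_le_div_iff₀ (by positivity) (by positivity)]
  linarith

lemma sqrt_div_rp {R u : ℝ} (hR : 0 ≤ R) (hu : 0 < u) : √(R / u) = R ^ (1/2:ℝ) * u ^ (-(1/2):ℝ) := by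
  rw [Real.sqrt_eq_rpow, Real.div_rpow hR hu.le, Real.rpow_neg hu.le]; rfl

namespace BQF

lemma low_count : ∃ K : ℝ, 0 < K ∧ ∀ (S : Finset BQF) (R : ℝ), 1 ≤ R →
    (∀ f ∈ S, f.a ≠ 0 ∧ ∃ A y, Bd f.a f.b f.c f.d f.e A y ∧ A ≤ R) →
    (S.card : ℝ) ≤ K * R ^ (45/8 : ℝ) := by
  obtain ⟨K, hK, hm⟩ := master (7/8) 0 0 (by norm_num) (by norm_num) (by norm_num) (by norm_num)
    (by norm_num) (by norm_num)
  refine ⟨K * (25600 * (8 ^ (1/8:ℝ) * 24 * 50)), by positivity, fun S R hR hS => ?_⟩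
  have hR0 : 0 < R := by linarith
  have := hm S (25600 * R ^ (7/2:ℝ)) (8 * R) (24 * R) (50 * R) (fun _ _ _ => 0)
    (fun a _ _ => 128 * R * √(R / |(a:ℝ)|)) (fun a _ _ => 100 * R ^ 2 / |(a:ℝ)|)
    (fun _ _ _ _ => 0) (by positivity) (by linarith) (by linarith) (by linarith) (by
      intro f hf
      obtain ⟨ha, A, y, hB, hAR⟩ := hS f hf
      have hu : (1:ℝ) ≤ |(f.a:ℝ)| := by exact_mod_cast Int.one_le_abs ha
      have h8 := hB.ha8
      have h24 := hB.hb24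
      have hc := hB.bc
      have hA := hB.hA
      have hd := hB.hd' hu hAR
      have hba := hB.ba
      have hbe := hB.be
      generalize |(f.a:ℝ)| = u at *
      have hu0 : 0 < u := by linarith
      refine ⟨by linarith, by linarith, by linarith, P_ge hR hu (by linarith), ?_, by simpa using hd, ?_, ?_⟩
      · rw [le_div_iff₀ hu0]; nlinarith
      · rw [sub_zero, le_div_iff₀ hu0]
        calc |(f.e:ℝ)| * u ≤ (50 * A * y ^ 2) * u := by gcongr
          _ = 50 * A * (u * y ^ 2) := by ring
          _ ≤ 50 * R * (2 * R) :=
            mul_le_mul (by linarith) (by linarith) (by positivity) (by positivity)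
          _ = _ := by ring
      · rw [neg_zero, Real.rpow_zero, Real.rpow_zero, mul_one, mul_one, sqrt_div_rp hR0.le hu0]
        have e1 : 128 * R * (R ^ (1/2:ℝ) * u ^ (-(1/2):ℝ)) * (100 * R ^ 2 / u) =
            12800 * R ^ (7/2:ℝ) * u ^ (-(3/2):ℝ) := by
          have : R ^ (7/2:ℝ) = R ^ 3 * R ^ (1/2:ℝ) := by
            rw [← Real.rpow_natCast, ← Real.rpow_add hR0]; norm_num
          have h2 : u ^ (-(3/2):ℝ) = u ^ (-(1/2):ℝ) / u := by
            rw [← Real.rpow_sub_one hu0.ne']; norm_num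
          rw [this, h2]; ring
        rw [e1]
        have e2 : u ^ (-(3/2):ℝ) ≤ u ^ (-(7/8):ℝ) := Real.rpow_le_rpow_of_exponent_le hu (by norm_num)
        have e3 := rp1 hu (s := 7/8) (by norm_num) (by norm_num)
        calc _ ≤ 12800 * R ^ (7/2:ℝ) * (2 * (1 + u) ^ (-(7/8):ℝ)) := by gcongr; linarith
          _ = _ := by ring)
  refine this.trans (le_of_eq ?_)
  rw [Real.mul_rpow (by norm_num) hR0.le]
  have : R ^ (45/8:ℝ) = R ^ (7/2:ℝ) * R ^ (1/8:ℝ) * R ^ 2 := by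
    rw [← Real.rpow_natCast, ← Real.rpow_add hR0, ← Real.rpow_add hR0]; norm_num
  norm_num
  rw [this]; ring

end BQF



lemma hfacts {a b c d e x s b0 β A y : ℝ} (hp : Par a b c d e x s b0 β) (hB : Bd a b c d e A y)
    (hys : y ^ 2 = s) (hA2 : A ^ 2 = (a * s - β) ^ 2 + b0 ^ 2 * s / 16) (hβ : 2 * |β| ≤ A)
    (hu : 1 ≤ |a|) :
    Hf a b c < 0 ∧ 252 * A ^ 2 ≤ |Hf a b c| * y ^ 2 ∧ |Hf a b c| * y ^ 2 ≤ 864 * A ^ 2 ∧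
    |a| ^ 2 ≤ |Hf a b c| ∧ |b| ^ 2 ≤ |Hf a b c| ∧ |a| * |c| ≤ |Hf a b c| := by
  have hA := hB.hA
  have hs := hp.hs
  have e1 : Hf a b c * s = -432 * A ^ 2 + 144 * β ^ 2 - 288 * (β * (a * s - β)) := by
    rw [hA2]; linear_combination s * hp.H_eq
  have h1 : |a * s - β| ≤ A := abs_le_of_sq_le_sq (by rw [hA2]; nlinarith [mul_nonneg (sq_nonneg b0) hs.le]) hA.le
  have h2 : |β * (a * s - β)| ≤ A / 2 * A := by
    rw [abs_mul]; gcongr; linarith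
  have h3 := abs_le.mp h2
  have h4 : β ^ 2 ≤ A ^ 2 / 4 := by
    have := abs_le.mp (show |β| ≤ A / 2 by linarith); nlinarith
  have h5 : Hf a b c * s ≤ -252 * A ^ 2 := by rw [e1]; nlinarith
  have hA2p : 0 < A ^ 2 := by positivity
  have hneg : Hf a b c < 0 := by
    by_contra hcon
    push Not at hcon
    have := mul_nonneg hcon hs.le
    linarith
  have h6 : |Hf a b c| * y ^ 2 = -(Hf a b c * s) := by rw [abs_of_neg hneg, hys]; ring
  have h7 : 252 * A ^ 2 ≤ |Hf a b c| * y ^ 2 := by rw [h6]; linarith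
  have hy := hB.hy
  have hy0 : 0 < y := by linarith
  have hy2 : 0 < y ^ 2 := by positivity
  have hy4 : (1:ℝ) / 4 ≤ y ^ 2 := by nlinarith
  refine ⟨hneg, h7, by rw [h6, e1]; nlinarith [sq_nonneg β], ?_, ?_, ?_⟩
  · have : |a| ^ 2 * y ^ 2 ≤ |Hf a b c| * y ^ 2 := by
      have t1 : (|a| * y ^ 2) ^ 2 ≤ (2 * A) ^ 2 := by have := hB.ba; gcongr
      have t2 : |a| ^ 2 * y ^ 2 * (1/4) ≤ |a| ^ 2 * y ^ 2 * y ^ 2 := by gcongr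
      nlinarith
    exact le_of_mul_le_mul_right this hy2
  · have : |b| ^ 2 * y ^ 2 ≤ |Hf a b c| * y ^ 2 := by
      have t1 : (|b| * y) ^ 2 ≤ (12 * A) ^ 2 := by have := hB.bb; gcongr
      nlinarith
    exact le_of_mul_le_mul_right this hy2
  · have : |a| * |c| * y ^ 2 ≤ |Hf a b c| * y ^ 2 := by
      have t1 : (|a| * y ^ 2) * |c| ≤ (2 * A) * (50 * A) := by
        have := hB.ba; have := hB.bc; exact mul_le_mul hB.ba hB.bc (abs_nonneg _) (by positivity)
      nlinarith
    exact le_of_mul_le_mul_right this hy2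

lemma Q_bound {C T h e Hh G : ℝ} (hC : 0 < C) (hT : 1 ≤ T) (hh : h = |Hh|) (h1 : 1 ≤ h) (h72 : h ≤ 72 * T ^ 2)
    (hJ : |e * Hh - G| < C * T ^ 2) : 1 ≤ (C + 72) * T ^ 2 / h ∧ |e - G / Hh| ≤ (C + 72) * T ^ 2 / h := by
  have h0 : 0 < h := by linarith
  have hne : Hh ≠ 0 := by intro h2; rw [h2, abs_zero] at hh; linarith
  constructor
  · rw [le_div_iff₀ h0]; nlinarith [mul_pos hC (by positivity : 0 < T ^ 2)]
  · rw [le_div_iff₀ h0, hh, ← abs_mul, sub_mul, div_mul_cancel₀ _ hne]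
    nlinarith [mul_pos hC (by positivity : 0 < T ^ 2)]

/-- data of a mid or top form -/
def Mt (C T : ℝ) (f : BQF) (A y : ℝ) : Prop := f.a ≠ 0 ∧ Bd f.a f.b f.c f.d f.e A y ∧
  48 * A ^ 2 ≤ T ^ 2 ∧ |(f.J:ℝ)| < C * T ^ 2 ∧
  252 * A ^ 2 ≤ |Hf f.a f.b f.c| * y ^ 2 ∧ |Hf f.a f.b f.c| * y ^ 2 ≤ 864 * A ^ 2 ∧
    |(f.a:ℝ)| ^ 2 ≤ |Hf f.a f.b f.c| ∧ |(f.b:ℝ)| ^ 2 ≤ |Hf f.a f.b f.c| ∧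
    |(f.a:ℝ)| * |(f.c:ℝ)| ≤ |Hf f.a f.b f.c|

lemma h72 {h A y T : ℝ} (h0 : 0 ≤ h) (hy : 1 / 2 ≤ y) (h1 : h * y ^ 2 ≤ 864 * A ^ 2) (h2 : 48 * A ^ 2 ≤ T ^ 2) :
    h ≤ 72 * T ^ 2 := by
  have : (1/2:ℝ) ^ 2 ≤ y ^ 2 := by gcongr
  have := mul_le_mul_of_nonneg_left this h0
  linarith

lemma hrp {h u b c : ℝ} (hu : 1 ≤ u) (hb : 0 ≤ b) (hc : 0 ≤ c) (h1 : u ^ 2 ≤ h) (h2 : b ^ 2 ≤ h) (h3 : u * c ≤ h)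
    {t : ℝ} (ht0 : 0 ≤ t) (ht1 : t ≤ 1) :
    h ^ (-t) ≤ 4 * (1 + b) ^ (-(2 * t)) ∧ h ^ (-t) ≤ 2 * (u ^ (-t) * (1 + c) ^ (-t)) := by
  have hh : 1 ≤ h := by nlinarith
  have hh0 : 0 < h := by linarith
  have pw : ∀ k : ℝ, 1 ≤ k → k ^ t ≤ k := fun k hk => by
    calc k ^ t ≤ k ^ (1:ℝ) := Real.rpow_le_rpow_of_exponent_le hk ht1
      _ = k := Real.rpow_one k
  constructor
  · have e1 : (1 + b) ^ (2 * t) ≤ 4 * h ^ t := by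
      calc (1 + b) ^ (2 * t) = ((1 + b) ^ 2) ^ t := by
            rw [← Real.rpow_natCast, ← Real.rpow_mul (by linarith)]; norm_num
        _ ≤ (4 * h) ^ t := by apply Real.rpow_le_rpow (by positivity) _ ht0; nlinarith [sq_nonneg (1 - b)]
        _ = 4 ^ t * h ^ t := Real.mul_rpow (by norm_num) hh0.le
        _ ≤ 4 * h ^ t := by gcongr; exact pw 4 (by norm_num)
    rw [Real.rpow_neg hh0.le, Real.rpow_neg (by linarith), inv_eq_one_div, ← div_eq_mul_inv,
      div_le_div_iff₀ (by positivity) (by positivity)]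
    linarith
  · have hu0 : 0 < u := by linarith
    have e1 : u ^ t * (1 + c) ^ t ≤ 2 * h ^ t := by
      calc u ^ t * (1 + c) ^ t = (u * (1 + c)) ^ t := (Real.mul_rpow hu0.le (by linarith)).symm
        _ ≤ (2 * h) ^ t := by apply Real.rpow_le_rpow (by positivity) _ ht0; nlinarith
        _ = 2 ^ t * h ^ t := Real.mul_rpow (by norm_num) hh0.le
        _ ≤ 2 * h ^ t := by gcongr; exact pw 2 (by norm_num)
    rw [Real.rpow_neg hh0.le, Real.rpow_neg hu0.le, Real.rpow_neg (by linarith), ← mul_inv, inv_eq_one_div,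
      ← div_eq_mul_inv, div_le_div_iff₀ (by positivity) (by positivity)]
    linarith

namespace BQF

lemma mid_count (C : ℝ) (hC : 0 < C) : ∃ K : ℝ, 0 < K ∧ ∀ (S : Finset BQF) (T R : ℝ), 1 ≤ R → 1 ≤ T →
    (∀ f ∈ S, ∃ A y, Mt C T f A y ∧ A ≤ R) →
    (S.card : ℝ) ≤ K * (T ^ 2 * R ^ (19/8 : ℝ)) := by
  obtain ⟨K, hK, hm⟩ := master (7/8) (7/8) (3/8) (by norm_num) (by norm_num) (by norm_num) (by norm_num)
    (by norm_num) (by norm_num)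
  refine ⟨K * (2048 * (C + 72) * (8 ^ (1/8:ℝ) * 24 ^ (1/8:ℝ) * 50 ^ (5/8:ℝ))), by positivity,
    fun S T R hR hT hS => ?_⟩
  have hR0 : 0 < R := by linarith
  have := hm S (2048 * (C + 72) * T ^ 2 * R ^ (3/2:ℝ)) (8 * R) (24 * R) (50 * R) (fun _ _ _ => 0)
    (fun a _ _ => 128 * R * √(R / |(a:ℝ)|)) (fun a b c => (C + 72) * T ^ 2 / |Hf a b c|)
    (fun a b c d => Gf a b c d / Hf a b c) (by positivity) (by linarith) (by linarith) (by linarith) (by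
      intro f hf
      obtain ⟨A, y, ⟨ha, hB, hAT, hJ, H1, H2, H3, H4, H5⟩, hAR⟩ := hS f hf
      have hu : (1:ℝ) ≤ |(f.a:ℝ)| := by exact_mod_cast Int.one_le_abs ha
      have h8 := hB.ha8
      have h24 := hB.hb24
      have hc := hB.bc
      have hd := hB.hd' hu hAR
      rw [J_cast] at hJ
      have hh1 : 1 ≤ |Hf f.a f.b f.c| := by nlinarith
      obtain ⟨q1, q2⟩ := Q_bound hC hT rfl hh1 (h72 (by positivity) hB.hy H2 hAT) hJ
      refine ⟨by linarith, by linarith, by linarith, P_ge hR hu (by linarith), q1, by simpa using hd, q2, ?_⟩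
      obtain ⟨r1, -⟩ := hrp hu (abs_nonneg _) (abs_nonneg _) H3 H4 H5 (t := 5/8) (by norm_num) (by norm_num)
      obtain ⟨-, r2⟩ := hrp hu (abs_nonneg _) (abs_nonneg _) H3 H4 H5 (t := 3/8) (by norm_num) (by norm_num)
      clear q1 q2 hd hc h24 h8 H1 H2 H3 H4 H5 hJ hB
      generalize |Hf f.a f.b f.c| = h at *
      generalize |(f.a:ℝ)| = u at *
      have hb0 := abs_nonneg (f.b:ℝ)
      have hc0 := abs_nonneg (f.c:ℝ)
      generalize |(f.b:ℝ)| = b at *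
      generalize |(f.c:ℝ)| = c at *
      have hu0 : 0 < u := by linarith
      have hh0 : 0 < h := by linarith
      rw [sqrt_div_rp hR0.le hu0]
      have e1 : 128 * R * (R ^ (1/2:ℝ) * u ^ (-(1/2):ℝ)) * ((C + 72) * T ^ 2 / h) =
          128 * (C + 72) * T ^ 2 * R ^ (3/2:ℝ) * (u ^ (-(1/2):ℝ) * (h ^ (-(5/8):ℝ) * h ^ (-(3/8):ℝ))) := by
        have e2 : R ^ (3/2:ℝ) = R * R ^ (1/2:ℝ) := by
          rw [mul_comm, ← Real.rpow_add_one hR0.ne']; norm_num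
        rw [← Real.rpow_add hh0, e2, show (-(5/8) + -(3/8) : ℝ) = -1 by norm_num, Real.rpow_neg_one]
        ring
      rw [e1]
      have e4 : (1 + b) ^ (-(2 * (5/8)):ℝ) ≤ (1 + b) ^ (-(7/8):ℝ) :=
        Real.rpow_le_rpow_of_exponent_le (by linarith) (by norm_num)
      have e3 := rp1 hu (s := 7/8) (by norm_num) (by norm_num)
      have e5 : u ^ (-(1/2):ℝ) * u ^ (-(3/8):ℝ) = u ^ (-(7/8):ℝ) := by
        rw [← Real.rpow_add hu0]; norm_num
      calc _ ≤ 128 * (C + 72) * T ^ 2 * R ^ (3/2:ℝ) * (u ^ (-(1/2):ℝ) * ((4 * (1 + b) ^ (-(7/8):ℝ)) *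
            (2 * (u ^ (-(3/8):ℝ) * (1 + c) ^ (-(3/8):ℝ))))) := by gcongr; linarith
        _ = 1024 * (C + 72) * T ^ 2 * R ^ (3/2:ℝ) * (u ^ (-(7/8):ℝ) * (1 + b) ^ (-(7/8):ℝ) * (1 + c) ^ (-(3/8):ℝ)) := by
            rw [← e5]; ring
        _ ≤ 1024 * (C + 72) * T ^ 2 * R ^ (3/2:ℝ) * ((2 * (1 + u) ^ (-(7/8):ℝ)) * (1 + b) ^ (-(7/8):ℝ) * (1 + c) ^ (-(3/8):ℝ)) := by
            gcongr
        _ = _ := by ring)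
  refine this.trans (le_of_eq ?_)
  rw [Real.mul_rpow (by norm_num) hR0.le, Real.mul_rpow (by norm_num) hR0.le, Real.mul_rpow (by norm_num) hR0.le]
  have : R ^ (19/8:ℝ) = R ^ (3/2:ℝ) * R ^ (1/8:ℝ) * R ^ (1/8:ℝ) * R ^ (5/8:ℝ) := by
    rw [← Real.rpow_add hR0, ← Real.rpow_add hR0, ← Real.rpow_add hR0]; norm_num
  norm_num
  rw [this]; ring

end BQF



lemma min_le_rp {p q : ℝ} (hp : 0 < p) (hq : 0 < q) : min p q ≤ p ^ (1/4:ℝ) * q ^ (3/4:ℝ) := by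
  have h0 : 0 < min p q := lt_min hp hq
  calc min p q = (min p q) ^ (1/4:ℝ) * (min p q) ^ (3/4:ℝ) := by
        rw [← Real.rpow_add h0]; norm_num
    _ ≤ _ := by
        gcongr
        · exact min_le_left _ _
        · exact min_le_right _ _

namespace BQF

set_option maxHeartbeats 1000000 in
lemma top_count (C : ℝ) (hC : 0 < C) : ∃ K : ℝ, 0 < K ∧ ∀ (S : Finset BQF) (T M : ℝ), 1 ≤ M → 1 ≤ T →
    (∀ f ∈ S, ∃ A y, Mt C T f A y ∧ |(f.a:ℝ)| ≤ M ∧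
      |54 * (f.a:ℝ) * f.d - 9 * f.b * f.c| ≤ (1 / 2 + 216 * C) * |Hf f.a f.b f.c|) →
    (S.card : ℝ) ≤ K * (M ^ (1/4:ℝ) * T ^ (15/4:ℝ)) := by
  obtain ⟨K, hK, hm⟩ := master (3/4) (3/4) 0 (by norm_num) (by norm_num) (by norm_num) (by norm_num)
    (by norm_num) (by norm_num)
  refine ⟨K * (8 * ((40 + 4 * C) * (C + 72)) * (24 ^ (1/4:ℝ) * 50)), by positivity,
    fun S T M hM hT hS => ?_⟩
  have hT0 : 0 < T := by linarith
  have := hm S (8 * ((40 + 4 * C) * (C + 72)) * T ^ (5/2:ℝ)) M (24 * T) (50 * T)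
    (fun a b c => if T ^ 2 / √|Hf a b c| ≤ |Hf a b c| / |(a:ℝ)| then 0 else (b * c / (6 * a) : ℝ))
    (fun a b c => (40 + 4 * C) * min (T ^ 2 / √|Hf a b c|) (|Hf a b c| / |(a:ℝ)|))
    (fun a b c => (C + 72) * T ^ 2 / |Hf a b c|)
    (fun a b c d => Gf a b c d / Hf a b c) (by positivity) hM (by linarith) (by linarith) (by
      intro f hf
      obtain ⟨A, y, ⟨ha, hB, hAT, hJ, H1, H2, H3, H4, H5⟩, haM, hx⟩ := hS f hf
      have hu : (1:ℝ) ≤ |(f.a:ℝ)| := by exact_mod_cast Int.one_le_abs ha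
      have h24 := hB.hb24
      have hc := hB.bc
      have hA := hB.hA
      have hy := hB.hy
      have hAT' : A ≤ T := by
        have : A ^ 2 ≤ T ^ 2 := by linarith [sq_nonneg A]
        exact le_of_sq_le_sq this hT0.le
      rw [J_cast] at hJ
      have hh1 : 1 ≤ |Hf f.a f.b f.c| := by nlinarith
      have h72 := h72 (by positivity) hB.hy H2 hAT
      obtain ⟨q1, q2⟩ := Q_bound hC hT rfl hh1 h72 hJ
      have hd1 : |(f.d:ℝ)| * √|Hf f.a f.b f.c| ≤ 40 * T ^ 2 := by
        apply le_of_sq_le_sq _ (by positivity)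
        rw [mul_pow, Real.sq_sqrt (by positivity)]
        have hh0 : 0 ≤ |Hf f.a f.b f.c| := by positivity
        calc |(f.d:ℝ)| ^ 2 * |Hf f.a f.b f.c| ≤ (64 * A * y) ^ 2 * |Hf f.a f.b f.c| := by
              have := hB.bd; gcongr
          _ = 4096 * A ^ 2 * (|Hf f.a f.b f.c| * y ^ 2) := by ring
          _ ≤ 4096 * A ^ 2 * (864 * A ^ 2) := by gcongr
          _ = 1536 * (48 * A ^ 2) ^ 2 := by ring
          _ ≤ 1536 * (T ^ 2) ^ 2 := by gcongr
          _ ≤ _ := by nlinarith [sq_nonneg (T ^ 2)]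
      have ha' : (f.a:ℝ) ≠ 0 := by exact_mod_cast ha
      have hd2 : |(f.d:ℝ) - f.b * f.c / (6 * f.a)| ≤ (40 + 4 * C) * (|Hf f.a f.b f.c| / |(f.a:ℝ)|) := by
        rw [mul_div_assoc', le_div_iff₀ (by positivity), ← abs_mul]
        have e : ((f.d:ℝ) - f.b * f.c / (6 * f.a)) * f.a = (54 * (f.a:ℝ) * f.d - 9 * f.b * f.c) / 54 := by
          field_simp; ring
        rw [e, abs_div, abs_of_pos (by norm_num : (0:ℝ) < 54), div_le_iff₀ (by norm_num)]
        have h0 : 0 ≤ |Hf f.a f.b f.c| := by positivity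
        nlinarith [mul_nonneg hC.le h0]
      obtain ⟨r1, -⟩ := hrp hu (abs_nonneg _) (abs_nonneg _) H3 H4 H5 (t := 3/8) (by norm_num) (by norm_num)
      refine ⟨haM, by linarith, by linarith, ?_, q1, ?_, q2, ?_⟩
      · have h9 : √|Hf f.a f.b f.c| ≤ 9 * T := by
          apply Real.sqrt_le_iff.mpr ⟨by positivity, ?_⟩
          nlinarith
        have hs0 : 0 < √|Hf f.a f.b f.c| := Real.sqrt_pos.mpr (by linarith)
        have m1 : (1:ℝ) / 9 ≤ T ^ 2 / √|Hf f.a f.b f.c| := by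
          rw [le_div_iff₀ hs0]; nlinarith
        have m2 : (1:ℝ) / 9 ≤ |Hf f.a f.b f.c| / |(f.a:ℝ)| := by
          rw [le_div_iff₀ (by linarith)]; nlinarith
        have := le_min m1 m2
        nlinarith
      · split_ifs with hif
        · rw [min_eq_left hif, sub_zero, mul_div_assoc', le_div_iff₀ (Real.sqrt_pos.mpr (by linarith))]
          have := mul_pos hC (by positivity : 0 < T ^ 2)
          linarith
        · rw [min_eq_right (le_of_not_ge hif)]
          exact hd2
      · rw [neg_zero, Real.rpow_zero, mul_one]
        clear q1 q2 hd1 hd2 hc h24 H1 H2 H3 H4 H5 hJ hB hx h72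
        generalize |Hf f.a f.b f.c| = h at *
        generalize |(f.a:ℝ)| = u at *
        have hb0 := abs_nonneg (f.b:ℝ)
        generalize |(f.b:ℝ)| = b at *
        have hu0 : 0 < u := by linarith
        have hh0 : 0 < h := by linarith
        have hs0 : 0 < √h := Real.sqrt_pos.mpr hh0
        have e0 := min_le_rp (p := T ^ 2 / √h) (q := h / u) (by positivity) (by positivity)
        have e1 : (T ^ 2 / √h) ^ (1/4:ℝ) * (h / u) ^ (3/4:ℝ) * (T ^ 2 / h) =
            T ^ (5/2:ℝ) * (h ^ (-(3/8):ℝ) * u ^ (-(3/4):ℝ)) := by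
          rw [Real.sqrt_eq_rpow, Real.div_rpow (by positivity) (by positivity),
            Real.div_rpow hh0.le hu0.le, ← Real.rpow_mul hh0.le, ← Real.rpow_natCast T, ← Real.rpow_mul hT0.le]
          have k1 : T ^ (5/2:ℝ) = T ^ (((2:ℕ):ℝ) * (1/4)) * T ^ ((2:ℕ):ℝ) := by
            rw [← Real.rpow_add hT0]; norm_num
          have k2 : h ^ (-(3/8):ℝ) = (h ^ ((1/2:ℝ) * (1/4)))⁻¹ * h ^ (3/4:ℝ) * h⁻¹ := by
            rw [← Real.rpow_neg hh0.le, ← Real.rpow_neg_one h, ← Real.rpow_add hh0, ← Real.rpow_add hh0]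
            norm_num
          rw [k1, k2, Real.rpow_neg hu0.le]
          field_simp
        have e3 := rp1 hu (s := 3/4) (by norm_num) (by norm_num)
        rw [show (2 * (3/8) : ℝ) = 3/4 by norm_num] at r1
        calc (40 + 4 * C) * min (T ^ 2 / √h) (h / u) * ((C + 72) * T ^ 2 / h)
            = ((40 + 4 * C) * (C + 72)) * (min (T ^ 2 / √h) (h / u) * (T ^ 2 / h)) := by ring
          _ ≤ ((40 + 4 * C) * (C + 72)) * ((T ^ 2 / √h) ^ (1/4:ℝ) * (h / u) ^ (3/4:ℝ) * (T ^ 2 / h)) := by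
              gcongr
          _ = ((40 + 4 * C) * (C + 72)) * (T ^ (5/2:ℝ) * (h ^ (-(3/8):ℝ) * u ^ (-(3/4):ℝ))) := by rw [e1]
          _ ≤ ((40 + 4 * C) * (C + 72)) * (T ^ (5/2:ℝ) * ((4 * (1 + b) ^ (-(3/4):ℝ)) * (2 * (1 + u) ^ (-(3/4):ℝ)))) := by
              gcongr
          _ = _ := by ring)
  refine this.trans (le_of_eq ?_)
  rw [Real.mul_rpow (by norm_num) hT0.le]
  have : T ^ (15/4:ℝ) = T ^ (5/2:ℝ) * T ^ (1/4:ℝ) * T := by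
    rw [← Real.rpow_add hT0, ← Real.rpow_add_one hT0.ne']; norm_num
  norm_num
  rw [this]; ring

lemma tri {C T : ℝ} (hC : 0 < C) (hT : 1 ≤ T) {f : BQF} (hf : f ∈ Usc C (T ^ 2)) :
    f.a ≠ 0 ∧ ∃ A y, Bd f.a f.b f.c f.d f.e A y ∧ (A ≤ (C * T ^ 2) ^ (1/3:ℝ) ∨ (Mt C T f A y ∧
      (A ≤ T ^ (4/5:ℝ) ∨
      |54 * (f.a:ℝ) * f.d - 9 * f.b * f.c| ≤ (1 / 2 + 216 * C) * |Hf f.a f.b f.c|))) := by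
  obtain ⟨ha, hI, hJ, x, s, b0, β, hp, hx0, hx1, hs⟩ := hf
  obtain ⟨A, y, hA, hy, hys, hA2, hβ, eI, eJ, ba, bb, bc, bd, be⟩ := hp.bounds hx0 hx1 hs
  have hB : Bd f.a f.b f.c f.d f.e A y := ⟨hA, hy, ba, bb, bc, bd, be⟩
  refine ⟨ha, A, y, hB, ?_⟩
  have hT0 : 0 < T := by linarith
  have hu : (1:ℝ) ≤ |(f.a:ℝ)| := by exact_mod_cast Int.one_le_abs ha
  rw [I_cast, eI, abs_of_nonneg (by positivity)] at hI
  have hAT : 48 * A ^ 2 ≤ T ^ 2 := by nlinarith [sq_nonneg β]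
  have hβA : 1024 * |β| * A ^ 2 < C * T ^ 2 := by
    refine lt_of_le_of_lt ?_ hJ
    rw [J_cast, eJ, abs_mul, abs_mul, abs_of_pos (by norm_num : (0:ℝ) < 128)]
    have : 8 * A ^ 2 ≤ |β ^ 2 - 9 * A ^ 2| := by
      rw [abs_sub_comm]
      refine le_trans ?_ (le_abs_self _)
      have := sq_lt_sq' (by linarith [abs_nonneg β]) hβ
      rw [sq_abs] at this
      linarith
    calc 1024 * |β| * A ^ 2 = 128 * |β| * (8 * A ^ 2) := by ring
      _ ≤ _ := by gcongr
  by_cases hlow : 2 * |β| ≤ A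
  · right
    obtain ⟨-, H1, H2, H3, H4, H5⟩ := hfacts hp hB hys hA2 hlow hu
    refine ⟨⟨ha, hB, hAT, hJ, H1, H2, H3, H4, H5⟩, ?_⟩
    by_cases hR : A ≤ T ^ (4/5:ℝ)
    · left; exact hR
    · right
      push Not at hR
      have hA5 : T ^ 4 ≤ A ^ 5 := by
        have : (T ^ (4/5:ℝ)) ^ 5 ≤ A ^ 5 := by gcongr
        rwa [← Real.rpow_natCast (T ^ (4/5:ℝ)), ← Real.rpow_mul hT0.le,
          show (4/5 * ((5:ℕ):ℝ) : ℝ) = ((4:ℕ):ℝ) by norm_num, Real.rpow_natCast] at this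
      have hy2 : y ^ 2 ≤ 2 * A := by
        have := mul_le_mul_of_nonneg_right hu (sq_nonneg y); linarith
      set h := |Hf f.a f.b f.c| with hh
      have hh0 : 0 ≤ h := abs_nonneg _
      have hhA : 126 * A ≤ h := by
        have := mul_le_mul_of_nonneg_left hy2 hh0
        have : 126 * A * A ≤ h * A := by nlinarith
        exact le_of_mul_le_mul_right this hA
      have hβh : |β| ≤ C * √h := by
        apply le_of_sq_le_sq _ (by positivity)
        rw [mul_pow, Real.sq_sqrt hh0]
        have t1 : (1024 * |β| * A ^ 2) ^ 2 ≤ (C * T ^ 2) ^ 2 := by gcongr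
        have t2 : (1024 ^ 2 * |β| ^ 2) * A ^ 4 ≤ (C ^ 2 * A) * A ^ 4 := by
          calc _ = (1024 * |β| * A ^ 2) ^ 2 := by ring
            _ ≤ (C * T ^ 2) ^ 2 := t1
            _ = C ^ 2 * T ^ 4 := by ring
            _ ≤ C ^ 2 * A ^ 5 := by gcongr
            _ = _ := by ring
        have t3 := le_of_mul_le_mul_right t2 (by positivity)
        have t4 : C ^ 2 * A ≤ C ^ 2 * h := by gcongr; linarith
        nlinarith [sq_nonneg (|β|)]
      have hua : |(f.a:ℝ)| ≤ √h := Real.le_sqrt_of_sq_le H3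
      have hub : |(f.b:ℝ)| ≤ √h := Real.le_sqrt_of_sq_le H4
      have hsq : √h * √h = h := Real.mul_self_sqrt hh0
      have g1 : |β| * |(f.a:ℝ)| ≤ C * h := by
        rw [← hsq, ← mul_assoc]; exact mul_le_mul hβh hua (abs_nonneg _) (by positivity)
      have g2 : |β| * |(f.b:ℝ)| ≤ C * h := by
        rw [← hsq, ← mul_assoc]; exact mul_le_mul hβh hub (abs_nonneg _) (by positivity)
      have e : 54 * (f.a:ℝ) * f.d - 9 * f.b * f.c =
        x * (Hf f.a f.b f.c + 288 * (β * f.a)) - 72 * (β * f.b) := by linear_combination -hp.x_eq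
      rw [e]
      have k1 : |Hf f.a f.b f.c + 288 * (β * f.a)| ≤ h + 288 * (C * h) := by
        refine (abs_add_le _ _).trans ?_
        rw [abs_mul, abs_mul, abs_of_pos (by norm_num : (0:ℝ) < 288)]
        linarith
      have k2 : |x * (Hf f.a f.b f.c + 288 * (β * f.a))| ≤ (1/2) * (h + 288 * (C * h)) := by
        rw [abs_mul, abs_of_nonneg hx0]; gcongr
      refine (abs_sub _ _).trans ?_
      rw [abs_mul 72, abs_mul β, abs_of_pos (by norm_num : (0:ℝ) < 72)]
      linarith
  · left
    push Not at hlow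
    have h3 : A ^ 3 ≤ C * T ^ 2 := by
      have q1 := mul_le_mul_of_nonneg_right hlow.le (sq_nonneg A)
      have q2 : 0 ≤ |β| * A ^ 2 := by positivity
      have q3 : A ^ 3 = A * A ^ 2 := by ring
      linarith
    calc A = (A ^ 3) ^ (1/3:ℝ) := by
          rw [← Real.rpow_natCast, ← Real.rpow_mul hA.le]; norm_num
      _ ≤ _ := by gcongr

lemma tight (C : ℝ) (hC : 0 < C) : ∃ K : ℝ, 0 < K ∧ ∀ κ : ℝ, 0 < κ → ∀ᶠ n : ℕ in atTop,
    (Set.ncard {f ∈ Usc C ((n:ℝ) ^ 2) | |(f.a:ℝ)| ≤ κ * n} : ℝ) ≤ K * κ ^ (1/4:ℝ) * (n:ℝ) ^ 4 := by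
  classical
  obtain ⟨K1, hK1, hl⟩ := low_count
  obtain ⟨K2, hK2, hmid⟩ := mid_count C hC
  obtain ⟨K3, hK3, ht⟩ := top_count C hC
  refine ⟨K3 + 2, by linarith, fun κ hκ => ?_⟩
  have hκ4 : 0 < κ ^ (1/4:ℝ) := by positivity
  have l1 : Tendsto (fun n : ℕ => K1 * C ^ (15/8:ℝ) * (n:ℝ) ^ (-(1/4):ℝ)) atTop (nhds 0) := by
    have := ((tendsto_rpow_neg_atTop (by norm_num : (0:ℝ) < 1/4)).comp tendsto_natCast_atTop_atTop).const_mul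
      (K1 * C ^ (15/8:ℝ))
    simpa using this
  have l2 : Tendsto (fun n : ℕ => K2 * (n:ℝ) ^ (-(1/10):ℝ)) atTop (nhds 0) := by
    have := ((tendsto_rpow_neg_atTop (by norm_num : (0:ℝ) < 1/10)).comp tendsto_natCast_atTop_atTop).const_mul K2
    simpa using this
  have l3 : Tendsto (fun n : ℕ => κ * (n:ℝ)) atTop atTop :=
    tendsto_natCast_atTop_atTop.const_mul_atTop hκ
  have l4 : Tendsto (fun n : ℕ => C * (n:ℝ)) atTop atTop :=
    tendsto_natCast_atTop_atTop.const_mul_atTop hC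
  filter_upwards [l1.eventually (gt_mem_nhds hκ4), l2.eventually (gt_mem_nhds hκ4), l3.eventually_ge_atTop 1,
    l4.eventually_ge_atTop 1, eventually_ge_atTop 1] with n e1 e2 e3 e4 e5
  have hT : (1:ℝ) ≤ n := by exact_mod_cast e5
  generalize (n:ℝ) = T at *
  have hT0 : 0 < T := by linarith
  have hfin : {f ∈ Usc C (T ^ 2) | |(f.a:ℝ)| ≤ κ * T}.Finite := (Usc_finite _ _).subset (fun f hf => hf.1)
  rw [Set.ncard_eq_toFinset_card _ hfin]
  set S := hfin.toFinset with hS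
  have hmem : ∀ f ∈ S, f ∈ Usc C (T ^ 2) ∧ |(f.a:ℝ)| ≤ κ * T := by
    intro f hf; rw [hS, Set.Finite.mem_toFinset] at hf; exact hf
  let S1 := S.filter (fun f => f.a ≠ 0 ∧ ∃ A y, Bd f.a f.b f.c f.d f.e A y ∧ A ≤ (C * T ^ 2) ^ (1/3:ℝ))
  let S2 := S.filter (fun f => ∃ A y, Mt C T f A y ∧ A ≤ T ^ (4/5:ℝ))
  let S3 := S.filter (fun f => ∃ A y, Mt C T f A y ∧ |(f.a:ℝ)| ≤ κ * T ∧
      |54 * (f.a:ℝ) * f.d - 9 * f.b * f.c| ≤ (1 / 2 + 216 * C) * |Hf f.a f.b f.c|)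
  have hsub : S ⊆ S1 ∪ (S2 ∪ S3) := by
    intro f hf
    obtain ⟨h1, h2⟩ := hmem f hf
    obtain ⟨ha, A, y, hB, h3 | ⟨h3, h4 | h4⟩⟩ := tri hC hT h1
    · exact Finset.mem_union_left _ (Finset.mem_filter.mpr ⟨hf, ha, A, y, hB, h3⟩)
    · exact Finset.mem_union_right _ (Finset.mem_union_left _ (Finset.mem_filter.mpr ⟨hf, A, y, h3, h4⟩))
    · exact Finset.mem_union_right _ (Finset.mem_union_right _ (Finset.mem_filter.mpr ⟨hf, A, y, h3, h2, h4⟩))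
  have hc1 : S.card ≤ S1.card + (S2.card + S3.card) :=
    (Finset.card_le_card hsub).trans ((Finset.card_union_le _ _).trans
      (Nat.add_le_add_left (Finset.card_union_le _ _) _))
  have hc2 : (S.card:ℝ) ≤ S1.card + (S2.card + S3.card) := by exact_mod_cast hc1
  have b1 := hl S1 ((C * T ^ 2) ^ (1/3:ℝ)) (Real.one_le_rpow (by nlinarith) (by norm_num))
    (fun f hf => (Finset.mem_filter.mp hf).2)
  have b2 := hmid S2 T (T ^ (4/5:ℝ)) (Real.one_le_rpow hT (by norm_num)) hT (fun f hf => (Finset.mem_filter.mp hf).2)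
  have b3 := ht S3 T (κ * T) e3 hT (fun f hf => (Finset.mem_filter.mp hf).2)
  have f1 : K1 * ((C * T ^ 2) ^ (1/3:ℝ)) ^ (45/8:ℝ) ≤ κ ^ (1/4:ℝ) * T ^ 4 := by
    have : K1 * ((C * T ^ 2) ^ (1/3:ℝ)) ^ (45/8:ℝ) = (K1 * C ^ (15/8:ℝ) * T ^ (-(1/4):ℝ)) * T ^ 4 := by
      rw [← Real.rpow_mul (by positivity), Real.mul_rpow hC.le (by positivity), ← Real.rpow_natCast T,
        ← Real.rpow_natCast T, ← Real.rpow_mul hT0.le, mul_assoc, mul_assoc, ← Real.rpow_add hT0]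
      norm_num
    rw [this]; gcongr
  have f2 : K2 * (T ^ 2 * (T ^ (4/5:ℝ)) ^ (19/8:ℝ)) ≤ κ ^ (1/4:ℝ) * T ^ 4 := by
    have : K2 * (T ^ 2 * (T ^ (4/5:ℝ)) ^ (19/8:ℝ)) = (K2 * T ^ (-(1/10):ℝ)) * T ^ 4 := by
      rw [← Real.rpow_mul hT0.le, ← Real.rpow_natCast T,
        ← Real.rpow_natCast T, ← Real.rpow_add hT0, mul_assoc, ← Real.rpow_add hT0]
      norm_num
    rw [this]; gcongr
  have f3 : K3 * ((κ * T) ^ (1/4:ℝ) * T ^ (15/4:ℝ)) = K3 * κ ^ (1/4:ℝ) * T ^ 4 := by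
    rw [Real.mul_rpow hκ.le hT0.le, mul_assoc, ← Real.rpow_add hT0, ← Real.rpow_natCast T]
    norm_num; ring
  linarith

end BQF



lemma step_gen {α β γ : Type*} [DecidableEq β] [DecidableEq γ] (S : Finset α) (g : α → β) (h : α → γ)
    (N F : ℝ) (hF : 0 ≤ F) (h1 : ((S.image g).card : ℝ) ≤ N)
    (h2 : ∀ y ∈ S.image g, (((S.filter (fun x => g x = y)).image h).card : ℝ) ≤ F) :
    ((S.image (fun x => (g x, h x))).card : ℝ) ≤ N * F := by
  have h3 := fib_sum (S.image (fun x => (g x, h x))) Prod.fst (S.image g)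
    (by intro x hx
        obtain ⟨z, hz, rfl⟩ := Finset.mem_image.mp hx
        exact Finset.mem_image_of_mem _ hz) (fun _ => F) (by
      intro y hy
      refine le_trans ?_ (h2 y hy)
      norm_cast
      refine Finset.card_le_card_of_injOn Prod.snd ?_ ?_
      · intro x hx
        obtain ⟨hx, hxy⟩ := Finset.mem_filter.mp hx
        obtain ⟨z, hz, rfl⟩ := Finset.mem_image.mp hx
        exact Finset.mem_image_of_mem _ (Finset.mem_filter.mpr ⟨hz, hxy⟩)
      · intro x hx x' hx' e
        exact Prod.ext ((Finset.mem_filter.mp hx).2.trans (Finset.mem_filter.mp hx').2.symm) e)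
  refine h3.trans ?_
  rw [Finset.sum_const, nsmul_eq_mul]
  gcongr

lemma step_int {α β : Type*} [DecidableEq β] (S : Finset α) (g : α → β) (h : α → ℤ)
    (N l : ℝ) (hl : 0 ≤ l) (m : β → ℝ) (h1 : ((S.image g).card : ℝ) ≤ N)
    (h2 : ∀ x ∈ S, |(h x : ℝ) - m (g x)| ≤ l) :
    ((S.image (fun x => (g x, h x))).card : ℝ) ≤ N * (2 * l + 1) := by
  refine step_gen S g h N _ (by positivity) h1 (fun y _ => int_card _ (m y) l hl ?_)
  intro k hk
  obtain ⟨x, hx, rfl⟩ := Finset.mem_image.mp hk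
  obtain ⟨hxS, rfl⟩ := Finset.mem_filter.mp hx
  exact h2 x hxS

lemma step_int0 {α : Type*} (S : Finset α) (h : α → ℤ)
    (l : ℝ) (hl : 0 ≤ l) (m : ℝ) (h2 : ∀ x ∈ S, |(h x : ℝ) - m| ≤ l) :
    ((S.image h).card : ℝ) ≤ 2 * l + 1 := by
  refine int_card _ m l hl ?_
  intro k hk
  obtain ⟨x, hx, rfl⟩ := Finset.mem_image.mp hk
  exact h2 x hx

/-- integers with a small quadratic value -/
lemma quad_card (s : Finset ℤ) (α β γ w : ℝ) (hα : α ≠ 0) (hw : 0 ≤ w)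
    (h : ∀ k ∈ s, |α * (k:ℝ) ^ 2 + β * k + γ| ≤ |α| * w) : (s.card : ℝ) ≤ 4 * √(2 * w) + 2 := by
  classical
  set m := -β / (2 * α) with hm
  set D := β ^ 2 / (4 * α ^ 2) - γ / α with hD
  set l := √(max (D - w) 0) with hl
  have key : ∀ k ∈ s, |((k:ℝ) - m)| - l ≤ √(2 * w) ∧ 0 ≤ |(k:ℝ) - m| - l := by
    intro k hk
    have h1 := h k hk
    have e : α * (k:ℝ) ^ 2 + β * k + γ = α * (((k:ℝ) - m) ^ 2 - D) := by
      rw [hm, hD]; field_simp; ring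
    rw [e, abs_mul] at h1
    have h2 := abs_le.mp (le_of_mul_le_mul_left h1 (abs_pos.mpr hα))
    have l0 : 0 ≤ l := Real.sqrt_nonneg _
    have l2 : l ^ 2 = max (D - w) 0 := Real.sq_sqrt (le_max_right _ _)
    have w2 : √(2 * w) ^ 2 = 2 * w := Real.sq_sqrt (by linarith)
    have w0 : 0 ≤ √(2 * w) := Real.sqrt_nonneg _
    rw [← sq_abs] at h2
    have a0 := abs_nonneg ((k:ℝ) - m)
    generalize |(k:ℝ) - m| = t at *
    constructor
    · rw [sub_le_iff_le_add]
      apply le_of_sq_le_sq _ (by positivity)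
      have : D - w ≤ l ^ 2 := l2 ▸ le_max_left _ _
      nlinarith [mul_nonneg w0 l0]
    · rw [sub_nonneg]
      apply le_of_sq_le_sq _ a0
      rw [l2]
      exact max_le (by linarith) (by positivity)
  have c1 := int_card (s.filter (fun k : ℤ => m ≤ k)) (m + l) (√(2 * w)) (by positivity) (by
    intro k hk
    obtain ⟨hk, hk2⟩ := Finset.mem_filter.mp hk
    have := key k hk
    rw [abs_of_nonneg (by linarith : (0:ℝ) ≤ k - m)] at this
    rw [abs_of_nonneg (by linarith)]; linarith)
  have c2 := int_card (s.filter (fun k : ℤ => ¬ m ≤ k)) (m - l) (√(2 * w)) (by positivity) (by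
    intro k hk
    obtain ⟨hk, hk2⟩ := Finset.mem_filter.mp hk
    push Not at hk2
    have := key k hk
    rw [abs_of_neg (by linarith : (k:ℝ) - m < 0)] at this
    rw [abs_le]; constructor <;> linarith)
  have c3 := Finset.card_filter_add_card_filter_not (s := s) (fun k : ℤ => m ≤ k)
  have c4 : ((s.filter (fun k : ℤ => m ≤ k)).card : ℝ) + (s.filter (fun k : ℤ => ¬ m ≤ k)).card = s.card := by
    exact_mod_cast c3
  linarith

lemma root_bound {a b c d e : ℝ} {z : ℂ} {B κ : ℝ} (hκ : 0 < κ) (ha : κ ≤ |a|) (hb : |b| ≤ B) (hc : |c| ≤ B)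
    (hd : |d| ≤ B) (he : |e| ≤ B) (hz : (a:ℂ) * z ^ 4 + b * z ^ 3 + c * z ^ 2 + d * z + e = 0) :
    ‖z‖ ≤ 1 + 4 * B / κ := by
  have hB : 0 ≤ B := (abs_nonneg b).trans hb
  by_cases h1 : ‖z‖ ≤ 1
  · have : 0 ≤ 4 * B / κ := by positivity
    linarith
  push Not at h1
  have e1 : (a:ℂ) * z ^ 4 = -(b * z ^ 3 + c * z ^ 2 + d * z + e) := by linear_combination hz
  have e2 : |a| * ‖z‖ ^ 4 ≤ |b| * ‖z‖ ^ 3 + |c| * ‖z‖ ^ 2 + |d| * ‖z‖ + |e| := by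
    have : ‖(a:ℂ) * z ^ 4‖ = |a| * ‖z‖ ^ 4 := by simp
    rw [← this, e1, norm_neg]
    refine (norm_add_le _ _).trans ?_
    refine add_le_add ((norm_add_le _ _).trans (add_le_add ((norm_add_le _ _).trans ?_) ?_)) ?_ <;> simp
  set t := ‖z‖ with ht
  have t1 : t ≤ t ^ 3 := le_self_pow₀ h1.le (by norm_num)
  have t2 : t ^ 2 ≤ t ^ 3 := pow_le_pow_right₀ h1.le (by norm_num)
  have t3 : 1 ≤ t ^ 3 := one_le_pow₀ h1.le
  have t0 : 0 < t ^ 3 := by positivity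
  have f1 : |b| * t ^ 3 ≤ B * t ^ 3 := by gcongr
  have f2 : |c| * t ^ 2 ≤ B * t ^ 3 := by gcongr
  have f3 : |d| * t ≤ B * t ^ 3 := by gcongr
  have f4 : |e| ≤ B * t ^ 3 := by nlinarith
  have f5 : κ * t * t ^ 3 ≤ (4 * B) * t ^ 3 := by
    have : κ * t ^ 4 ≤ |a| * t ^ 4 := by gcongr
    linarith [show κ * t * t ^ 3 = κ * t ^ 4 by ring]
  have f6 := le_of_mul_le_mul_right f5 t0
  have : t ≤ 4 * B / κ := by rw [le_div_iff₀ hκ]; linarith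
  linarith

lemma quad_factor_bound {a b c d e p q r p' q' r' B κ ρ : ℝ} (hκ : 0 < κ) (ha : κ ≤ |a|) (hb : |b| ≤ B)
    (hc : |c| ≤ B) (hd : |d| ≤ B) (he : |e| ≤ B) (hρ : ρ = 1 + 4 * B / κ) (hp : p ≠ 0)
    (ea : a = p * p') (eb : b = p * q' + q * p') (ec : c = p * r' + q * q' + r * p')
    (ed : d = q * r' + r * q') (ee : e = r * r') : |q| ≤ 2 * ρ * |p| ∧ |r| ≤ ρ ^ 2 * |p| := by
  have hp' : (p:ℂ) ≠ 0 := by exact_mod_cast hp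
  obtain ⟨z, hz⟩ := exists_quadratic_eq_zero (a := (p:ℂ)) (b := (q:ℂ)) (c := (r:ℂ)) hp'
    (IsAlgClosed.exists_eq_mul_self _)
  set z' : ℂ := -q / p - z with hz'
  have hq : (q:ℂ) = -p * (z + z') := by rw [hz']; field_simp; ring
  have hr : (r:ℂ) = p * (z * z') := by
    have : (r:ℂ) = - p * (z * z) - q * z := by linear_combination hz
    rw [this, hq]; ring
  have rt : ∀ y : ℂ, (p:ℂ) * (y * y) + q * y + r = 0 → ‖y‖ ≤ ρ := by
    intro y hy
    rw [hρ]
    apply root_bound hκ ha hb hc hd he (z := y)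
    rw [ea, eb, ec, ed, ee]
    push_cast
    linear_combination (p' * y ^ 2 + q' * y + r') * hy
  have r1 := rt z hz
  have r2 := rt z' (by rw [hq, hr]; ring)
  have nq : |q| = |p| * ‖z + z'‖ := by
    have := congrArg norm hq
    simpa using this
  have nr : |r| = |p| * (‖z‖ * ‖z'‖) := by
    have := congrArg norm hr
    simpa using this
  have n1 := norm_add_le z z'
  have p0 : 0 ≤ |p| := abs_nonneg _
  constructor
  · rw [nq, mul_comm]; gcongr; linarith
  · have r0 : 0 ≤ ρ := (norm_nonneg z).trans r1
    rw [nr, mul_comm, sq]; gcongr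

lemma sum_inv (B : ℝ) (hB : 1 ≤ B) (F : ℝ) (hF : 0 ≤ F) :
    ∑ s ∈ Finset.Icc (1:ℤ) ⌊B⌋, F / (s:ℝ) ≤ F * (4 * B ^ (1/4:ℝ)) := by
  have h0 : (0:ℤ) ≤ ⌊B⌋ := Int.floor_nonneg.mpr (by linarith)
  obtain ⟨N, hN⟩ := Int.eq_ofNat_of_zero_le h0
  have hNB : (N:ℝ) ≤ B := by
    have := Int.floor_le B
    rw [hN] at this; exact_mod_cast this
  have h1 := sum_rpow_nat (3/4) (by norm_num) (by norm_num) N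
  rw [hN]
  have e : ∑ s ∈ Finset.Icc (1:ℤ) (N:ℤ), F / (s:ℝ) = ∑ k ∈ Finset.range N, F / (1 + (k:ℝ)) := by
    symm
    refine Finset.sum_bij (fun k _ => (1 + k : ℤ)) ?_ ?_ ?_ ?_
    · intro k hk; rw [Finset.mem_range] at hk; rw [Finset.mem_Icc]; omega
    · intro k _ k' _ h; simp at h; exact h
    · intro s hs; rw [Finset.mem_Icc] at hs
      exact ⟨(s - 1).toNat, by rw [Finset.mem_range]; omega, by omega⟩
    · intro k _; push_cast; rfl
  rw [e]
  calc ∑ k ∈ Finset.range N, F / (1 + (k:ℝ)) ≤ ∑ k ∈ Finset.range N, F * (1 + (k:ℝ)) ^ (-(3/4):ℝ) := by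
        apply Finset.sum_le_sum
        intro k _
        rw [div_eq_mul_inv, ← Real.rpow_neg_one]
        have hk : (1:ℝ) ≤ 1 + k := by linarith [(Nat.cast_nonneg k : (0:ℝ) ≤ k)]
        gcongr
        norm_num
    _ = F * ∑ k ∈ Finset.range N, (1 + (k:ℝ)) ^ (-(3/4):ℝ) := by rw [Finset.mul_sum]
    _ ≤ F * (1 / (1 - 3/4) * (N:ℝ) ^ (1 - 3/4:ℝ)) := by gcongr
    _ ≤ F * (4 * B ^ (1/4:ℝ)) := by
        norm_num; gcongr



namespace BQF
open Polynomial in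
lemma q4 {a b c d e a' b' c' d' e' : ℤ}
    (h : (C a * X ^ 4 + C b * X ^ 3 + C c * X ^ 2 + C d * X + C e : ℤ[X]) =
      C a' * X ^ 4 + C b' * X ^ 3 + C c' * X ^ 2 + C d' * X + C e') :
    a = a' ∧ b = b' ∧ c = c' ∧ d = d' ∧ e = e' := by
  have k : ∀ (a b c d e : ℤ), (C a * X ^ 4 + C b * X ^ 3 + C c * X ^ 2 + C d * X + C e : ℤ[X]).coeff 4 = a ∧
      (C a * X ^ 4 + C b * X ^ 3 + C c * X ^ 2 + C d * X + C e : ℤ[X]).coeff 3 = b ∧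
      (C a * X ^ 4 + C b * X ^ 3 + C c * X ^ 2 + C d * X + C e : ℤ[X]).coeff 2 = c ∧
      (C a * X ^ 4 + C b * X ^ 3 + C c * X ^ 2 + C d * X + C e : ℤ[X]).coeff 1 = d ∧
      (C a * X ^ 4 + C b * X ^ 3 + C c * X ^ 2 + C d * X + C e : ℤ[X]).coeff 0 = e := by
    intro a b c d e
    refine ⟨?_, ?_, ?_, ?_, ?_⟩ <;>
      simp only [coeff_add, coeff_C_mul, coeff_X_pow, coeff_X, coeff_C] <;> norm_num
  obtain ⟨h4, h3, h2, h1, h0⟩ := k a b c d e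
  obtain ⟨h4', h3', h2', h1', h0'⟩ := k a' b' c' d' e'
  rw [h] at h4 h3 h2 h1 h0
  exact ⟨h4.symm.trans h4', h3.symm.trans h3', h2.symm.trans h2', h1.symm.trans h1', h0.symm.trans h0'⟩

open Polynomial in
lemma red_int (f : BQF) (ha : f.a ≠ 0) (hf : ¬ f.Irred) : ∃ g h : ℤ[X],
    C f.a * X ^ 4 + C f.b * X ^ 3 + C f.c * X ^ 2 + C f.d * X + C f.e = g * h ∧
    1 ≤ g.natDegree ∧ 1 ≤ h.natDegree ∧ g.natDegree + h.natDegree = 4 := by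
  set P : ℤ[X] := C f.a * X ^ 4 + C f.b * X ^ 3 + C f.c * X ^ 2 + C f.d * X + C f.e with hP
  have hdeg : P.natDegree = 4 := by rw [hP]; compute_degree!
  have hP0 : P ≠ 0 := by intro h; rw [h] at hdeg; simp at hdeg
  have hc0 : P.content ≠ 0 := by rwa [Ne, content_eq_zero_iff]
  have hirr : ¬ Irreducible P.primPart := by
    intro h
    rw [IsPrimitive.Int.irreducible_iff_irreducible_map_cast (isPrimitive_primPart P)] at h
    apply hf
    refine ⟨ha, ?_⟩
    have e : P.map (Int.castRingHom ℚ) = C (P.content : ℚ) * P.primPart.map (Int.castRingHom ℚ) := by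
      conv_lhs => rw [P.eq_C_content_mul_primPart]
      simp
    have hu : IsUnit (C (P.content : ℚ)) := by
      rw [isUnit_C]; exact IsUnit.mk0 _ (by exact_mod_cast hc0)
    have h2 := (irreducible_isUnit_mul hu).mpr h
    rw [← e, hP] at h2
    simpa using h2
  have hnu : ¬ IsUnit P.primPart := by
    intro h
    have := natDegree_eq_zero_of_isUnit h
    rw [natDegree_primPart, hdeg] at this
    norm_num at this
  rw [irreducible_iff] at hirr
  push Not at hirr
  obtain ⟨g, h, hgh, hg, hh⟩ := hirr hnu
  have hprim := isPrimitive_primPart P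
  have key : ∀ u v : ℤ[X], P.primPart = u * v → ¬ IsUnit u → 1 ≤ u.natDegree := by
    intro u v huv hu
    by_contra hd
    have hd0 : u.natDegree = 0 := by omega
    rw [eq_C_of_natDegree_eq_zero hd0] at huv hu
    exact hu (isUnit_C.mpr (hprim _ ⟨v, huv⟩))
  have g1 := key g h hgh hg
  have h1 := key h g (by rw [hgh, mul_comm]) hh
  refine ⟨C P.content * g, h, ?_, ?_, h1, ?_⟩
  · rw [mul_assoc, ← hgh]; exact P.eq_C_content_mul_primPart
  · rwa [natDegree_C_mul hc0]
  · rw [natDegree_C_mul hc0, ← natDegree_mul, ← hgh, natDegree_primPart, hdeg]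
    · intro h; rw [h] at g1; simp at g1
    · intro h; rw [h] at h1; simp at h1

open Polynomial in
lemma red_cases (f : BQF) (ha : f.a ≠ 0) (hf : ¬ f.Irred) :
    (∃ v : Fin 6 → ℤ, 1 ≤ v 0 ∧ f.a = v 0 * v 2 ∧ f.b = v 0 * v 3 - v 1 * v 2 ∧ f.c = v 0 * v 4 - v 1 * v 3 ∧
      f.d = v 0 * v 5 - v 1 * v 4 ∧ f.e = - v 1 * v 5) ∨
    (∃ v : Fin 6 → ℤ, 1 ≤ v 0 ∧ f.a = v 0 * v 3 ∧ f.b = v 0 * v 4 + v 1 * v 3 ∧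
      f.c = v 0 * v 5 + v 1 * v 4 + v 2 * v 3 ∧ f.d = v 1 * v 5 + v 2 * v 4 ∧ f.e = v 2 * v 5) := by
  obtain ⟨g, h, hgh, hg, hh, hs⟩ := red_int f ha hf
  have lin : ∀ g h : ℤ[X], C f.a * X ^ 4 + C f.b * X ^ 3 + C f.c * X ^ 2 + C f.d * X + C f.e = g * h →
      g.natDegree = 1 → h.natDegree = 3 → (∃ v : Fin 6 → ℤ, 1 ≤ v 0 ∧ f.a = v 0 * v 2 ∧
      f.b = v 0 * v 3 - v 1 * v 2 ∧ f.c = v 0 * v 4 - v 1 * v 3 ∧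
      f.d = v 0 * v 5 - v 1 * v 4 ∧ f.e = - v 1 * v 5) := by
    intro g h hgh hg hh
    have eg := g.as_sum_range_C_mul_X_pow
    have eh := h.as_sum_range_C_mul_X_pow
    rw [hg] at eg
    rw [hh] at eh
    simp only [Finset.sum_range_succ, Finset.sum_range_zero] at eg eh
    generalize g.coeff 0 = g0 at *
    generalize g.coeff 1 = g1 at *
    generalize h.coeff 0 = h0 at *
    generalize h.coeff 1 = h1 at *
    generalize h.coeff 2 = h2 at *
    generalize h.coeff 3 = h3 at *
    have key : C f.a * X ^ 4 + C f.b * X ^ 3 + C f.c * X ^ 2 + C f.d * X + C f.e =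
      C (g1 * h3) * X ^ 4 + C (g1 * h2 + g0 * h3) * X ^ 3 + C (g1 * h1 + g0 * h2) * X ^ 2 +
      C (g1 * h0 + g0 * h1) * X + C (g0 * h0) := by
      rw [hgh, eg, eh]; simp only [map_mul, map_add]; ring
    obtain ⟨k4, k3, k2, k1, k0⟩ := q4 key
    have hg1 : g1 ≠ 0 := by rintro rfl; simp at k4; exact ha k4
    rcases lt_or_gt_of_ne hg1 with hneg | hpos
    · refine ⟨![-g1, g0, -h3, -h2, -h1, -h0], ?_, ?_, ?_, ?_, ?_, ?_⟩ <;> simp [k0, k1, k2, k3, k4] <;> first | omega | ring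
    · refine ⟨![g1, -g0, h3, h2, h1, h0], ?_, ?_, ?_, ?_, ?_, ?_⟩ <;> simp [k0, k1, k2, k3, k4] <;> omega
  rcases (by omega : (g.natDegree = 1 ∧ h.natDegree = 3) ∨ (h.natDegree = 1 ∧ g.natDegree = 3) ∨
    (g.natDegree = 2 ∧ h.natDegree = 2)) with ⟨h1, h2⟩ | ⟨h1, h2⟩ | ⟨hg, hh⟩
  · left; exact lin g h hgh h1 h2
  · left; exact lin h g (by rw [hgh, mul_comm]) h1 h2
  · right
    have eg := g.as_sum_range_C_mul_X_pow
    have eh := h.as_sum_range_C_mul_X_pow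
    rw [hg] at eg
    rw [hh] at eh
    simp only [Finset.sum_range_succ, Finset.sum_range_zero] at eg eh
    generalize g.coeff 0 = g0 at *
    generalize g.coeff 1 = g1 at *
    generalize g.coeff 2 = g2 at *
    generalize h.coeff 0 = h0 at *
    generalize h.coeff 1 = h1 at *
    generalize h.coeff 2 = h2 at *
    have key : C f.a * X ^ 4 + C f.b * X ^ 3 + C f.c * X ^ 2 + C f.d * X + C f.e =
      C (g2 * h2) * X ^ 4 + C (g2 * h1 + g1 * h2) * X ^ 3 + C (g2 * h0 + g1 * h1 + g0 * h2) * X ^ 2 +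
      C (g1 * h0 + g0 * h1) * X + C (g0 * h0) := by
      rw [hgh, eg, eh]; simp only [map_mul, map_add]; ring
    obtain ⟨k4, k3, k2, k1, k0⟩ := q4 key
    have hg1 : g2 ≠ 0 := by rintro rfl; simp at k4; exact ha k4
    rcases lt_or_gt_of_ne hg1 with hneg | hpos
    · refine ⟨![-g2, -g1, -g0, -h2, -h1, -h0], ?_, ?_, ?_, ?_, ?_, ?_⟩ <;> simp [k0, k1, k2, k3, k4] <;> first | omega | ring
    · refine ⟨![g2, g1, g0, h2, h1, h0], ?_, ?_, ?_, ?_, ?_, ?_⟩ <;> simp [k0, k1, k2, k3, k4] <;> omega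

end BQF



namespace BQF

set_option maxHeartbeats 1000000 in
lemma lin_count (C κ M : ℝ) (hC : 0 < C) (hκ : 0 < κ) (hM : 1 ≤ M) : ∃ K : ℝ, 0 < K ∧ ∀ (S : Finset BQF) (T : ℝ),
    1 ≤ T → (∀ f ∈ S, f.a ≠ 0 ∧ κ * T ≤ |(f.a:ℝ)| ∧ |(f.a:ℝ)| ≤ M * T ∧ |(f.b:ℝ)| ≤ M * T ∧ |(f.c:ℝ)| ≤ M * T ∧
      |(f.d:ℝ)| ≤ M * T ∧ |(f.e:ℝ)| ≤ M * T ∧ |(f.J:ℝ)| < C * T ^ 2) →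
    (∀ f ∈ S, ∃ v : Fin 6 → ℤ, 1 ≤ v 0 ∧ f.a = v 0 * v 2 ∧ f.b = v 0 * v 3 - v 1 * v 2 ∧ f.c = v 0 * v 4 - v 1 * v 3 ∧
      f.d = v 0 * v 5 - v 1 * v 4 ∧ f.e = - v 1 * v 5) → (S.card : ℝ) ≤ K * T ^ (15/4:ℝ) := by
  classical
  set ρ := 1 + 4 * M / κ with hρ
  have hρ1 : 1 ≤ ρ := by rw [hρ]; have : 0 ≤ 4 * M / κ := by positivity
                         linarith
  set F0 := 4 * √(2 * (C / (27 * κ))) + 2 with hF0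
  have hF00 : 0 < F0 := by rw [hF0]; positivity
  refine ⟨81 * ρ * M ^ 3 * F0 * (4 * M ^ (1/4:ℝ)), by positivity, fun S T hT hS hv => ?_⟩
  have hT0 : 0 < T := by linarith
  set B := M * T with hB
  have hB1 : 1 ≤ B := by rw [hB]; nlinarith
  choose! v hv0 hva hvb hvc hvd hve using hv
  have ha2 : ∀ f ∈ S, v f 2 ≠ 0 := by
    intro f hf h
    apply (hS f hf).1
    rw [hva f hf, h, mul_zero]
  set w := C * T / (27 * κ) with hw
  have hw0 : 0 ≤ w := by rw [hw]; positivity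
  have hmain := fib_sum S (fun f => v f 0) (Finset.Icc 1 ⌊B⌋) (by
      intro f hf
      rw [Finset.mem_Icc]
      refine ⟨hv0 f hf, Int.le_floor.mpr ?_⟩
      have h1 := (hS f hf).2.2.1
      rw [hva f hf, Int.cast_mul, abs_mul] at h1
      have h2 : (1:ℝ) ≤ |((v f 2 : ℤ) : ℝ)| := by exact_mod_cast Int.one_le_abs (ha2 f hf)
      have h3 := le_abs_self ((v f 0 : ℤ) : ℝ)
      have h4 := abs_nonneg ((v f 0 : ℤ) : ℝ)
      nlinarith) (fun s => (81 * ρ * M ^ 3 * F0 * T ^ (7/2:ℝ)) / (s:ℝ)) (by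
      intro s hs
      rw [Finset.mem_Icc] at hs
      have hs1 : (1:ℝ) ≤ s := by exact_mod_cast hs.1
      have hsB : (s:ℝ) ≤ B := Int.le_floor.mp hs.2
      have hs0 : (0:ℝ) < s := by linarith
      set R := S.filter (fun f => v f 0 = s) with hR
      have hRS : ∀ f ∈ R, f ∈ S ∧ v f 0 = s := fun f hf => Finset.mem_filter.mp hf
      have c1 := step_int0 R (fun f => v f 1) (ρ * s) (by positivity) 0 (by
        intro f hf
        obtain ⟨hf, h0⟩ := hRS f hf
        obtain ⟨_, h1, h2, h3, h4, h5, h6, _⟩ := hS f hf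
        have := root_bound (z := (((v f 1 : ℤ) : ℝ) / s : ℝ)) (by positivity) h1 h3 h4 h5 h6 (by
          rw [hva f hf, hvb f hf, hvc f hf, hvd f hf, hve f hf, h0]
          have : (s:ℂ) ≠ 0 := by exact_mod_cast hs0.ne'
          push_cast
          field_simp
          ring)
        rw [Complex.norm_real, Real.norm_eq_abs, abs_div, abs_of_pos hs0, div_le_iff₀ hs0] at this
        rw [sub_zero]
        have e : 1 + 4 * (M * T) / (κ * T) = ρ := by rw [hρ]; field_simp
        rw [hB, e] at this
        exact this)
      have c2 := step_int R (fun f => v f 1) (fun f => v f 2) _ (B / s) (by positivity) (fun _ => 0) c1 (by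
        intro f hf
        obtain ⟨hf, h0⟩ := hRS f hf
        obtain ⟨_, h1, h2, h3, h4, h5, h6, _⟩ := hS f hf
        rw [hva f hf, h0, Int.cast_mul, abs_mul, abs_of_pos hs0] at h2
        rw [sub_zero, le_div_iff₀ hs0]; linarith)
      have c3 := step_int R (fun f => (v f 1, v f 2)) (fun f => v f 3) _ (B / s) (by positivity)
        (fun y => (y.1:ℝ) * y.2 / s) c2 (by
        intro f hf
        obtain ⟨hf, h0⟩ := hRS f hf
        obtain ⟨_, h1, h2, h3, h4, h5, h6, _⟩ := hS f hf
        rw [hvb f hf, h0] at h3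
        push_cast at h3
        have e : (((v f 3 : ℤ):ℝ) - ((v f 1 : ℤ):ℝ) * ((v f 2 : ℤ):ℝ) / s) * s =
          s * ((v f 3 : ℤ):ℝ) - ((v f 1 : ℤ):ℝ) * ((v f 2 : ℤ):ℝ) := by field_simp
        rw [← e, abs_mul, abs_of_pos hs0] at h3
        rw [le_div_iff₀ hs0]; exact h3)
      have c4 := step_int R (fun f => ((v f 1, v f 2), v f 3)) (fun f => v f 4) _ (B / s) (by positivity)
        (fun y => (y.1.1:ℝ) * y.2 / s) c3 (by
        intro f hf
        obtain ⟨hf, h0⟩ := hRS f hf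
        obtain ⟨_, h1, h2, h3, h4, h5, h6, _⟩ := hS f hf
        rw [hvc f hf, h0] at h4
        push_cast at h4
        have e : (((v f 4 : ℤ):ℝ) - ((v f 1 : ℤ):ℝ) * ((v f 3 : ℤ):ℝ) / s) * s =
          s * ((v f 4 : ℤ):ℝ) - ((v f 1 : ℤ):ℝ) * ((v f 3 : ℤ):ℝ) := by field_simp
        rw [← e, abs_mul, abs_of_pos hs0] at h4
        rw [le_div_iff₀ hs0]; exact h4)
      have c5 := step_gen R (fun f => (((v f 1, v f 2), v f 3), v f 4)) (fun f => v f 5) _ (4 * √(2 * w) + 2)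
        (by positivity) c4 (by
        rintro ⟨⟨⟨r, a'⟩, b'⟩, c'⟩ hy
        obtain ⟨f0, hf0, e0⟩ := Finset.mem_image.mp hy
        simp only [Prod.mk.injEq] at e0
        obtain ⟨hf0, h00⟩ := hRS f0 hf0
        have ha' : a' ≠ 0 := by rw [← e0.1.1.2]; exact ha2 f0 hf0
        have ha'' : (a':ℝ) ≠ 0 := by exact_mod_cast ha'
        set a : ℝ := s * a' with hha
        set b : ℝ := s * b' - r * a' with hhb
        set c : ℝ := s * c' - r * b' with hhc
        apply quad_card _ (-27 * a * s ^ 2) (-72 * a * c * r + 9 * b * c * s + 54 * a * s * r * c' + 27 * r * b ^ 2)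
          (-9 * b * c * (r * c') - 27 * a * r ^ 2 * c' ^ 2 - 2 * c ^ 3) w (by positivity) hw0
        intro k hk
        obtain ⟨f, hf, rfl⟩ := Finset.mem_image.mp hk
        obtain ⟨hf, e1⟩ := Finset.mem_filter.mp hf
        simp only [Prod.mk.injEq] at e1
        obtain ⟨⟨⟨e1, e2⟩, e3⟩, e4⟩ := e1
        obtain ⟨hf, h0⟩ := hRS f hf
        obtain ⟨_, h1, h2, h3, h4, h5, h6, h7⟩ := hS f hf
        have fa : (f.a:ℝ) = a := by rw [hva f hf, h0, e2]; push_cast; rfl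
        have hJ : (f.J:ℝ) = (-27 * a * s ^ 2) * ((v f 5 : ℤ):ℝ) ^ 2 +
          (-72 * a * c * r + 9 * b * c * s + 54 * a * s * r * c' + 27 * r * b ^ 2) * ((v f 5 : ℤ):ℝ) +
          (-9 * b * c * (r * c') - 27 * a * r ^ 2 * c' ^ 2 - 2 * c ^ 3) := by
          rw [BQF.J, hva f hf, hvb f hf, hvc f hf, hvd f hf, hve f hf, h0, e1, e2, e3, e4, hha, hhb, hhc]
          push_cast; ring
        rw [← hJ]
        refine h7.le.trans ?_
        rw [fa] at h1
        rw [abs_mul, abs_mul, abs_of_pos (by positivity : (0:ℝ) < (s:ℝ) ^ 2), abs_neg,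
          abs_of_pos (by norm_num : (0:ℝ) < 27)]
        calc C * T ^ 2 = 27 * (κ * T) * 1 * w := by rw [hw]; field_simp
          _ ≤ 27 * |a| * (s:ℝ) ^ 2 * w := by
            gcongr
            exact one_le_pow₀ hs1)
      have hinj : Set.InjOn (fun f => ((((v f 1, v f 2), v f 3), v f 4), v f 5)) (R : Set BQF) := by
        intro f hf g hg hfg
        simp only [Prod.mk.injEq] at hfg
        obtain ⟨⟨⟨⟨e1, e2⟩, e3⟩, e4⟩, e5⟩ := hfg
        obtain ⟨hf, h0⟩ := hRS f hf
        obtain ⟨hg, h0'⟩ := hRS g hg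
        apply ext'
        · rw [hva f hf, hva g hg, h0, h0', e2]
        · rw [hvb f hf, hvb g hg, h0, h0', e1, e2, e3]
        · rw [hvc f hf, hvc g hg, h0, h0', e1, e3, e4]
        · rw [hvd f hf, hvd g hg, h0, h0', e1, e4, e5]
        · rw [hve f hf, hve g hg, e1, e5]
      rw [Finset.card_image_of_injOn hinj] at c5
      refine c5.trans ?_
      have k1 : 2 * (ρ * s) + 1 ≤ 3 * ρ * s := by nlinarith
      have k2 : 2 * (B / s) + 1 ≤ 3 * (B / s) := by
        have : 1 ≤ B / s := by rw [le_div_iff₀ hs0]; linarith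
        linarith
      have k3 : 4 * √(2 * w) + 2 ≤ F0 * √T := by
        have e : 2 * w = (2 * (C / (27 * κ))) * T := by rw [hw]; field_simp
        rw [e, Real.sqrt_mul (by positivity), hF0]
        have : 1 ≤ √T := Real.one_le_sqrt.mpr hT
        linarith
      have kB : 0 ≤ 2 * (B / s) + 1 := by positivity
      calc (2 * (ρ * s) + 1) * (2 * (B / s) + 1) * (2 * (B / s) + 1) * (2 * (B / s) + 1) * (4 * √(2 * w) + 2)
          ≤ (3 * ρ * s) * (3 * (B / s)) * (3 * (B / s)) * (3 * (B / s)) * (F0 * √T) := by gcongr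
        _ = (81 * ρ * M ^ 3 * F0 * (T ^ 3 * √T)) / (s * s) := by rw [hB]; field_simp; ring
        _ ≤ (81 * ρ * M ^ 3 * F0 * (T ^ 3 * √T)) / s := by
            apply div_le_div_of_nonneg_left (by positivity) hs0; nlinarith
        _ = _ := by
            rw [Real.sqrt_eq_rpow, ← Real.rpow_natCast T, ← Real.rpow_add hT0]; norm_num)
  refine hmain.trans ((sum_inv B hB1 _ (by positivity)).trans (le_of_eq ?_))
  rw [hB, Real.mul_rpow (by positivity) hT0.le]
  have : T ^ (15/4:ℝ) = T ^ (7/2:ℝ) * T ^ (1/4:ℝ) := by rw [← Real.rpow_add hT0]; norm_num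
  rw [this]; ring

lemma qc_alg {ρ s B : ℝ} (hs : s ≠ 0) : (5 * (ρ * s)) * (3 * (ρ ^ 2 * s)) * (3 * (B / s)) * (5 * (ρ * (B / s))) *
    (3 * (ρ ^ 2 * (B / s))) = 675 * ρ ^ 6 * B ^ 3 / s := by
  field_simp; ring

set_option maxHeartbeats 1000000 in
lemma quad_count (κ M : ℝ) (hκ : 0 < κ) (hM : 1 ≤ M) : ∃ K : ℝ, 0 < K ∧ ∀ (S : Finset BQF) (T : ℝ),
    1 ≤ T → (∀ f ∈ S, f.a ≠ 0 ∧ κ * T ≤ |(f.a:ℝ)| ∧ |(f.a:ℝ)| ≤ M * T ∧ |(f.b:ℝ)| ≤ M * T ∧ |(f.c:ℝ)| ≤ M * T ∧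
      |(f.d:ℝ)| ≤ M * T ∧ |(f.e:ℝ)| ≤ M * T) →
    (∀ f ∈ S, ∃ v : Fin 6 → ℤ, 1 ≤ v 0 ∧ f.a = v 0 * v 3 ∧ f.b = v 0 * v 4 + v 1 * v 3 ∧
      f.c = v 0 * v 5 + v 1 * v 4 + v 2 * v 3 ∧ f.d = v 1 * v 5 + v 2 * v 4 ∧ f.e = v 2 * v 5) →
      (S.card : ℝ) ≤ K * T ^ (13/4:ℝ) := by
  classical
  set ρ := 1 + 4 * M / κ with hρ
  have hρ1 : 1 ≤ ρ := by rw [hρ]; have : 0 ≤ 4 * M / κ := by positivity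
                         linarith
  refine ⟨675 * ρ ^ 6 * M ^ 3 * (4 * M ^ (1/4:ℝ)), by positivity, fun S T hT hS hv => ?_⟩
  have hT0 : 0 < T := by linarith
  set B := M * T with hB
  have hB1 : 1 ≤ B := by rw [hB]; nlinarith
  have e : 1 + 4 * (M * T) / (κ * T) = ρ := by rw [hρ]; field_simp
  choose! v hv0 hva hvb hvc hvd hve using hv
  have ha2 : ∀ f ∈ S, v f 3 ≠ 0 := by
    intro f hf h
    apply (hS f hf).1
    rw [hva f hf, h, mul_zero]
  have hmain := fib_sum S (fun f => v f 0) (Finset.Icc 1 ⌊B⌋) (by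
      intro f hf
      rw [Finset.mem_Icc]
      refine ⟨hv0 f hf, Int.le_floor.mpr ?_⟩
      have h1 := (hS f hf).2.2.1
      rw [hva f hf, Int.cast_mul, abs_mul] at h1
      have h2 : (1:ℝ) ≤ |((v f 3 : ℤ) : ℝ)| := by exact_mod_cast Int.one_le_abs (ha2 f hf)
      have h3 := le_abs_self ((v f 0 : ℤ) : ℝ)
      have h4 := abs_nonneg ((v f 0 : ℤ) : ℝ)
      nlinarith) (fun s => (675 * ρ ^ 6 * M ^ 3 * T ^ (3:ℝ)) / (s:ℝ)) (by
      intro s hs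
      rw [Finset.mem_Icc] at hs
      have hs1 : (1:ℝ) ≤ s := by exact_mod_cast hs.1
      have hsB : (s:ℝ) ≤ B := Int.le_floor.mp hs.2
      have hs0 : (0:ℝ) < s := by linarith
      set R := S.filter (fun f => v f 0 = s) with hR
      have hRS : ∀ f ∈ R, f ∈ S ∧ v f 0 = s := fun f hf => Finset.mem_filter.mp hf
      have b3 : ∀ f ∈ R, |((v f 3 : ℤ):ℝ)| ≤ B / s := by
        intro f hf
        obtain ⟨hf, h0⟩ := hRS f hf
        obtain ⟨_, h1, h2, h3, h4, h5, h6⟩ := hS f hf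
        rw [hva f hf, h0, Int.cast_mul, abs_mul, abs_of_pos hs0] at h2
        rw [le_div_iff₀ hs0]; linarith
      have b12 : ∀ f ∈ R, |((v f 1 : ℤ):ℝ)| ≤ 2 * ρ * s ∧ |((v f 2 : ℤ):ℝ)| ≤ ρ ^ 2 * s := by
        intro f hf
        obtain ⟨hf, h0⟩ := hRS f hf
        obtain ⟨_, h1, h2, h3, h4, h5, h6⟩ := hS f hf
        have := quad_factor_bound (p := s) (q := ((v f 1:ℤ):ℝ)) (r := ((v f 2:ℤ):ℝ)) (p' := ((v f 3:ℤ):ℝ))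
          (q' := ((v f 4:ℤ):ℝ)) (r' := ((v f 5:ℤ):ℝ)) (ρ := ρ) (by positivity) h1 h3 h4 h5 h6 e.symm hs0.ne'
          (by rw [hva f hf, h0]; push_cast; ring) (by rw [hvb f hf, h0]; push_cast; ring)
          (by rw [hvc f hf, h0]; push_cast; ring) (by rw [hvd f hf]; push_cast; ring)
          (by rw [hve f hf]; push_cast; ring)
        rwa [abs_of_pos hs0] at this
      have b45 : ∀ f ∈ R, |((v f 4 : ℤ):ℝ)| ≤ 2 * ρ * (B / s) ∧ |((v f 5 : ℤ):ℝ)| ≤ ρ ^ 2 * (B / s) := by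
        intro f hf
        have hb3 := b3 f hf
        obtain ⟨hf, h0⟩ := hRS f hf
        obtain ⟨_, h1, h2, h3, h4, h5, h6⟩ := hS f hf
        have hne : ((v f 3:ℤ):ℝ) ≠ 0 := by exact_mod_cast ha2 f hf
        obtain ⟨t1, t2⟩ := quad_factor_bound (p' := s) (q' := ((v f 1:ℤ):ℝ)) (r' := ((v f 2:ℤ):ℝ)) (p := ((v f 3:ℤ):ℝ))
          (q := ((v f 4:ℤ):ℝ)) (r := ((v f 5:ℤ):ℝ)) (ρ := ρ) (by positivity) h1 h3 h4 h5 h6 e.symm hne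
          (by rw [hva f hf, h0]; push_cast; ring) (by rw [hvb f hf, h0]; push_cast; ring)
          (by rw [hvc f hf, h0]; push_cast; ring) (by rw [hvd f hf]; push_cast; ring)
          (by rw [hve f hf]; push_cast; ring)
        exact ⟨t1.trans (by gcongr), t2.trans (by gcongr)⟩
      have c1 := step_int0 R (fun f => v f 1) (2 * ρ * s) (by positivity) 0 (by
        intro f hf; rw [sub_zero]; exact (b12 f hf).1)
      have c2 := step_int R (fun f => v f 1) (fun f => v f 2) _ (ρ ^ 2 * s) (by positivity) (fun _ => 0) c1 (by
        intro f hf; rw [sub_zero]; exact (b12 f hf).2)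
      have c3 := step_int R (fun f => (v f 1, v f 2)) (fun f => v f 3) _ (B / s) (by positivity)
        (fun _ => 0) c2 (by intro f hf; rw [sub_zero]; exact b3 f hf)
      have c4 := step_int R (fun f => ((v f 1, v f 2), v f 3)) (fun f => v f 4) _ (2 * ρ * (B / s)) (by positivity)
        (fun _ => 0) c3 (by intro f hf; rw [sub_zero]; exact (b45 f hf).1)
      have c5 := step_int R (fun f => (((v f 1, v f 2), v f 3), v f 4)) (fun f => v f 5) _ (ρ ^ 2 * (B / s))
        (by positivity) (fun _ => 0) c4 (by intro f hf; rw [sub_zero]; exact (b45 f hf).2)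
      have hinj : Set.InjOn (fun f => ((((v f 1, v f 2), v f 3), v f 4), v f 5)) (R : Set BQF) := by
        intro f hf g hg hfg
        simp only [Prod.mk.injEq] at hfg
        obtain ⟨⟨⟨⟨e1, e2⟩, e3⟩, e4⟩, e5⟩ := hfg
        obtain ⟨hf, h0⟩ := hRS f hf
        obtain ⟨hg, h0'⟩ := hRS g hg
        apply ext'
        · rw [hva f hf, hva g hg, h0, h0', e3]
        · rw [hvb f hf, hvb g hg, h0, h0', e1, e4, e3]
        · rw [hvc f hf, hvc g hg, h0, h0', e1, e2, e3, e4, e5]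
        · rw [hvd f hf, hvd g hg, e1, e2, e4, e5]
        · rw [hve f hf, hve g hg, e2, e5]
      rw [Finset.card_image_of_injOn hinj] at c5
      refine c5.trans ?_
      have hBs : 1 ≤ B / s := by rw [le_div_iff₀ hs0]; linarith
      have h1s : 1 ≤ ρ * s := by nlinarith
      have h2s : 1 ≤ ρ ^ 2 * s := by nlinarith
      have h1b : 1 ≤ ρ * (B / s) := by nlinarith
      have h2b : 1 ≤ ρ ^ 2 * (B / s) := by nlinarith
      have k1 : 2 * (2 * ρ * s) + 1 ≤ 5 * (ρ * s) := by linarith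
      have k2 : 2 * (ρ ^ 2 * s) + 1 ≤ 3 * (ρ ^ 2 * s) := by linarith
      have k3 : 2 * (B / s) + 1 ≤ 3 * (B / s) := by linarith
      have k4 : 2 * (2 * ρ * (B / s)) + 1 ≤ 5 * (ρ * (B / s)) := by linarith
      have k5 : 2 * (ρ ^ 2 * (B / s)) + 1 ≤ 3 * (ρ ^ 2 * (B / s)) := by linarith
      calc _ ≤ (5 * (ρ * s)) * (3 * (ρ ^ 2 * s)) * (3 * (B / s)) * (5 * (ρ * (B / s))) * (3 * (ρ ^ 2 * (B / s))) := by
            gcongr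
        _ = _ := by
            have e3 : T ^ (3:ℝ) = T ^ 3 := by rw [← Real.rpow_natCast T]; norm_num
            rw [e3, qc_alg hs0.ne', hB]; ring)
  refine hmain.trans ((sum_inv B hB1 _ (by positivity)).trans (le_of_eq ?_))
  rw [hB, Real.mul_rpow (by positivity) hT0.le]
  have : T ^ (13/4:ℝ) = T ^ (3:ℝ) * T ^ (1/4:ℝ) := by rw [← Real.rpow_add hT0]; norm_num
  rw [this]; ring

/-- the reducible forms are negligible -/
lemma red_count (C κ M ε : ℝ) (hC : 0 < C) (hκ : 0 < κ) (hM : 1 ≤ M) (hε : 0 < ε) : ∀ᶠ n : ℕ in atTop,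
    (Set.ncard {f : BQF | f.a ≠ 0 ∧ ¬ f.Irred ∧ κ * n ≤ |(f.a:ℝ)| ∧ |(f.a:ℝ)| ≤ M * n ∧ |(f.b:ℝ)| ≤ M * n ∧
      |(f.c:ℝ)| ≤ M * n ∧ |(f.d:ℝ)| ≤ M * n ∧ |(f.e:ℝ)| ≤ M * n ∧ |(f.J:ℝ)| < C * (n:ℝ) ^ 2} : ℝ) ≤ ε * (n:ℝ) ^ 4 := by
  classical
  obtain ⟨K1, hK1, h1⟩ := lin_count C κ M hC hκ hM
  obtain ⟨K2, hK2, h2⟩ := quad_count κ M hκ hM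
  have l1 : Tendsto (fun n : ℕ => (K1 + K2) * (n:ℝ) ^ (-(1/4):ℝ)) atTop (nhds 0) := by
    have := ((tendsto_rpow_neg_atTop (by norm_num : (0:ℝ) < 1/4)).comp tendsto_natCast_atTop_atTop).const_mul
      (K1 + K2)
    simpa using this
  filter_upwards [l1.eventually (gt_mem_nhds hε), eventually_ge_atTop 1] with n e1 e2
  have hT : (1:ℝ) ≤ n := by exact_mod_cast e2
  generalize (n:ℝ) = T at *
  have hT0 : 0 < T := by linarith
  set W := {f : BQF | f.a ≠ 0 ∧ ¬ f.Irred ∧ κ * T ≤ |(f.a:ℝ)| ∧ |(f.a:ℝ)| ≤ M * T ∧ |(f.b:ℝ)| ≤ M * T ∧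
      |(f.c:ℝ)| ≤ M * T ∧ |(f.d:ℝ)| ≤ M * T ∧ |(f.e:ℝ)| ≤ M * T ∧ |(f.J:ℝ)| < C * T ^ 2} with hW
  have hfin : W.Finite := finite_of_bdd W (M * T) (fun f hf => ⟨hf.2.2.2.1, hf.2.2.2.2.1, hf.2.2.2.2.2.1,
    hf.2.2.2.2.2.2.1, hf.2.2.2.2.2.2.2.1⟩)
  rw [Set.ncard_eq_toFinset_card _ hfin]
  set S := hfin.toFinset with hS
  have hmem : ∀ f ∈ S, f ∈ W := by
    intro f hf; rw [hS, Set.Finite.mem_toFinset] at hf; exact hf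
  let S1 := S.filter (fun f => ∃ v : Fin 6 → ℤ, 1 ≤ v 0 ∧ f.a = v 0 * v 2 ∧ f.b = v 0 * v 3 - v 1 * v 2 ∧
    f.c = v 0 * v 4 - v 1 * v 3 ∧ f.d = v 0 * v 5 - v 1 * v 4 ∧ f.e = - v 1 * v 5)
  let S2 := S.filter (fun f => ∃ v : Fin 6 → ℤ, 1 ≤ v 0 ∧ f.a = v 0 * v 3 ∧ f.b = v 0 * v 4 + v 1 * v 3 ∧
      f.c = v 0 * v 5 + v 1 * v 4 + v 2 * v 3 ∧ f.d = v 1 * v 5 + v 2 * v 4 ∧ f.e = v 2 * v 5)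
  have hsub : S ⊆ S1 ∪ S2 := by
    intro f hf
    have hfW := hmem f hf
    rcases red_cases f hfW.1 hfW.2.1 with h | h
    · exact Finset.mem_union_left _ (Finset.mem_filter.mpr ⟨hf, h⟩)
    · exact Finset.mem_union_right _ (Finset.mem_filter.mpr ⟨hf, h⟩)
  have hc1 : S.card ≤ S1.card + S2.card := (Finset.card_le_card hsub).trans (Finset.card_union_le _ _)
  have hc2 : (S.card:ℝ) ≤ S1.card + S2.card := by exact_mod_cast hc1
  have b1 := h1 S1 T hT (fun f hf => by
    obtain ⟨p1, p2, p3⟩ := hmem f (Finset.mem_filter.mp hf).1; exact ⟨p1, p3⟩) (fun f hf => (Finset.mem_filter.mp hf).2)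
  have b2 := h2 S2 T hT (fun f hf => by
    obtain ⟨p1, p2, p3, p4, p5, p6, p7, p8, p9⟩ := hmem f (Finset.mem_filter.mp hf).1
    exact ⟨p1, p3, p4, p5, p6, p7, p8⟩) (fun f hf => (Finset.mem_filter.mp hf).2)
  have k1 : T ^ (13/4:ℝ) ≤ T ^ (15/4:ℝ) := Real.rpow_le_rpow_of_exponent_le hT (by norm_num)
  have k2 : T ^ (15/4:ℝ) = T ^ (-(1/4):ℝ) * T ^ 4 := by
    rw [← Real.rpow_natCast T, ← Real.rpow_add hT0]; norm_num
  have k3 : K2 * T ^ (13/4:ℝ) ≤ K2 * T ^ (15/4:ℝ) := by gcongr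
  have k4 : (K1 + K2) * T ^ (-(1/4):ℝ) * T ^ 4 ≤ ε * T ^ 4 := by gcongr
  rw [mul_assoc, ← k2] at k4
  linarith

end BQF



/-- parametrization -/
noncomputable def Phi (u : Fin 4 → ℝ) : Fin 4 → ℝ :=
  ![u 2, u 3 + 4 * u 2 * u 0, -6 * u 2 * u 1 + 3 * u 3 * u 0 + 6 * u 2 * u 0 ^ 2,
    -(u 3) * u 1 - 12 * u 2 * u 1 * u 0 + 3 * u 3 * u 0 ^ 2 + 4 * u 2 * u 0 ^ 3]

noncomputable def PhiM (u : Fin 4 → ℝ) : Matrix (Fin 4) (Fin 4) ℝ :=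
  !![0, 0, 1, 0;
    4 * u 2, 0, 4 * u 0, 1;
    3 * u 3 + 12 * u 2 * u 0, -6 * u 2, -6 * u 1 + 6 * u 0 ^ 2, 3 * u 0;
    -12 * u 2 * u 1 + 6 * u 3 * u 0 + 12 * u 2 * u 0 ^ 2, -(u 3) - 12 * u 2 * u 0,
      -12 * u 1 * u 0 + 4 * u 0 ^ 3, -(u 1) + 3 * u 0 ^ 2]

noncomputable def PhiD (u : Fin 4 → ℝ) : (Fin 4 → ℝ) →L[ℝ] (Fin 4 → ℝ) :=
  LinearMap.toContinuousLinearMap (Matrix.toLin' (PhiM u))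

lemma PhiD_det (u : Fin 4 → ℝ) : (PhiD u).det = -3 * (16 * u 2 ^ 2 * u 1 + u 3 ^ 2) := by
  have : (PhiD u).det = (PhiM u).det := by
    rw [PhiD, ContinuousLinearMap.det]
    simp
  rw [this, PhiM]
  simp [Matrix.det_succ_row_zero, Fin.sum_univ_succ, Fin.succAbove]
  ring

lemma Phi_deriv (u : Fin 4 → ℝ) : HasFDerivAt Phi (PhiD u) u := by
  have hi : ∀ i : Fin 4, HasFDerivAt (fun v : Fin 4 → ℝ => v i)
    (ContinuousLinearMap.proj i : (Fin 4 → ℝ) →L[ℝ] ℝ) u := fun i => hasFDerivAt_apply i u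
  rw [hasFDerivAt_pi']
  intro i
  fin_cases i
  · have := hi 2
    refine HasFDerivAt.congr_fderiv this ?_
    ext w
    simp [PhiD, PhiM, dotProduct, Fin.sum_univ_four]
  · have := (hi 3).add (((hi 2).const_mul 4).mul (hi 0))
    refine HasFDerivAt.congr_fderiv this ?_
    ext w
    simp [PhiD, PhiM, dotProduct, Fin.sum_univ_four]
    ring
  · have := ((((hi 2).const_mul (-6)).mul (hi 1)).add (((hi 3).const_mul 3).mul (hi 0))).add
      (((hi 2).const_mul 6).mul ((hi 0).pow 2))
    refine HasFDerivAt.congr_fderiv this ?_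
    ext w
    simp [PhiD, PhiM, dotProduct, Fin.sum_univ_four]
    ring
  · have := ((((hi 3).neg.mul (hi 1)).sub ((((hi 2).const_mul 12).mul (hi 1)).mul (hi 0))).add
      (((hi 3).const_mul 3).mul ((hi 0).pow 2))).add (((hi 2).const_mul 4).mul ((hi 0).pow 3))
    refine HasFDerivAt.congr_fderiv this ?_
    ext w
    simp [PhiD, PhiM, dotProduct, Fin.sum_univ_four]
    ring

noncomputable def x0f (v : Fin 4 → ℝ) : ℝ := (54 * v 0 * v 3 - 9 * v 1 * v 2) / Hf (v 0) (v 1) (v 2)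
noncomputable def s0f (v : Fin 4 → ℝ) : ℝ := -(v 2 - 3 * v 1 * x0f v + 6 * v 0 * x0f v ^ 2) / (6 * v 0)

def Reg (x1 x2 r m : ℝ) : Set (Fin 4 → ℝ) :=
  {v | v 0 ≠ 0 ∧ Hf (v 0) (v 1) (v 2) < 0 ∧ x1 < x0f v ∧ x0f v < x2 ∧ 0 < s0f v ∧ r < x0f v ^ 2 + s0f v ∧
    -Hf (v 0) (v 1) (v 2) * s0f v / 9 < m}

def Ureg (x1 x2 r m : ℝ) : Set (Fin 4 → ℝ) :=
  {u | u 2 ≠ 0 ∧ x1 < u 0 ∧ u 0 < x2 ∧ 0 < u 1 ∧ r < u 0 ^ 2 + u 1 ∧ 3 * u 1 * (16 * u 2 ^ 2 * u 1 + u 3 ^ 2) < m}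

lemma Hf_Phi (u : Fin 4 → ℝ) : Hf (Phi u 0) (Phi u 1) (Phi u 2) = -27 * (16 * u 2 ^ 2 * u 1 + u 3 ^ 2) := by
  simp [Phi, Hf]; ring

lemma x0_Phi (u : Fin 4 → ℝ) (h2 : u 2 ≠ 0) (h1 : 0 < u 1) : x0f (Phi u) = u 0 := by
  have hD : 0 < 16 * u 2 ^ 2 * u 1 + u 3 ^ 2 := by positivity
  rw [x0f, Hf_Phi, div_eq_iff (by linarith)]
  simp [Phi]; ring

lemma s0_Phi (u : Fin 4 → ℝ) (h2 : u 2 ≠ 0) (h1 : 0 < u 1) : s0f (Phi u) = u 1 := by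
  have h : 6 * Phi u 0 ≠ 0 := by simpa [Phi] using h2
  rw [s0f, x0_Phi u h2 h1, div_eq_iff h]
  simp [Phi]; ring

lemma Phi_inj (x1 x2 r m : ℝ) : Set.InjOn Phi (Ureg x1 x2 r m) := by
  intro u hu v hv h
  have e0 : u 0 = v 0 := by rw [← x0_Phi u hu.1 hu.2.2.2.1, ← x0_Phi v hv.1 hv.2.2.2.1, h]
  have e1 : u 1 = v 1 := by rw [← s0_Phi u hu.1 hu.2.2.2.1, ← s0_Phi v hv.1 hv.2.2.2.1, h]
  have e2 : u 2 = v 2 := by simpa [Phi] using congrFun h 0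
  have e3 : u 3 = v 3 := by
    have := congrFun h 1
    simp [Phi] at this
    rw [e0, e2] at this; linarith
  ext i; fin_cases i <;> assumption

lemma Phi_image (x1 x2 r m : ℝ) : Phi '' (Ureg x1 x2 r m) = Reg x1 x2 r m := by
  ext v
  constructor
  · rintro ⟨u, hu, rfl⟩
    obtain ⟨h2, hx1, hx2, h1, hr, hm⟩ := hu
    have hD : 0 < 16 * u 2 ^ 2 * u 1 + u 3 ^ 2 := by positivity
    refine ⟨by simpa [Phi] using h2, ?_⟩
    rw [Hf_Phi, x0_Phi u h2 h1, s0_Phi u h2 h1]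
    refine ⟨by linarith, hx1, hx2, h1, hr, ?_⟩
    linarith
  · rintro ⟨h0, hH, hx1, hx2, hs, hr, hm⟩
    set x := x0f v with hx
    set s := s0f v with hs'
    have ex : x * Hf (v 0) (v 1) (v 2) = 54 * v 0 * v 3 - 9 * v 1 * v 2 := by
      rw [hx, x0f, div_mul_cancel₀ _ hH.ne]
    have es : s * (6 * v 0) = -(v 2 - 3 * v 1 * x + 6 * v 0 * x ^ 2) := by
      rw [hs', s0f, div_mul_cancel₀ _ (by simpa using h0)]
    have ec : v 2 = 3 * v 1 * x - 6 * v 0 * x ^ 2 - 6 * v 0 * s := by linarith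
    have key : Phi ![x, s, v 0, v 1 - 4 * v 0 * x] = v := by
      ext i
      fin_cases i
      · simp [Phi]
      · simp [Phi]
      · simp [Phi]; rw [ec]; ring
      · simp [Phi]
        apply mul_left_cancel₀ (mul_ne_zero (by norm_num : (54:ℝ) ≠ 0) h0)
        have : 54 * v 0 * v 3 = x * Hf (v 0) (v 1) (v 2) + 9 * v 1 * v 2 := by linarith
        rw [this, Hf, ec]; ring
    refine ⟨![x, s, v 0, v 1 - 4 * v 0 * x], ?_, key⟩
    refine ⟨h0, hx1, hx2, hs, hr, ?_⟩
    have := Hf_Phi ![x, s, v 0, v 1 - 4 * v 0 * x]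
    rw [key] at this
    rw [this] at hm
    simp at hm ⊢
    linarith

lemma Ureg_meas (x1 x2 r m : ℝ) : MeasurableSet (Ureg x1 x2 r m) := by
  have h0 : Measurable (fun u : Fin 4 → ℝ => u 0) := measurable_pi_apply 0
  have h1 : Measurable (fun u : Fin 4 → ℝ => u 1) := measurable_pi_apply 1
  have h2 : Measurable (fun u : Fin 4 → ℝ => u 2) := measurable_pi_apply 2
  have h3 : Measurable (fun u : Fin 4 → ℝ => u 3) := measurable_pi_apply 3
  refine MeasurableSet.inter (h2 (measurableSet_singleton 0).compl) ?_
  refine (measurableSet_lt measurable_const h0).inter ?_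
  refine (measurableSet_lt h0 measurable_const).inter ?_
  refine (measurableSet_lt measurable_const h1).inter ?_
  refine (measurableSet_lt measurable_const ((h0.pow_const 2).add h1)).inter ?_
  exact measurableSet_lt ((measurable_const.mul h1).mul
    (((measurable_const.mul (h2.pow_const 2)).mul h1).add (h3.pow_const 2))) measurable_const

open MeasureTheory in
lemma lint_reg (C : ℝ) (hC : 0 < C) (x1 x2 r m : ℝ) :
    ∫⁻ v in Reg x1 x2 r m, ENNReal.ofReal (2 * C / |Hf (v 0) (v 1) (v 2)|) =
      ENNReal.ofReal (2 * C / 9) * volume (Ureg x1 x2 r m) := by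
  rw [← Phi_image, lintegral_image_eq_lintegral_abs_det_fderiv_mul volume (Ureg_meas x1 x2 r m)
    (fun u _ => (Phi_deriv u).hasFDerivWithinAt) (Phi_inj x1 x2 r m)]
  rw [← setLIntegral_const]
  refine setLIntegral_congr_fun (Ureg_meas x1 x2 r m) (fun u hu => ?_)
  obtain ⟨h2, -, -, h1, -⟩ := hu
  have hD : 0 < 16 * u 2 ^ 2 * u 1 + u 3 ^ 2 := by positivity
  rw [Hf_Phi, PhiD_det, ← ENNReal.ofReal_mul (abs_nonneg _), abs_mul, abs_mul, abs_of_pos hD]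
  congr 1
  norm_num
  field_simp
  norm_num



open MeasureTheory in
lemma vol_cons {n : ℕ} (S : Set (Fin (n+1) → ℝ)) (hS : MeasurableSet S) :
    volume S = ∫⁻ x : ℝ, volume {w : Fin n → ℝ | (Fin.cons x w : Fin (n+1) → ℝ) ∈ S} := by
  have h := (volume_preserving_piFinSuccAbove (fun _ : Fin (n+1) => ℝ) 0).symm
  rw [← h.measure_preimage hS.nullMeasurableSet]
  erw [Measure.prod_apply ((MeasurableEquiv.measurable _) hS)]
  congr 1
  funext x
  congr 1
  ext w
  simp [MeasurableEquiv.piFinSuccAbove, Fin.insertNth_zero]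
  rfl

open MeasureTheory in
lemma vol_disk : volume {w : Fin 2 → ℝ | w 0 ^ 2 + w 1 ^ 2 < 1} = ENNReal.ofReal Real.pi := by
  have h := Complex.volume_preserving_equiv_pi
  have hm : MeasurableSet {w : Fin 2 → ℝ | w 0 ^ 2 + w 1 ^ 2 < 1} := by
    apply IsOpen.measurableSet
    exact isOpen_lt (by fun_prop) (by fun_prop)
  rw [← h.measure_preimage hm.nullMeasurableSet]
  have : Complex.measurableEquivPi ⁻¹' {w : Fin 2 → ℝ | w 0 ^ 2 + w 1 ^ 2 < 1} = Metric.ball (0:ℂ) 1 := by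
    ext z
    simp [Complex.measurableEquivPi_apply]
    rw [← sq_lt_one_iff₀ (norm_nonneg z), ← Complex.normSq_eq_norm_sq, Complex.normSq_apply]
    simp [sq]
  rw [this, Complex.volume_ball]
  simp only [ENNReal.ofReal, one_pow, one_mul, ENNReal.ofReal_one, NNReal.pi, Real.toNNReal_one, ENNReal.coe_one]
  congr 1
  exact (Real.toNNReal_of_nonneg Real.pi_nonneg).symm

open MeasureTheory in
lemma vol_ell (p q : ℝ) (hp : 0 < p) (hq : 0 < q) :
    volume {w : Fin 2 → ℝ | w 0 ≠ 0 ∧ (w 0 / p) ^ 2 + (w 1 / q) ^ 2 < 1} = ENNReal.ofReal (Real.pi * p * q) := by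
  have h1 : volume {w : Fin 2 → ℝ | w 0 ≠ 0 ∧ (w 0 / p) ^ 2 + (w 1 / q) ^ 2 < 1} =
      volume {w : Fin 2 → ℝ | (w 0 / p) ^ 2 + (w 1 / q) ^ 2 < 1} := by
    apply measure_congr
    have : ∀ᵐ w : Fin 2 → ℝ, w 0 ≠ 0 := by
      have := Measure.pi_hyperplane (fun _ : Fin 2 => (volume : Measure ℝ)) 0 0
      exact measure_eq_zero_iff_ae_notMem.mp this
    filter_upwards [this] with w hw
    apply propext
    exact ⟨fun h => h.2, fun h => ⟨hw, h⟩⟩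
  rw [h1]
  have h2 := Real.smul_map_diagonal_volume_pi (D := ![p⁻¹, q⁻¹]) (by simp [Matrix.det_diagonal, hp.ne', hq.ne'])
  have hm : MeasurableSet {w : Fin 2 → ℝ | w 0 ^ 2 + w 1 ^ 2 < 1} := by
    apply IsOpen.measurableSet
    exact isOpen_lt (by fun_prop) (by fun_prop)
  have h3 := vol_disk
  rw [← h2, Measure.smul_apply, Measure.map_apply (by exact (LinearMap.continuous_of_finiteDimensional _).measurable) hm] at h3
  have h4 : (Matrix.toLin' (Matrix.diagonal ![p⁻¹, q⁻¹])) ⁻¹' {w : Fin 2 → ℝ | w 0 ^ 2 + w 1 ^ 2 < 1} =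
      {w : Fin 2 → ℝ | (w 0 / p) ^ 2 + (w 1 / q) ^ 2 < 1} := by
    ext w
    simp [Matrix.mulVec_diagonal, div_eq_inv_mul]
  rw [h4] at h3
  have h5 : |(Matrix.diagonal ![p⁻¹, q⁻¹]).det| = (p * q)⁻¹ := by
    rw [Matrix.det_diagonal, Fin.prod_univ_two]
    simp
    rw [abs_of_pos hp, abs_of_pos hq, mul_comm]
  rw [h5, smul_eq_mul] at h3
  have h6 : ENNReal.ofReal (p * q) * (ENNReal.ofReal (p * q)⁻¹) = 1 := by
    rw [← ENNReal.ofReal_mul (by positivity), mul_inv_cancel₀ (by positivity), ENNReal.ofReal_one]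
  calc _ = (ENNReal.ofReal (p * q) * (ENNReal.ofReal (p * q)⁻¹)) * volume {w : Fin 2 → ℝ | (w 0 / p) ^ 2 + (w 1 / q) ^ 2 < 1} := by
        rw [h6, one_mul]
    _ = ENNReal.ofReal (p * q) * ENNReal.ofReal Real.pi := by rw [mul_assoc, h3]
    _ = _ := by rw [← ENNReal.ofReal_mul (by positivity)]; congr 1; ring

open MeasureTheory in
lemma lint_s (k c : ℝ) (hk : 0 < k) (hc : 0 < c) :
    ∫⁻ s in Set.Ioi c, ENNReal.ofReal (k * s ^ (-(3/2):ℝ)) = ENNReal.ofReal (2 * k / √c) := by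
  have hi := integrableOn_Ioi_rpow_of_lt (a := (-(3/2):ℝ)) (by norm_num) hc
  rw [← ofReal_integral_eq_lintegral_ofReal (hi.const_mul k)]
  · rw [integral_const_mul, integral_Ioi_rpow_of_lt (by norm_num) hc, Real.sqrt_eq_rpow]
    congr 1
    rw [show (-(3/2) + 1 : ℝ) = -(1/2) by norm_num, Real.rpow_neg hc.le]
    field_simp
  · refine (ae_restrict_iff' measurableSet_Ioi).mpr (Eventually.of_forall fun s hs => ?_)
    have : 0 < s := hc.trans hs
    positivity

open MeasureTheory in
lemma lint_x (k r x1 x2 : ℝ) (hk : 0 < k) (hr : 0 < r) (h12 : x1 ≤ x2) (h1 : -√r < x1) (h2 : x2 < √r) :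
    ∫⁻ x in Set.Ioo x1 x2, ENNReal.ofReal (k / √(r - x ^ 2)) =
      ENNReal.ofReal (k * (Real.arcsin (x2 / √r) - Real.arcsin (x1 / √r))) := by
  have hsr : 0 < √r := Real.sqrt_pos.mpr hr
  have hpos : ∀ x ∈ Set.Icc x1 x2, 0 < r - x ^ 2 := by
    intro x hx
    have a1 : -√r < x := by linarith [hx.1]
    have a2 : x < √r := by linarith [hx.2]
    have := Real.sq_sqrt hr.le
    nlinarith
  have hd : ∀ x ∈ Set.Icc x1 x2, HasDerivAt (fun x => k * Real.arcsin (x / √r)) (k / √(r - x ^ 2)) x := by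
    intro x hx
    have a1 : -√r < x := by linarith [hx.1]
    have a2 : x < √r := by linarith [hx.2]
    have b1 : x / √r ≠ -1 := by
      intro h; rw [div_eq_iff hsr.ne'] at h; linarith
    have b2 : x / √r ≠ 1 := by
      intro h; rw [div_eq_iff hsr.ne'] at h; linarith
    have := ((Real.hasDerivAt_arcsin b1 b2).comp x ((hasDerivAt_id x).div_const (√r))).const_mul k
    refine this.congr_deriv ?_
    have e : 1 - (x / √r) ^ 2 = (r - x ^ 2) / r := by
      rw [div_pow, Real.sq_sqrt hr.le]; field_simp
    rw [e, Real.sqrt_div' _ hr.le]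
    field_simp
  have hcont : ContinuousOn (fun x => k / √(r - x ^ 2)) (Set.Icc x1 x2) := by
    apply ContinuousOn.div continuousOn_const
    · exact (Continuous.continuousOn (by fun_prop))
    · intro x hx; exact (Real.sqrt_pos.mpr (hpos x hx)).ne'
  have hint : IntegrableOn (fun x => k / √(r - x ^ 2)) (Set.Ioo x1 x2) :=
    (hcont.integrableOn_Icc).mono_set Set.Ioo_subset_Icc_self
  rw [← ofReal_integral_eq_lintegral_ofReal hint]
  · rw [← integral_Ioc_eq_integral_Ioo, ← intervalIntegral.integral_of_le h12,
      intervalIntegral.integral_eq_sub_of_hasDerivAt (f := fun x => k * Real.arcsin (x / √r))]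
    · congr 1; ring
    · intro x hx; rw [Set.uIcc_of_le h12] at hx; exact hd x hx
    · apply ContinuousOn.intervalIntegrable; rwa [Set.uIcc_of_le h12]
  · refine Eventually.of_forall fun s => ?_
    exact div_nonneg hk.le (Real.sqrt_nonneg _)

open MeasureTheory in
lemma vol_U (r m x1 x2 : ℝ) (hm : 0 < m) (hr : 0 < r) (h12 : x1 ≤ x2) (h1 : -√r < x1) (h2 : x2 < √r) :
    volume (Ureg x1 x2 r m) =
      ENNReal.ofReal (Real.pi * m / 6 * (Real.arcsin (x2 / √r) - Real.arcsin (x1 / √r))) := by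
  rw [vol_cons _ (Ureg_meas x1 x2 r m), ← lint_x _ r x1 x2 (by positivity) hr h12 h1 h2,
    ← lintegral_indicator measurableSet_Ioo]
  congr 1
  ext x
  by_cases hx : x ∈ Set.Ioo x1 x2
  · rw [Set.indicator_of_mem hx]
    have hc : 0 < r - x ^ 2 := by
      have a1 : -√r < x := by linarith [hx.1]
      have a2 : x < √r := by linarith [hx.2]
      have := Real.sq_sqrt hr.le
      nlinarith
    rw [show Real.pi * m / 6 / √(r - x ^ 2) = 2 * (Real.pi * m / 12) / √(r - x ^ 2) by ring,
      ← lint_s _ _ (by positivity) hc, ← lintegral_indicator measurableSet_Ioi]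
    rw [vol_cons]
    · congr 1
      ext s
      by_cases hs : s ∈ Set.Ioi (r - x ^ 2)
      · rw [Set.indicator_of_mem hs]
        have hs' : r - x ^ 2 < s := hs
        have hs0 : 0 < s := hc.trans hs'
        set p := √m / (√48 * s) with hp
        set q := √m / (√3 * √s) with hq
        have hsm : 0 < √m := Real.sqrt_pos.mpr hm
        have hss : 0 < √s := Real.sqrt_pos.mpr hs0
        have m2 := Real.sq_sqrt hm.le
        have s2 := Real.sq_sqrt hs0.le
        have t2 : √(48:ℝ) ^ 2 = 48 := Real.sq_sqrt (by norm_num)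
        have u2 : √(3:ℝ) ^ 2 = 3 := Real.sq_sqrt (by norm_num)
        have := vol_ell p q (by positivity) (by positivity)
        have e1 : Real.pi * p * q = Real.pi * m / 12 * s ^ (-(3/2):ℝ) := by
          have : s ^ (-(3/2):ℝ) = (s * √s)⁻¹ := by
            rw [Real.sqrt_eq_rpow, Real.rpow_neg hs0.le, ← Real.rpow_one_add' hs0.le (by norm_num)]; norm_num
          have t3 : √(48:ℝ) * √3 = 12 := by
            rw [← Real.sqrt_mul (by norm_num), show (48 * 3 : ℝ) = 12 ^ 2 by norm_num, Real.sqrt_sq (by norm_num)]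
          rw [this, hp, hq, show Real.pi * (√m / (√48 * s)) * (√m / (√3 * √s)) =
            Real.pi * √m ^ 2 / ((√48 * √3) * (s * √s)) by field_simp, m2, t3]
          field_simp
        rw [← e1, ← this]
        congr 1
        ext w
        have e2 : (w 0 / p) ^ 2 + (w 1 / q) ^ 2 = 3 * s * (16 * w 0 ^ 2 * s + w 1 ^ 2) / m := by
          rw [hp, hq, div_div_eq_mul_div, div_div_eq_mul_div, div_pow, div_pow, mul_pow, mul_pow, mul_pow, mul_pow,
            m2, s2, t2, u2]
          field_simp; ring
        simp only [Set.mem_ofPred_eq]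
        rw [e2, div_lt_one hm]
        constructor
        · intro h; exact ⟨h.1, h.2.2.2.2.2⟩
        · intro h; exact ⟨h.1, hx.1, hx.2, hs0, by show r < x ^ 2 + s; linarith, h.2⟩
      · rw [Set.indicator_of_notMem hs]
        have : {w : Fin 2 → ℝ | (Fin.cons s w : Fin 3 → ℝ) ∈ {w : Fin 3 → ℝ | (Fin.cons x w : Fin 4 → ℝ) ∈ Ureg x1 x2 r m}} = ∅ := by
          ext w
          simp only [Set.mem_ofPred_eq, Set.mem_empty_iff_false, iff_false]
          intro h
          have h5 : r < x ^ 2 + s := h.2.2.2.2.1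
          exact hs (by show r - x ^ 2 < s; linarith)
        rw [this, measure_empty]
    · have : Measurable (fun w : Fin 3 → ℝ => (Fin.cons x w : Fin 4 → ℝ)) := by
        apply measurable_pi_lambda
        intro i
        refine Fin.cases ?_ (fun j => ?_) i
        · simp
        · simpa using measurable_pi_apply j
      exact this (Ureg_meas x1 x2 r m)
  · rw [Set.indicator_of_notMem hx]
    have : {w : Fin 3 → ℝ | (Fin.cons x w : Fin 4 → ℝ) ∈ Ureg x1 x2 r m} = ∅ := by
      ext w
      simp only [Set.mem_ofPred_eq, Set.mem_empty_iff_false, iff_false]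
      intro h
      exact hx ⟨h.2.1, h.2.2.1⟩
    rw [this, measure_empty]

open MeasureTheory in
lemma lint_reg' (C : ℝ) (hC : 0 < C) (x1 x2 r m : ℝ) (hm : 0 < m) (hr : 0 < r) (h12 : x1 ≤ x2) (h1 : -√r < x1)
    (h2 : x2 < √r) :
    ∫⁻ v in Reg x1 x2 r m, ENNReal.ofReal (2 * C / |Hf (v 0) (v 1) (v 2)|) =
      ENNReal.ofReal (C * Real.pi * m / 27 * (Real.arcsin (x2 / √r) - Real.arcsin (x1 / √r))) := by
  rw [lint_reg C hC, vol_U r m x1 x2 hm hr h12 h1 h2, ← ENNReal.ofReal_mul (by positivity)]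
  congr 1; ring



noncomputable def Hb (q : (Fin 4 → ℝ) × ℝ) : ℝ := Hf (q.1 0) (q.1 1) (q.1 2) + 288 * q.1 0 * q.2
noncomputable def xb (q : (Fin 4 → ℝ) × ℝ) : ℝ :=
  (54 * q.1 0 * q.1 3 - 9 * q.1 1 * q.1 2 + 72 * q.2 * q.1 1) / Hb q
noncomputable def sb (q : (Fin 4 → ℝ) × ℝ) : ℝ :=
  (8 * q.2 - (q.1 2 - 3 * q.1 1 * xb q + 6 * q.1 0 * xb q ^ 2)) / (6 * q.1 0)

def Ob (x1 x2 r m : ℝ) : Set ((Fin 4 → ℝ) × ℝ) :=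
  {q | (q.1 0 ≠ 0 ∧ Hb q < 0) ∧ (x1 < xb q ∧ xb q < x2 ∧ 0 < sb q ∧ r < xb q ^ 2 + sb q ∧
    - Hb q * sb q / 9 + 64 * q.2 ^ 2 < m)}

lemma Ob_open (x1 x2 r m : ℝ) : IsOpen (Ob x1 x2 r m) := by
  have hHc : Continuous Hb := by unfold Hb Hf; fun_prop
  have hD : IsOpen {q : (Fin 4 → ℝ) × ℝ | q.1 0 ≠ 0 ∧ Hb q < 0} := by
    apply IsOpen.inter
    · exact isOpen_ne_fun (by fun_prop) (by fun_prop)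
    · exact isOpen_lt hHc (by fun_prop)
  have hx : ContinuousOn xb {q : (Fin 4 → ℝ) × ℝ | q.1 0 ≠ 0 ∧ Hb q < 0} := by
    unfold xb
    exact ContinuousOn.div (by fun_prop) hHc.continuousOn (fun q hq => hq.2.ne)
  have hs : ContinuousOn sb {q : (Fin 4 → ℝ) × ℝ | q.1 0 ≠ 0 ∧ Hb q < 0} := by
    unfold sb
    exact ContinuousOn.div (by fun_prop) (by fun_prop) (fun q hq => mul_ne_zero (by norm_num) hq.1)
  have hF : ContinuousOn (fun q => (xb q, sb q, Hb q, q.2)) {q : (Fin 4 → ℝ) × ℝ | q.1 0 ≠ 0 ∧ Hb q < 0} := by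
    exact hx.prodMk (hs.prodMk (hHc.continuousOn.prodMk (by fun_prop)))
  have hW : IsOpen {t : ℝ × ℝ × ℝ × ℝ | x1 < t.1 ∧ t.1 < x2 ∧ 0 < t.2.1 ∧ r < t.1 ^ 2 + t.2.1 ∧
      - t.2.2.1 * t.2.1 / 9 + 64 * t.2.2.2 ^ 2 < m} := by
    repeat' apply IsOpen.and
    all_goals exact isOpen_lt (by fun_prop) (by fun_prop)
  exact hF.isOpen_inter_preimage hD hW

lemma Reg_eq (x1 x2 r m : ℝ) : Reg x1 x2 r m = (fun v => (v, (0:ℝ))) ⁻¹' Ob x1 x2 r m := by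
  ext v
  simp only [Reg, Ob, Hb, xb, sb, x0f, s0f, Set.mem_ofPred_eq, Set.mem_preimage, mul_zero, zero_mul, add_zero, zero_sub,
    ne_eq, OfNat.ofNat_ne_zero, not_false_eq_true, zero_pow, and_assoc]

lemma Reg_open (x1 x2 r m : ℝ) : IsOpen (Reg x1 x2 r m) := by
  rw [Reg_eq]
  exact (Ob_open _ _ _ _).preimage (by fun_prop)

lemma Hf_cont : Continuous (fun v : Fin 4 → ℝ => Hf (v 0) (v 1) (v 2)) := by unfold Hf; fun_prop

lemma cpt_lower {K : Set (Fin 4 → ℝ)} (hK : IsCompact K) (g : (Fin 4 → ℝ) → ℝ) (hg : ContinuousOn g K)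
    (hp : ∀ v ∈ K, 0 < g v) : ∃ k > 0, ∀ v ∈ K, k ≤ g v := by
  rcases K.eq_empty_or_nonempty with rfl | hne
  · exact ⟨1, one_pos, by simp⟩
  · obtain ⟨v, hv, hmin⟩ := hK.exists_isMinOn hne hg
    exact ⟨g v, hp v hv, fun u hu => hmin hu⟩

lemma bump {K G : Set (Fin 4 → ℝ)} (hK : IsCompact K) (hG : IsOpen G) (hKG : K ⊆ G)
    (hGH : ∀ v ∈ G, v 0 ≠ 0 ∧ Hf (v 0) (v 1) (v 2) < 0) :
    ∃ (w : (Fin 4 → ℝ) → ℝ) (Kw : NNReal) (ρ : ℝ) (K' : Set (Fin 4 → ℝ)) (M : ℕ) (κ h : ℝ),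
      LipschitzWith Kw w ∧ (∀ v, 0 ≤ w v) ∧ (∀ v, w v ≤ 1) ∧ 0 < ρ ∧ IsCompact K' ∧ K' ⊆ G ∧
      (∀ v, w v ≠ 0 → v ∈ K') ∧ (∀ v, ∀ u ∈ K, dist v u ≤ ρ → w v = 1) ∧ 0 < M ∧ 0 < κ ∧ 0 < h ∧
      (∀ v ∈ K', ∀ i, |v i| ≤ M) ∧ (∀ v ∈ K', κ ≤ |v 0| ∧ h ≤ |Hf (v 0) (v 1) (v 2)|) := by
  obtain ⟨δ, hδ, hsub⟩ := hK.exists_cthickening_subset_open hG hKG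
  have hρ : 0 < δ / 2 := by positivity
  have hK' : IsCompact (Metric.cthickening δ K) := hK.cthickening
  obtain ⟨κ, hκ, hκ'⟩ := cpt_lower hK' (fun v => |v 0|) (by fun_prop) (fun v hv => abs_pos.mpr (hGH v (hsub hv)).1)
  obtain ⟨h, hh, hh'⟩ := cpt_lower hK' (fun v => |Hf (v 0) (v 1) (v 2)|) (Hf_cont.abs.continuousOn)
    (fun v hv => abs_pos.mpr (hGH v (hsub hv)).2.ne)
  obtain ⟨R, hR⟩ := hK'.isBounded.exists_norm_le
  refine ⟨fun v => (thickenedIndicator hρ (Metric.cthickening (δ/2) K) v : ℝ), (δ/2).toNNReal⁻¹, δ/2,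
    Metric.cthickening δ K, ⌈|R|⌉₊ + 1, κ, h, ?_, fun v => NNReal.coe_nonneg _, ?_, hρ, hK', hsub, ?_, ?_, by omega, hκ, hh,
    ?_, fun v hv => ⟨hκ' v hv, hh' v hv⟩⟩
  · have := lipschitzWith_thickenedIndicator hρ (Metric.cthickening (δ/2) K)
    exact this
  · intro v
    have := thickenedIndicator_le_one hρ (Metric.cthickening (δ/2) K) v
    exact_mod_cast this
  · intro v hv
    have h1 : v ∈ Metric.thickening (δ/2) (Metric.cthickening (δ/2) K) := by
      by_contra hn
      exact hv (by simp [thickenedIndicator_zero hρ _ hn])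
    have h2 := Metric.thickening_cthickening_subset (δ/2) hρ.le K h1
    have h3 := Metric.thickening_subset_cthickening _ _ h2
    rwa [add_halves] at h3
  · intro v u hu hd
    have : v ∈ Metric.cthickening (δ/2) K := Metric.mem_cthickening_of_dist_le v u _ K hu hd
    simp [thickenedIndicator_one hρ _ this]
  · intro v hv i
    have h1 := (norm_le_pi_norm v i).trans (hR v hv)
    rw [Real.norm_eq_abs] at h1
    have h2 := Nat.le_ceil |R|
    push_cast
    linarith [le_abs_self R]



noncomputable def wsum (C : ℝ) (w : (Fin 4 → ℝ) → ℝ) (M n : ℕ) : ℝ :=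
  ∑ a ∈ Finset.Icc (-((M * n : ℕ):ℤ)) ((M * n : ℕ):ℤ),
      ∑ b ∈ Finset.Icc (-((M * n : ℕ):ℤ)) ((M * n : ℕ):ℤ),
      ∑ c ∈ Finset.Icc (-((M * n : ℕ):ℤ)) ((M * n : ℕ):ℤ),
      ∑ d ∈ Finset.Icc (-((M * n : ℕ):ℤ)) ((M * n : ℕ):ℤ),
        w ![(a:ℝ) / n, (b:ℝ) / n, (c:ℝ) / n, (d:ℝ) / n] * (ecount (C * (n:ℝ) ^ 2) a b c d : ℝ)

lemma Hf_scale (t a b c : ℝ) : Hf (a / t) (b / t) (c / t) = Hf a b c / t ^ 2 := by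
  unfold Hf; ring

namespace BQF

def quad (f : BQF) : ℤ × ℤ × ℤ × ℤ := (f.a, f.b, f.c, f.d)

noncomputable def pt (n : ℕ) (f : BQF) : Fin 4 → ℝ :=
  ![(f.a:ℝ) / n, (f.b:ℝ) / n, (f.c:ℝ) / n, (f.d:ℝ) / n]

noncomputable def box (N : ℕ) : Finset (ℤ × ℤ × ℤ × ℤ) :=
  Finset.Icc (-(N:ℤ)) N ×ˢ Finset.Icc (-(N:ℤ)) N ×ˢ Finset.Icc (-(N:ℤ)) N ×ˢ Finset.Icc (-(N:ℤ)) N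

lemma wsum_eq (C : ℝ) (w : (Fin 4 → ℝ) → ℝ) (M n : ℕ) : wsum C w M n = ∑ t ∈ box (M * n),
    w ![(t.1:ℝ) / n, (t.2.1:ℝ) / n, (t.2.2.1:ℝ) / n, (t.2.2.2:ℝ) / n] *
      (ecount (C * (n:ℝ) ^ 2) t.1 t.2.1 t.2.2.1 t.2.2.2 : ℝ) := by
  unfold wsum box
  rw [Finset.sum_product]
  simp_rw [Finset.sum_product]

lemma pt_box {M n : ℕ} (hn : 0 < n) {f : BQF} (h : ∀ i, |pt n f i| ≤ M) : quad f ∈ box (M * n) := by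
  have hn' : (0:ℝ) < n := by exact_mod_cast hn
  have key : ∀ z : ℤ, |(z:ℝ) / n| ≤ M → z ∈ Finset.Icc (-((M * n : ℕ):ℤ)) ((M * n : ℕ):ℤ) := by
    intro z hz
    rw [abs_div, abs_of_pos hn', div_le_iff₀ hn', abs_le] at hz
    rw [Finset.mem_Icc]
    constructor
    · have := hz.1; exact_mod_cast this
    · have := hz.2; exact_mod_cast this
  simp only [quad, box, Finset.mem_product]
  exact ⟨key _ (h 0), key _ (h 1), key _ (h 2), key _ (h 3)⟩

lemma count_up {C : ℝ} {w : (Fin 4 → ℝ) → ℝ} {M n : ℕ} (hn : 0 < n) {h : ℝ} (hh : 0 < h) (hw0 : ∀ v, 0 ≤ w v)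
    (hM : ∀ v, w v ≠ 0 → ∀ i, |v i| ≤ M) (hH : ∀ v, w v ≠ 0 → h ≤ |Hf (v 0) (v 1) (v 2)|)
    (S : Set BQF) (hS : S.Finite) (h1 : ∀ f ∈ S, w (pt n f) = 1 ∧ |(f.J:ℝ)| < C * (n:ℝ) ^ 2) :
    (S.ncard : ℝ) ≤ wsum C w M n := by
  classical
  rw [wsum_eq, Set.ncard_eq_toFinset_card S hS]
  have hmaps : ∀ f ∈ hS.toFinset, quad f ∈ box (M * n) := by
    intro f hf
    have := (h1 f (hS.mem_toFinset.mp hf)).1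
    exact pt_box hn (hM _ (by rw [this]; norm_num))
  rw [Finset.card_eq_sum_card_fiberwise hmaps]
  push_cast
  apply Finset.sum_le_sum
  intro t ht
  by_cases he : (hS.toFinset.filter (fun f => quad f = t)) = ∅
  · rw [he]; simp only [Finset.card_empty, Nat.cast_zero]
    exact mul_nonneg (hw0 _) (Nat.cast_nonneg _)
  · obtain ⟨g, hg⟩ := Finset.nonempty_iff_ne_empty.mpr he
    obtain ⟨hg1, hg2⟩ := Finset.mem_filter.mp hg
    have hw := (h1 g (hS.mem_toFinset.mp hg1)).1
    subst hg2
    have hw' : w ![((quad g).1:ℝ) / n, ((quad g).2.1:ℝ) / n, ((quad g).2.2.1:ℝ) / n, ((quad g).2.2.2:ℝ) / n] = 1 := hw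
    rw [hw', one_mul]
    have hHne : Hf (g.a:ℝ) g.b g.c ≠ 0 := by
      intro h0
      have h3 := hH (pt n g) (by rw [hw]; norm_num)
      have : Hf ((pt n g) 0) ((pt n g) 1) ((pt n g) 2) = Hf (g.a:ℝ) g.b g.c / (n:ℝ)^2 := Hf_scale _ _ _ _
      rw [this, h0] at h3
      simp at h3; linarith
    have hfin : {e : ℤ | |(e:ℝ) * Hf g.a g.b g.c - Gf g.a g.b g.c g.d| < C * (n:ℝ)^2}.Finite := by
      rw [eset_eq _ _ _ hHne]; exact Set.finite_Ioo _ _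
    have : (hS.toFinset.filter (fun f => quad f = quad g)).card ≤ ecount (C * (n:ℝ)^2) g.a g.b g.c g.d := by
      unfold ecount
      rw [Set.ncard_eq_toFinset_card _ hfin]
      apply Finset.card_le_card_of_injOn (fun f => f.e)
      · intro f hf
        obtain ⟨hf1, hf2⟩ := Finset.mem_filter.mp hf
        have hJ := (h1 f (hS.mem_toFinset.mp hf1)).2
        rw [J_cast] at hJ
        simp only [quad, Prod.mk.injEq] at hf2
        rw [hf2.1, hf2.2.1, hf2.2.2.1, hf2.2.2.2] at hJ
        simpa using hJ
      · intro f hf f' hf' hee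
        have hf2 := (Finset.mem_filter.mp hf).2
        have hf3 := (Finset.mem_filter.mp hf').2
        rw [← hf3] at hf2
        simp only [quad, Prod.mk.injEq] at hf2
        exact ext' hf2.1 hf2.2.1 hf2.2.2.1 hf2.2.2.2 hee
    exact_mod_cast this

lemma count_lo {C : ℝ} {w : (Fin 4 → ℝ) → ℝ} {M n : ℕ} (hw1 : ∀ v, w v ≤ 1)
    (S : Set BQF) (hS : S.Finite) (h1 : ∀ f : BQF, w (pt n f) ≠ 0 → |(f.J:ℝ)| < C * (n:ℝ) ^ 2 → f ∈ S) :
    wsum C w M n ≤ S.ncard := by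
  classical
  rw [wsum_eq, Set.ncard_eq_toFinset_card S hS]
  have h2 : ∑ t ∈ box (M * n), (hS.toFinset.filter (fun f => quad f = t)).card ≤ hS.toFinset.card := by
    rw [Finset.sum_card_fiberwise_eq_card_filter]
    exact Finset.card_filter_le _ _
  refine le_trans ?_ (Nat.cast_le.mpr h2)
  push_cast
  apply Finset.sum_le_sum
  intro t ht
  by_cases hw : w ![(t.1:ℝ) / n, (t.2.1:ℝ) / n, (t.2.2.1:ℝ) / n, (t.2.2.2:ℝ) / n] = 0
  · rw [hw, zero_mul]; positivity
  · refine le_trans (mul_le_of_le_one_left (Nat.cast_nonneg _) (hw1 _)) ?_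
    have : ecount (C * (n:ℝ)^2) t.1 t.2.1 t.2.2.1 t.2.2.2 ≤ (hS.toFinset.filter (fun f => quad f = t)).card := by
      unfold ecount
      rw [← Set.ncard_coe_finset]
      apply Set.ncard_le_ncard_of_injOn (fun e => (⟨t.1, t.2.1, t.2.2.1, t.2.2.2, e⟩ : BQF))
      · intro e he
        rw [Finset.mem_coe, Finset.mem_filter, hS.mem_toFinset]
        refine ⟨h1 _ hw ?_, rfl⟩
        rw [J_cast]; exact he
      · intro e he e' he' hee
        exact congrArg BQF.e hee
    exact_mod_cast this

end BQF



def Uc (κ δ : ℝ) : Set (Fin 4 → ℝ) :=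
  {u | 0 ≤ u 0 ∧ u 0 ≤ 1 / 2 ∧ 1 ≤ u 0 ^ 2 + u 1 ∧ u 1 ≤ 1 / κ ∧ κ ≤ |u 2| ∧ |u 2| ≤ 1 ∧ |u 3| ≤ 1 ∧
    3 * u 1 * (16 * u 2 ^ 2 * u 1 + u 3 ^ 2) ≤ 1 + δ}

lemma Uc_compact (κ δ : ℝ) (hκ : 0 < κ) : IsCompact (Uc κ δ) := by
  have hc : IsClosed (Uc κ δ) := by
    unfold Uc
    repeat' apply IsClosed.and
    all_goals exact isClosed_le (by fun_prop) (by fun_prop)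
  refine (isCompact_closedBall (0 : Fin 4 → ℝ) (1 + 1 / κ)).of_isClosed_subset hc ?_
  rintro u ⟨h1, h2, h3, h4, h5, h6, h7, h8⟩
  rw [mem_closedBall_zero_iff, pi_norm_le_iff_of_nonneg (by positivity)]
  have hk : 0 < 1 / κ := by positivity
  have hs : 3 / 4 ≤ u 1 := by nlinarith
  intro i
  rw [Real.norm_eq_abs]
  fin_cases i
  · show |u 0| ≤ _; rw [abs_of_nonneg h1]; linarith
  · show |u 1| ≤ _; rw [abs_of_nonneg (by linarith)]; linarith
  · show |u 2| ≤ _; linarith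
  · show |u 3| ≤ _; linarith

lemma Uc_sub (κ δ : ℝ) (hκ : 0 < κ) (hδ : 0 < δ) : Uc κ δ ⊆ Ureg (-δ) (1 / 2 + δ) (1 - δ) (1 + 2 * δ) := by
  rintro u ⟨h1, h2, h3, h4, h5, h6, h7, h8⟩
  refine ⟨?_, by linarith, by linarith, by nlinarith, by linarith, by linarith⟩
  rw [← abs_pos]; linarith

namespace BQF

lemma near_pt (C κ δ : ℝ) (hC : 0 < C) (hκ : 0 < κ) (hδ : 0 < δ) (hδ1 : δ ≤ 1 / 4) (n : ℕ) (hn : 0 < n)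
    (hnb : 32 * (C / (64 * κ ^ 2)) ≤ δ * n) (f : BQF) (hf : f ∈ Usc C ((n:ℝ) ^ 2)) (ha : κ * n ≤ |(f.a:ℝ)|) :
    ∃ u ∈ Uc κ δ, dist (pt n f) (Phi u) ≤ 8 * (C / (64 * κ ^ 2)) / n := by
  obtain ⟨ha0, hI, hJ, x, s, b0, β, hp, hx0, hx1, hs⟩ := hf
  obtain ⟨A, y, hA, hy, hys, hA2, hβ, eI, eJ, ba, bb, bc, bd, be⟩ := hp.bounds hx0 hx1 hs
  have hn' : (0:ℝ) < n := by exact_mod_cast hn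
  have hIe := hp.I_eq
  rw [I_cast] at hI
  rw [J_cast] at hJ
  set a := (f.a:ℝ) with hadef
  set B := C / (64 * κ ^ 2) with hB
  have hB0 : 0 < B := by positivity
  have hBe : B * (64 * κ ^ 2) = C := by rw [hB]; field_simp
  rw [hys] at ba
  have hs34 : 3 / 4 ≤ s := by nlinarith
  have hI' := (abs_lt.mp hI).2
  have hAn : A < n / 6 := by
    by_contra hcon
    push Not at hcon
    have h1 : (n / 6 : ℝ) ^ 2 ≤ A ^ 2 := by gcongr
    linarith [sq_nonneg β, sq_pos_of_pos hn']
  have hsa : |a| * (3/4) ≤ |a| * s := mul_le_mul_of_nonneg_left hs34 (abs_nonneg _)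
  have hsk : κ * n * s ≤ |a| * s := mul_le_mul_of_nonneg_right ha (by linarith)
  have hs1 : s ≤ 1 / κ := by
    rw [le_div_iff₀ hκ]
    by_contra hcon
    push Not at hcon
    have := mul_lt_mul_of_pos_right hcon hn'
    linarith
  have hAl : κ * n / 4 ≤ A := by linarith
  have hAl2 : (κ * n / 4) ^ 2 ≤ A ^ 2 := by gcongr
  have hβ2 : β ^ 2 ≤ A ^ 2 := by rw [← sq_abs β]; gcongr
  have hβB : |β| ≤ B := by
    rw [eJ, abs_mul, abs_mul, abs_of_nonpos (by linarith [sq_nonneg A] : β ^ 2 - 9 * A ^ 2 ≤ 0)] at hJ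
    norm_num at hJ
    by_contra hcon
    push Not at hcon
    have h1 : |β| * (8 * (κ * n / 4) ^ 2) ≤ |β| * (9 * A ^ 2 - β ^ 2) :=
      mul_le_mul_of_nonneg_left (by linarith) (abs_nonneg _)
    have h2 : B * (κ * n) ^ 2 ≤ |β| * (κ * n) ^ 2 := mul_le_mul_of_nonneg_right hcon.le (by positivity)
    have h3 : B * (κ * n) ^ 2 * 64 = C * n ^ 2 := by rw [← hBe]; ring
    linarith
  have hmain : 3 * s * (16 * a ^ 2 * s + b0 ^ 2) ≤ (1 + δ) * n ^ 2 := by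
    have h1 : a * β ≤ |a| * B := by
      calc a * β ≤ |a * β| := le_abs_self _
        _ = |a| * |β| := abs_mul _ _
        _ ≤ _ := mul_le_mul_of_nonneg_left hβB (abs_nonneg _)
    have h2 : 96 * s * (a * β) ≤ 96 * s * (|a| * B) := mul_le_mul_of_nonneg_left h1 (by linarith)
    have h3 : (|a| * s) * B ≤ (n / 3) * B := mul_le_mul_of_nonneg_right (by linarith) hB0.le
    have h4 : 32 * B * n ≤ δ * n * n := mul_le_mul_of_nonneg_right hnb hn'.le
    linarith [sq_nonneg β]
  have hb02 : b0 ^ 2 ≤ (n:ℝ) ^ 2 := by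
    have h1 : 3 / 4 * b0 ^ 2 ≤ s * b0 ^ 2 := mul_le_mul_of_nonneg_right hs34 (sq_nonneg _)
    have h2 : 0 ≤ 48 * a ^ 2 * s ^ 2 := by positivity
    have h3 : (1 + δ) * (n:ℝ) ^ 2 ≤ (1 + 1 / 4) * n ^ 2 := by gcongr
    linarith [sq_nonneg (n:ℝ)]
  have hb0n : |b0| ≤ n := abs_le_of_sq_le_sq hb02 hn'.le
  refine ⟨![x, s, a / n, b0 / n], ⟨hx0, hx1, hs, hs1, ?_, ?_, ?_, ?_⟩, ?_⟩
  · show κ ≤ |a / n|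
    rwa [abs_div, abs_of_pos hn', le_div_iff₀ hn']
  · show |a / n| ≤ 1
    rw [abs_div, abs_of_pos hn', div_le_one hn']; linarith
  · show |b0 / n| ≤ 1
    rwa [abs_div, abs_of_pos hn', div_le_one hn']
  · show 3 * s * (16 * (a / n) ^ 2 * s + (b0 / n) ^ 2) ≤ 1 + δ
    rw [show 3 * s * (16 * (a / n) ^ 2 * s + (b0 / n) ^ 2) = 3 * s * (16 * a ^ 2 * s + b0 ^ 2) / n ^ 2 by
      field_simp, div_le_iff₀ (by positivity)]
    exact hmain
  · rw [dist_pi_le_iff (by positivity)]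
    intro i
    have hc := hp.hc
    have hd := hp.hd
    have hb := hp.hb
    rw [Real.dist_eq]
    fin_cases i
    · show |a / n - a / n| ≤ _
      rw [sub_self, abs_zero]; positivity
    · show |(f.b:ℝ) / n - (b0 / n + 4 * (a / n) * x)| ≤ _
      rw [hb, show (b0 + 4 * a * x) / n - (b0 / n + 4 * (a / n) * x) = 0 by ring, abs_zero]; positivity
    · show |(f.c:ℝ) / n - (-6 * (a / n) * s + 3 * (b0 / n) * x + 6 * (a / n) * x ^ 2)| ≤ _
      rw [hc, show (8 * β - 6 * a * s + 3 * b0 * x + 6 * a * x ^ 2) / n -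
        (-6 * (a / n) * s + 3 * (b0 / n) * x + 6 * (a / n) * x ^ 2) = 8 * β / n by ring, abs_div, abs_of_pos hn', abs_mul]
      norm_num
      gcongr
    · show |(f.d:ℝ) / n - (-(b0 / n) * s - 12 * (a / n) * s * x + 3 * (b0 / n) * x ^ 2 + 4 * (a / n) * x ^ 3)| ≤ _
      rw [hd, show (-b0 * s + 2 * (8 * β - 6 * a * s) * x + 3 * b0 * x ^ 2 + 4 * a * x ^ 3) / n -
        (-(b0 / n) * s - 12 * (a / n) * s * x + 3 * (b0 / n) * x ^ 2 + 4 * (a / n) * x ^ 3) = 16 * x * β / n by ring,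
        abs_div, abs_of_pos hn', abs_mul, abs_of_nonneg (by linarith : 0 ≤ 16 * x)]
      have : 16 * x * |β| ≤ 8 * B := by
        have h1 := mul_le_mul_of_nonneg_right (by linarith : 16 * x ≤ 8) (abs_nonneg β)
        linarith
      gcongr

end BQF

open MeasureTheory in
lemma lint_w (C : ℝ) (hC : 0 < C) (w : (Fin 4 → ℝ) → ℝ) (hw : Continuous w) (hw0 : ∀ v, 0 ≤ w v) :
    ∫ v, w v * (2 * C / |Hf (v 0) (v 1) (v 2)|) =
      (∫⁻ v, ENNReal.ofReal (w v * (2 * C / |Hf (v 0) (v 1) (v 2)|))).toReal := by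
  rw [integral_eq_lintegral_of_nonneg_ae]
  · exact Eventually.of_forall fun v => mul_nonneg (hw0 v) (by positivity)
  · apply Measurable.aestronglyMeasurable
    have := Hf_cont.measurable
    have := hw.measurable
    fun_prop

open MeasureTheory in
lemma lint_w_le (C : ℝ) (hC : 0 < C) (w : (Fin 4 → ℝ) → ℝ) (hw1 : ∀ v, w v ≤ 1)
    (G : Set (Fin 4 → ℝ)) (hG : IsOpen G) (hs : ∀ v, w v ≠ 0 → v ∈ G) :
    (∫⁻ v, ENNReal.ofReal (w v * (2 * C / |Hf (v 0) (v 1) (v 2)|))) ≤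
      ∫⁻ v in G, ENNReal.ofReal (2 * C / |Hf (v 0) (v 1) (v 2)|) := by
  rw [← lintegral_indicator hG.measurableSet]
  apply lintegral_mono
  intro v
  by_cases hv : v ∈ G
  · rw [Set.indicator_of_mem hv]
    apply ENNReal.ofReal_le_ofReal
    exact mul_le_of_le_one_left (by positivity) (hw1 v)
  · have : w v = 0 := by by_contra h; exact hv (hs v h)
    simp [this]

noncomputable def Vd (C δ : ℝ) : ℝ :=
  C * Real.pi * (1 + 2 * δ) / 27 * (Real.arcsin ((1 / 2 + δ) / √(1 - δ)) - Real.arcsin (-δ / √(1 - δ)))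

lemma BQF.upper (C κ δ ε : ℝ) (hC : 0 < C) (hκ : 0 < κ) (hδ : 0 < δ) (hδ1 : δ ≤ 1 / 10) (hε : 0 < ε) :
    ∀ᶠ n : ℕ in atTop, (Set.ncard {f ∈ Usc C ((n:ℝ)^2) | κ * n < |(f.a:ℝ)|} : ℝ) ≤ (Vd C δ + ε) * (n:ℝ) ^ 4 := by
  have hGo := Reg_open (-δ) (1 / 2 + δ) (1 - δ) (1 + 2 * δ)
  have hcont : Continuous Phi := by
    rw [continuous_iff_continuousAt]; exact fun u => (Phi_deriv u).continuousAt
  obtain ⟨w, Kw, ρ, K', M, κ', h, hL, hw0, hw1, hρ, hK', hKG, hws, hwK, hM, hκ', hh, hMb, hb⟩ :=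
    bump ((Uc_compact κ δ hκ).image hcont) hGo
    (by rw [← Phi_image]; exact Set.image_mono (Uc_sub κ δ hκ hδ)) (fun v hv => ⟨hv.1, hv.2.1⟩)
  have hv := vague C hC w Kw hL M hM (fun v hv => hMb v (hws v hv)) κ' h hκ' hh (fun v hv => hb v (hws v hv))
  have hVd0 : ∫ v, w v * (2 * C / |Hf (v 0) (v 1) (v 2)|) ≤ Vd C δ := by
    have hq : 0.9 ≤ √(1 - δ) := Real.le_sqrt_of_sq_le (by norm_num; linarith)
    have h1 := lint_w_le C hC w hw1 _ hGo (fun v hv => hKG (hws v hv))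
    rw [lint_reg' C hC _ _ _ _ (by linarith) (by linarith) (by linarith) (by norm_num at hq; linarith)
      (by norm_num at hq; linarith)] at h1
    rw [lint_w C hC w hL.continuous hw0]
    refine (ENNReal.toReal_mono ENNReal.ofReal_ne_top h1).trans ?_
    rw [ENNReal.toReal_ofReal]
    · exact le_rfl
    · apply mul_nonneg (by positivity)
      rw [sub_nonneg]
      apply Real.monotone_arcsin
      gcongr; linarith
  have h2 := hv.eventually_lt_const (show _ < Vd C δ + ε by linarith)
  have h3 : ∀ᶠ n : ℕ in atTop, 32 * (C / (64 * κ ^ 2)) ≤ δ * (n:ℝ) :=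
    (tendsto_natCast_atTop_atTop.const_mul_atTop hδ).eventually_ge_atTop _
  have h4 : ∀ᶠ n : ℕ in atTop, 8 * (C / (64 * κ ^ 2)) ≤ ρ * (n:ℝ) :=
    (tendsto_natCast_atTop_atTop.const_mul_atTop hρ).eventually_ge_atTop _
  filter_upwards [h2, h3, h4, eventually_gt_atTop 0] with n e2 e3 e4 hn
  have hn' : (0:ℝ) < n := by exact_mod_cast hn
  rw [div_lt_iff₀ (by positivity)] at e2
  refine le_trans ?_ e2.le
  refine count_up hn hh hw0 (fun v hv => hMb v (hws v hv)) (fun v hv => (hb v (hws v hv)).2) _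
    ((Usc_finite C _).subset (Set.sep_subset _ _)) ?_
  rintro f ⟨hf, hfa⟩
  refine ⟨?_, hf.2.2.1⟩
  obtain ⟨u, hu, hd⟩ := near_pt C κ δ hC hκ hδ (by linarith) n hn e3 f hf hfa.le
  refine hwK _ (Phi u) ⟨u, hu, rfl⟩ (hd.trans ?_)
  rwa [div_le_iff₀ hn']



lemma Par.scale {a b c d e x s b0 β : ℝ} (h : Par a b c d e x s b0 β) (t : ℝ) (ht : 0 < t) :
    Par (t * a) (t * b) (t * c) (t * d) (t * e) x s (t * b0) (t * β) := by
  have := h.hD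
  refine ⟨h.hs, ?_, ?_, ?_, ?_, ?_⟩
  · have h2 : 0 < t ^ 2 * (16 * a ^ 2 * s - 32 * a * β + b0 ^ 2) := by positivity
    linarith
  · rw [h.hb]; ring
  · rw [h.hc]; ring
  · rw [h.hd]; ring
  · rw [h.he]; ring

lemma tube {K : Set (Fin 4 → ℝ)} (hK : IsCompact K) (x1 x2 r m : ℝ) (hs : K ⊆ Reg x1 x2 r m) :
    ∃ η > 0, ∀ v ∈ K, ∀ β : ℝ, |β| < η → (v, β) ∈ Ob x1 x2 r m := by
  have h0 : K ×ˢ ({0} : Set ℝ) ⊆ Ob x1 x2 r m := by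
    rintro ⟨v, β⟩ ⟨hv, hβ⟩
    have hv' := hs hv
    rw [Reg_eq] at hv'
    have : β = 0 := hβ
    rw [this]; exact hv'
  obtain ⟨U, W, hU, hW, hKU, h0W, hUW⟩ := generalized_tube_lemma hK isCompact_singleton (Ob_open x1 x2 r m) h0
  obtain ⟨η, hη, hb⟩ := Metric.isOpen_iff.mp hW 0 (h0W rfl)
  refine ⟨η, hη, fun v hv β hβ => hUW ⟨hKU hv, hb ?_⟩⟩
  rw [Metric.mem_ball, Real.dist_eq, sub_zero]; exact hβ

lemma I_j (a b c d e j : ℝ) (ha : a ≠ 0) (hH : Hf a b c ≠ 0) (hj : e * Hf a b c - Gf a b c d = j) :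
    If a b c d e = - Hf a b c * s0f ![a, b, c, d] / 9 + 12 * a * j / Hf a b c := by
  have he : e = (j + Gf a b c d) / Hf a b c := by rw [eq_div_iff hH]; linarith
  have hs : s0f ![a, b, c, d] = -(c - 3 * b * ((54 * a * d - 9 * b * c) / Hf a b c) +
    6 * a * ((54 * a * d - 9 * b * c) / Hf a b c) ^ 2) / (6 * a) := by simp [s0f, x0f]
  rw [hs, he, If]
  field_simp
  unfold Hf Gf
  ring

lemma ivt_beta (I j η i1 : ℝ) (hη : 0 < η) (hi : i1 ≤ I) (h1 : 512 * η ^ 2 ≤ 12 * i1) (h2 : |j| ≤ 12 * i1 * η) :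
    ∃ β, |β| ≤ η ∧ j = 512 * β ^ 3 - 24 * I * β := by
  have hc : ContinuousOn (fun β : ℝ => 512 * β ^ 3 - 24 * I * β) (Set.Icc (-η) η) := by fun_prop
  have hiv := intermediate_value_Icc' (by linarith : -η ≤ η) hc
  have hq : 512 * η ^ 3 ≤ 12 * i1 * η := by
    have := mul_le_mul_of_nonneg_right h1 hη.le
    linarith
  have hq2 : i1 * η ≤ I * η := mul_le_mul_of_nonneg_right hi hη.le
  have hj := abs_le.mp h2
  obtain ⟨β, hβ, he⟩ := hiv (show j ∈ Set.Icc _ _ from ⟨by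
    show 512 * η ^ 3 - 24 * I * η ≤ j
    linarith, by
    show j ≤ 512 * (-η) ^ 3 - 24 * I * (-η)
    have : (-η) ^ 3 = - η ^ 3 := by ring
    rw [this]; linarith⟩)
  exact ⟨β, abs_le.mpr hβ, he.symm⟩

lemma par_of_pt (C : ℝ) (hC : 0 < C) {K : Set (Fin 4 → ℝ)} (hK : IsCompact K) (hs : K ⊆ Reg 0 (1/2) 1 1)
    (M κ h : ℝ) (hM0 : 0 < M) (hκ : 0 < κ) (hh : 0 < h) (hM : ∀ v ∈ K, ∀ i, |v i| ≤ M)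
    (hb : ∀ v ∈ K, κ ≤ |v 0| ∧ h ≤ |Hf (v 0) (v 1) (v 2)|) :
    ∃ j0 > 0, ∀ a b c d e : ℝ, ![a, b, c, d] ∈ K → |e * Hf a b c - Gf a b c d| ≤ j0 →
      ∃ x s b0 β, Par a b c d e x s b0 β ∧ 0 < x ∧ x < 1 / 2 ∧ 1 < x ^ 2 + s ∧ If a b c d e < 1 := by
  obtain ⟨η, hη, ht⟩ := tube hK _ _ _ _ hs
  set η1 := min (η / 2) (min 1 (12 * (h / 24) / 512)) with hη1
  have hη10 : 0 < η1 := by positivity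
  have hη1a : η1 ≤ η / 2 := min_le_left _ _
  have hη1b : η1 ≤ 1 := (min_le_right _ _).trans (min_le_left _ _)
  have hη1c : η1 ≤ 12 * (h / 24) / 512 := (min_le_right _ _).trans (min_le_right _ _)
  refine ⟨min (12 * (h / 24) * η1) (h / 24 * h / (12 * M)), by positivity, ?_⟩
  intro a b c d e hv hj
  have hj1 := hj.trans (min_le_left _ _)
  have hj2 := hj.trans (min_le_right _ _)
  obtain ⟨r0, r1, r2, r3, r4, r5, r6⟩ := hs hv
  have r0' : a ≠ 0 := r0
  have r1' : Hf a b c < 0 := r1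
  obtain ⟨hb1, hb2⟩ := hb _ hv
  have hb2' : h ≤ |Hf a b c| := hb2
  have haM : |a| ≤ M := hM _ hv 0
  set j := e * Hf a b c - Gf a b c d with hjd
  have hI := I_j a b c d e j r0' r1'.ne hjd.symm
  have hs34 : 3 / 4 ≤ s0f ![a, b, c, d] := by nlinarith
  have hIl : h / 24 ≤ If a b c d e := by
    have h1 : h * (3 / 4) ≤ |Hf a b c| * s0f ![a, b, c, d] := mul_le_mul hb2' hs34 (by norm_num) (abs_nonneg _)
    rw [abs_of_neg r1'] at h1
    have h2 : |12 * a * j / Hf a b c| ≤ h / 24 := by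
      rw [abs_div, div_le_iff₀ (by linarith), abs_mul, abs_mul]
      norm_num
      rw [le_div_iff₀ (by positivity)] at hj2
      calc 12 * |a| * |j| ≤ 12 * M * |j| := by gcongr
        _ ≤ h / 24 * h := by linarith
        _ ≤ h / 24 * |Hf a b c| := by gcongr
    have h3 := (abs_le.mp h2).1
    rw [hI]; linarith
  obtain ⟨β, hβ, hβe⟩ := ivt_beta (If a b c d e) j η1 (h / 24) hη10 hIl (by nlinarith) hj1
  obtain ⟨⟨q0, q1⟩, q2, q3, q4, q5, q6⟩ := ht _ hv β (by linarith)
  set q : (Fin 4 → ℝ) × ℝ := (![a, b, c, d], β) with hq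
  have hHb : Hb q = Hf a b c + 288 * a * β := rfl
  have hxe : xb q * (Hf a b c + 288 * a * β) = 54 * a * d - 9 * b * c + 72 * β * b := by
    rw [← hHb, xb, div_mul_cancel₀ _ q1.ne]; rfl
  have hse : 6 * a * sb q = 8 * β - (c - 3 * b * xb q + 6 * a * xb q ^ 2) := by
    rw [sb, mul_div_assoc']
    exact mul_div_cancel_left₀ _ (mul_ne_zero (by norm_num) r0')
  have hp := par_of_beta r0' (by rw [← hjd]; exact hβe) (by rw [← hHb]; exact q1) hxe hse q4
  refine ⟨_, _, _, _, hp, q2, q3, q5, ?_⟩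
  rw [hp.I_eq]
  have hHe := hp.H_eq
  rw [← hHb] at hHe
  have q6' : - Hb q * sb q / 9 + 64 * β ^ 2 < 1 := q6
  rw [hHe] at q6'
  linarith



open MeasureTheory in
lemma inner_K (C ε : ℝ) (hC : 0 < C) (hε : 0 < ε) : ∃ K : Set (Fin 4 → ℝ), IsCompact K ∧ K ⊆ Reg 0 (1/2) 1 1 ∧
    ENNReal.ofReal (C * (Real.pi ^ 2 / 6) / 27 - ε) <
      ∫⁻ v in K, ENNReal.ofReal (2 * C / |Hf (v 0) (v 1) (v 2)|) := by
  have hV := lint_reg' C hC 0 (1/2) 1 1 (by norm_num) (by norm_num) (by norm_num) (by norm_num) (by norm_num)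
  have harc : Real.arcsin (1 / 2) = Real.pi / 6 := by
    rw [← Real.sin_pi_div_six, Real.arcsin_sin] <;> linarith [Real.pi_pos]
  rw [Real.sqrt_one, div_one, div_one, Real.arcsin_zero, harc,
    show C * Real.pi * 1 / 27 * (Real.pi / 6 - 0) = C * (Real.pi ^ 2 / 6) / 27 by ring] at hV
  have hGo := Reg_open 0 (1/2) 1 1
  set G := Reg 0 (1/2) 1 1 with hG
  set g : (Fin 4 → ℝ) → ENNReal := fun v => ENNReal.ofReal (2 * C / |Hf (v 0) (v 1) (v 2)|) with hg
  set ν := (volume.restrict G).withDensity g with hν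
  have hνG : ν Set.univ = ENNReal.ofReal (C * (Real.pi ^ 2 / 6) / 27) := by
    rw [hν, withDensity_apply _ MeasurableSet.univ, Measure.restrict_univ]; exact hV
  have hνG' : ν G = ENNReal.ofReal (C * (Real.pi ^ 2 / 6) / 27) := by
    rw [hν, withDensity_apply _ hGo.measurableSet, Measure.restrict_restrict hGo.measurableSet, Set.inter_self]; exact hV
  have : IsFiniteMeasure ν := ⟨by rw [hνG]; exact ENNReal.ofReal_lt_top⟩
  have hpos : 0 < C * (Real.pi ^ 2 / 6) / 27 := by have := Real.pi_pos; positivity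
  obtain ⟨K, hKG, hK, hlt⟩ := hGo.exists_lt_isCompact (μ := ν) (r := ENNReal.ofReal (C * (Real.pi ^ 2 / 6) / 27 - ε)) (by
    rw [hνG', ENNReal.ofReal_lt_ofReal_iff hpos]; linarith)
  refine ⟨K, hK, hKG, hlt.trans_le ?_⟩
  rw [hν, withDensity_apply _ hK.measurableSet, Measure.restrict_restrict hK.measurableSet]
  exact lintegral_mono_set Set.inter_subset_left

lemma BQF.lower (C ε : ℝ) (hC : 0 < C) (hε : 0 < ε) :
    ∀ᶠ n : ℕ in atTop, (C * (Real.pi ^ 2 / 6) / 27 - ε) * (n:ℝ) ^ 4 ≤ ((Lsc C ((n:ℝ)^2)).ncard : ℝ) := by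
  set V := C * (Real.pi ^ 2 / 6) / 27 with hVd
  obtain ⟨K, hK, hKG, hlt⟩ := inner_K C (ε / 4) hC (by positivity)
  have hGo := Reg_open 0 (1/2) 1 1
  obtain ⟨w, Kw, ρ, K', M, κ, h, hL, hw0, hw1, hρ, hK', hKG', hws, hwK, hM, hκ, hh, hMb, hb⟩ :=
    bump hK hGo hKG (fun v hv => ⟨hv.1, hv.2.1⟩)
  have hM' : (0:ℝ) < M := by exact_mod_cast hM
  have hM1 : (1:ℝ) ≤ M := by exact_mod_cast hM
  have hv := vague C hC w Kw hL M hM (fun v hv => hMb v (hws v hv)) κ h hκ hh (fun v hv => hb v (hws v hv))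
  have hint : V - ε / 4 ≤ ∫ v, w v * (2 * C / |Hf (v 0) (v 1) (v 2)|) := by
    rw [lint_w C hC w hL.continuous hw0]
    have h1 := lint_w_le C hC w hw1 _ hGo (fun v hv => hKG' (hws v hv))
    rw [lint_reg' C hC 0 (1/2) 1 1 (by norm_num) (by norm_num) (by norm_num) (by norm_num) (by norm_num)] at h1
    have hne := (h1.trans_lt ENNReal.ofReal_lt_top).ne
    rw [← ENNReal.ofReal_le_iff_le_toReal hne]
    refine hlt.le.trans ?_
    rw [← MeasureTheory.lintegral_indicator hK.measurableSet]
    apply MeasureTheory.lintegral_mono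
    intro v
    by_cases hvK : v ∈ K
    · dsimp only
      rw [Set.indicator_of_mem hvK, hwK v v hvK (by simpa using hρ.le), one_mul]
    · rw [Set.indicator_of_notMem hvK]; exact zero_le
  obtain ⟨j0, hj0, hpar⟩ := par_of_pt C hC hK' hKG' M κ h hM' hκ hh hMb hb
  have e1 := hv.eventually_const_lt (show V - ε / 2 < _ by linarith)
  have e2 := red_count C κ (M + 3 / κ) (ε / 2) hC hκ (by have : 0 < 3 / κ := by positivity
                                                         linarith) (by positivity)
  have e3 : ∀ᶠ n : ℕ in atTop, C ≤ j0 * (n:ℝ) :=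
    (tendsto_natCast_atTop_atTop.const_mul_atTop hj0).eventually_ge_atTop _
  filter_upwards [e1, e2, e3, eventually_gt_atTop 0] with n f1 f2 f3 hn
  have hn' : (0:ℝ) < n := by exact_mod_cast hn
  rw [lt_div_iff₀ (by positivity)] at f1
  set Red := {f : BQF | f.a ≠ 0 ∧ ¬f.Irred ∧ κ * n ≤ |(f.a:ℝ)| ∧ |(f.a:ℝ)| ≤ (M + 3 / κ) * n ∧
    |(f.b:ℝ)| ≤ (M + 3 / κ) * n ∧ |(f.c:ℝ)| ≤ (M + 3 / κ) * n ∧ |(f.d:ℝ)| ≤ (M + 3 / κ) * n ∧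
    |(f.e:ℝ)| ≤ (M + 3 / κ) * n ∧ |(f.J:ℝ)| < C * (n:ℝ)^2} with hRed
  have hRfin : Red.Finite := by
    apply finite_of_bdd _ ((M + 3 / κ) * n)
    rintro f ⟨-, -, -, h1, h2, h3, h4, h5, -⟩
    exact ⟨h1, h2, h3, h4, h5⟩
  have hLfin : (Lsc C ((n:ℝ)^2)).Finite := by
    apply (Usc_finite C ((n:ℝ)^2)).subset
    rintro f ⟨h1, h2, h3, x, s, b0, β, hp, hx0, hx1, hs⟩
    exact ⟨h1.1, h2, h3, x, s, b0, β, hp, hx0.le, hx1.le, hs.le⟩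
  have hkey : wsum C w M n ≤ ((Lsc C ((n:ℝ)^2) ∪ Red).ncard : ℝ) := by
    refine count_lo hw1 _ (hLfin.union hRfin) ?_
    intro f hwf hJ
    have hf := hws _ hwf
    have hJ' := hJ
    rw [J_cast] at hJ'
    have hjs : (f.e / n : ℝ) * Hf (f.a / n) (f.b / n) (f.c / n) - Gf (f.a / n) (f.b / n) (f.c / n) (f.d / n) =
        (f.e * Hf f.a f.b f.c - Gf f.a f.b f.c f.d) / n ^ 3 := by
      unfold Hf Gf; field_simp
    obtain ⟨x, s, b0, β, hp, hx0, hx1, hs, hI⟩ := hpar (f.a / n) (f.b / n) (f.c / n) (f.d / n) (f.e / n) hf (by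
      rw [hjs, abs_div, abs_of_pos (by positivity : (0:ℝ) < n ^ 3), div_le_iff₀ (by positivity)]
      have := mul_le_mul_of_nonneg_right f3 (sq_nonneg (n:ℝ))
      linarith)
    have hp' := hp.scale n hn'
    rw [mul_div_cancel₀ _ hn'.ne', mul_div_cancel₀ _ hn'.ne', mul_div_cancel₀ _ hn'.ne', mul_div_cancel₀ _ hn'.ne',
      mul_div_cancel₀ _ hn'.ne'] at hp'
    have hIs : If (f.a / n) (f.b / n) (f.c / n) (f.d / n) (f.e / n) = If f.a f.b f.c f.d f.e / (n:ℝ) ^ 2 := by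
      unfold If; ring
    rw [hIs, div_lt_one (by positivity)] at hI
    obtain ⟨A, y, hA, hy, hys, hA2, hβ, eI, eJ, ba, bb, bc, bd, be⟩ := hp'.bounds hx0.le hx1.le hs.le
    have hIabs : |(f.I:ℝ)| < (n:ℝ) ^ 2 := by
      rw [I_cast, abs_of_nonneg (by rw [eI]; positivity)]; exact hI
    by_cases hirr : f.Irred
    · left
      exact ⟨hirr, hIabs, hJ, x, s, _, _, hp', hx0, hx1, hs⟩
    · right
      have hab := hMb _ hf
      have conv : ∀ z : ℤ, |(z:ℝ) / n| ≤ M → |(z:ℝ)| ≤ (M + 3 / κ) * n := by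
        intro z hz
        rw [abs_div, abs_of_pos hn', div_le_iff₀ hn'] at hz
        have : 0 < 3 / κ * n := by positivity
        linarith
      have hka : κ * n ≤ |(f.a:ℝ)| := by
        have := (hb _ hf).1
        have h2 : κ ≤ |(f.a:ℝ) / n| := this
        rwa [abs_div, abs_of_pos hn', le_div_iff₀ hn'] at h2
      have ha0 : f.a ≠ 0 := by
        intro h0
        rw [h0] at hka
        have : 0 < κ * n := by positivity
        simp at hka; linarith
      refine ⟨ha0, hirr, hka, conv _ (hab 0), conv _ (hab 1), conv _ (hab 2), conv _ (hab 3), ?_, hJ⟩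
      have hAn : A < n / 6 := by
        by_contra hcon
        push Not at hcon
        have h1 : (n / 6 : ℝ) ^ 2 ≤ A ^ 2 := by gcongr
        rw [eI] at hI
        have := sq_nonneg ((n:ℝ) * β)
        have := sq_pos_of_pos hn'
        linarith
      have hys2 : y ^ 2 ≤ 1 / 3 * (1 / κ) := by
        have h1 : κ * n * y ^ 2 ≤ |(f.a:ℝ)| * y ^ 2 := mul_le_mul_of_nonneg_right hka (sq_nonneg _)
        rw [mul_one_div, le_div_iff₀ hκ]
        have h2 : (y ^ 2 * κ) * n ≤ 1 / 3 * n := by linarith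
        exact le_of_mul_le_mul_right h2 hn'
      calc |(f.e:ℝ)| ≤ 50 * A * y ^ 2 := be
        _ ≤ 50 * (n / 6) * (1 / 3 * (1 / κ)) := by gcongr
        _ ≤ 3 / κ * n := by
            rw [show 50 * ((n:ℝ) / 6) * (1 / 3 * (1 / κ)) = (50 / 18) * (n / κ) by ring, show 3 / κ * n = 3 * (n / κ) by ring]
            have : 0 < n / κ := by positivity
            linarith
        _ ≤ _ := by
            have : 0 < (M:ℝ) * n := by positivity
            linarith
  have hun : ((Lsc C ((n:ℝ)^2) ∪ Red).ncard : ℝ) ≤ (Lsc C ((n:ℝ)^2)).ncard + Red.ncard := by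
    exact_mod_cast Set.ncard_union_le _ _
  have f1' : (V - ε / 2) * (n:ℝ) ^ 4 < wsum C w M n := f1
  linarith



lemma Vd_tendsto (C : ℝ) : Tendsto (Vd C) (nhds 0) (nhds (C * (Real.pi ^ 2 / 6) / 27)) := by
  have harc : Real.arcsin (1 / 2) = Real.pi / 6 := by
    rw [← Real.sin_pi_div_six, Real.arcsin_sin] <;> linarith [Real.pi_pos]
  have h0 : Vd C 0 = C * (Real.pi ^ 2 / 6) / 27 := by
    unfold Vd
    simp only [mul_zero, add_zero, sub_zero, Real.sqrt_one, div_one, neg_zero, Real.arcsin_zero, harc]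
    ring
  rw [← h0]
  have hne : √(1 - (0:ℝ)) ≠ 0 := by norm_num
  have : ContinuousAt (Vd C) 0 := by
    unfold Vd
    apply ContinuousAt.mul (by fun_prop)
    apply ContinuousAt.sub
    · exact Real.continuous_arcsin.continuousAt.comp (ContinuousAt.div (by fun_prop) (by fun_prop) hne)
    · exact Real.continuous_arcsin.continuousAt.comp (ContinuousAt.div (by fun_prop) (by fun_prop) hne)
  exact this

namespace BQF

lemma nat_upper (C ε : ℝ) (hC : 0 < C) (hε : 0 < ε) :
    ∀ᶠ n : ℕ in atTop, (classCount (Good C ((n:ℝ)^2)) : ℝ) ≤ (C * (Real.pi ^ 2 / 6) / 27 + ε) * (n:ℝ) ^ 4 := by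
  obtain ⟨K, hK, ht⟩ := tight C hC
  have h1 : ∀ᶠ δ in nhdsWithin (0:ℝ) (Set.Ioi 0), Vd C δ < C * (Real.pi ^ 2 / 6) / 27 + ε / 4 :=
    ((Vd_tendsto C).mono_left nhdsWithin_le_nhds).eventually_lt_const (by linarith)
  have h2 : ∀ᶠ δ in nhdsWithin (0:ℝ) (Set.Ioi 0), δ ∈ Set.Ioo (0:ℝ) (1 / 10) := Ioo_mem_nhdsGT (by norm_num)
  obtain ⟨δ, hδ, hδ1⟩ := (h1.and h2).exists
  set κ := (ε / (4 * K)) ^ (4:ℝ) with hκ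
  have hq : 0 < ε / (4 * K) := by positivity
  have hκ0 : 0 < κ := by positivity
  have hκe : K * κ ^ (1/4:ℝ) = ε / 4 := by
    rw [hκ, ← Real.rpow_mul hq.le]
    norm_num
    field_simp
  filter_upwards [ht κ hκ0, upper C κ δ (ε / 4) hC hκ0 hδ1.1 hδ1.2.le (by positivity)] with n e1 e2
  rw [hκe] at e1
  have h3 := count_le hC (Usc_finite C ((n:ℝ)^2))
  have h4 : (Usc C ((n:ℝ)^2)).ncard ≤ Set.ncard {f ∈ Usc C ((n:ℝ)^2) | |(f.a:ℝ)| ≤ κ * n} +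
      Set.ncard {f ∈ Usc C ((n:ℝ)^2) | κ * n < |(f.a:ℝ)|} := by
    refine le_trans (Set.ncard_le_ncard ?_ ?_) (Set.ncard_union_le _ _)
    · intro f hf
      rcases le_or_gt |(f.a:ℝ)| (κ * n) with h | h
      · left; exact ⟨hf, h⟩
      · right; exact ⟨hf, h⟩
    · exact ((Usc_finite C _).subset (Set.sep_subset _ _)).union ((Usc_finite C _).subset (Set.sep_subset _ _))
  have h5 : (classCount (Good C ((n:ℝ)^2)) : ℝ) ≤ (Set.ncard {f ∈ Usc C ((n:ℝ)^2) | |(f.a:ℝ)| ≤ κ * n} : ℝ) +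
      (Set.ncard {f ∈ Usc C ((n:ℝ)^2) | κ * n < |(f.a:ℝ)|} : ℝ) := by exact_mod_cast h3.trans h4
  have h6 : (Vd C δ + ε / 4) * (n:ℝ) ^ 4 ≤ (C * (Real.pi ^ 2 / 6) / 27 + ε / 4 + ε / 4) * (n:ℝ) ^ 4 := by gcongr
  have h7 : 0 ≤ ε * (n:ℝ) ^ 4 := by positivity
  linarith

lemma nat_tendsto (C : ℝ) (hC : 0 < C) : Tendsto (fun n : ℕ => (classCount (Good C ((n:ℝ)^2)) : ℝ) / (n:ℝ) ^ 4) atTop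
    (nhds (C * (Real.pi ^ 2 / 6) / 27)) := by
  rw [Metric.tendsto_nhds]
  intro ε hε
  filter_upwards [nat_upper C (ε / 2) hC (by positivity), lower C (ε / 2) hC (by positivity), eventually_gt_atTop 0]
    with n h1 h2 hn
  have hn' : (0:ℝ) < n := by exact_mod_cast hn
  have h3 : ((Lsc C ((n:ℝ)^2)).ncard : ℝ) ≤ (classCount (Good C ((n:ℝ)^2)) : ℝ) := by
    exact_mod_cast count_ge hC (Usc_finite C ((n:ℝ)^2))
  have h4 : (classCount (Good C ((n:ℝ)^2)) : ℝ) / (n:ℝ) ^ 4 ≤ C * (Real.pi ^ 2 / 6) / 27 + ε / 2 := by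
    rwa [div_le_iff₀ (by positivity)]
  have h5 : C * (Real.pi ^ 2 / 6) / 27 - ε / 2 ≤ (classCount (Good C ((n:ℝ)^2)) : ℝ) / (n:ℝ) ^ 4 := by
    rw [le_div_iff₀ (by positivity)]; exact h2.trans h3
  rw [Real.dist_eq, abs_lt]
  constructor <;> linarith

lemma real_tendsto (C : ℝ) (hC : 0 < C) : Tendsto (fun X : ℝ => (classCount (Good C X) : ℝ) / X ^ 2) atTop
    (nhds (C * (Real.pi ^ 2 / 6) / 27)) := by
  set V := C * (Real.pi ^ 2 / 6) / 27
  have hF := nat_tendsto C hC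
  have hfl : Tendsto (fun X : ℝ => ⌊√X⌋₊) atTop atTop := tendsto_nat_floor_atTop.comp Real.tendsto_sqrt_atTop
  have hr : Tendsto (fun n : ℕ => (n:ℝ) / ((n:ℝ) + 1)) atTop (nhds 1) := tendsto_natCast_div_add_atTop 1
  have hr4 : Tendsto (fun n : ℕ => ((n:ℝ) / ((n:ℝ) + 1)) ^ 4) atTop (nhds 1) := by simpa using hr.pow 4
  have hlo : Tendsto (fun X : ℝ => (classCount (Good C ((⌊√X⌋₊:ℝ)^2)) : ℝ) / (⌊√X⌋₊:ℝ) ^ 4 *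
      ((⌊√X⌋₊:ℝ) / ((⌊√X⌋₊:ℝ) + 1)) ^ 4) atTop (nhds V) := by
    have := (hF.mul hr4).comp hfl
    rw [mul_one] at this
    exact this
  have hup : Tendsto (fun X : ℝ => (classCount (Good C (((⌊√X⌋₊ + 1 : ℕ):ℝ)^2)) : ℝ) / ((⌊√X⌋₊ + 1 : ℕ):ℝ) ^ 4 /
      ((⌊√X⌋₊:ℝ) / ((⌊√X⌋₊:ℝ) + 1)) ^ 4) atTop (nhds V) := by
    have := (((tendsto_add_atTop_iff_nat 1).mpr hF).div hr4 one_ne_zero).comp hfl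
    rw [div_one] at this
    exact this
  refine tendsto_of_tendsto_of_tendsto_of_le_of_le' hlo hup ?_ ?_
  · filter_upwards [eventually_ge_atTop 1] with X hX
    have hX0 : (0:ℝ) ≤ X := by linarith
    set n := ⌊√X⌋₊ with hn
    have h1 : (n:ℝ) ≤ √X := Nat.floor_le (Real.sqrt_nonneg _)
    have h2 : √X < n + 1 := Nat.lt_floor_add_one _
    have hn1 : 0 < n := Nat.floor_pos.mpr (by rw [Real.one_le_sqrt]; exact hX)
    have hn' : (0:ℝ) < n := by exact_mod_cast hn1
    have h3 : (n:ℝ) ^ 2 ≤ X := by rw [← Real.sq_sqrt hX0]; gcongr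
    have h4 : X ≤ ((n:ℝ) + 1) ^ 2 := by rw [← Real.sq_sqrt hX0]; gcongr
    have h5 : (classCount (Good C ((n:ℝ)^2)) : ℝ) ≤ classCount (Good C X) := by
      exact_mod_cast count_mono hC h3 (Usc_finite C X)
    have h6 : X ^ 2 ≤ ((n:ℝ) + 1) ^ 4 := by
      calc X ^ 2 ≤ (((n:ℝ) + 1) ^ 2) ^ 2 := by gcongr
        _ = _ := by ring
    rw [show (classCount (Good C ((n:ℝ)^2)) : ℝ) / (n:ℝ) ^ 4 * ((n:ℝ) / ((n:ℝ) + 1)) ^ 4 =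
      (classCount (Good C ((n:ℝ)^2)) : ℝ) / ((n:ℝ) + 1) ^ 4 by field_simp]
    gcongr
  · filter_upwards [eventually_ge_atTop 1] with X hX
    have hX0 : (0:ℝ) ≤ X := by linarith
    set n := ⌊√X⌋₊ with hn
    have h1 : (n:ℝ) ≤ √X := Nat.floor_le (Real.sqrt_nonneg _)
    have h2 : √X < n + 1 := Nat.lt_floor_add_one _
    have hn1 : 0 < n := Nat.floor_pos.mpr (by rw [Real.one_le_sqrt]; exact hX)
    have hn' : (0:ℝ) < n := by exact_mod_cast hn1
    have h3 : (n:ℝ) ^ 2 ≤ X := by rw [← Real.sq_sqrt hX0]; gcongr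
    have h4 : X ≤ ((n + 1 : ℕ):ℝ) ^ 2 := by rw [← Real.sq_sqrt hX0]; push_cast; gcongr
    have h5 : (classCount (Good C X) : ℝ) ≤ classCount (Good C (((n + 1 : ℕ):ℝ)^2)) := by
      exact_mod_cast count_mono hC h4 (Usc_finite C _)
    have h6 : (n:ℝ) ^ 4 ≤ X ^ 2 := by
      calc (n:ℝ) ^ 4 = ((n:ℝ) ^ 2) ^ 2 := by ring
        _ ≤ X ^ 2 := by gcongr
    rw [show (classCount (Good C (((n + 1 : ℕ):ℝ)^2)) : ℝ) / ((n + 1 : ℕ):ℝ) ^ 4 / ((n:ℝ) / ((n:ℝ) + 1)) ^ 4 =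
      (classCount (Good C (((n + 1 : ℕ):ℝ)^2)) : ℝ) / (n:ℝ) ^ 4 by push_cast; field_simp]
    gcongr

end BQF

/-- Counting `GL₂(ℤ)`-classes of irreducible integral binary quartic forms with
4 distinct real roots and height `h_C = max(|I|, |J|/C) < X`:
the count is `(C ζ(2)/27) X² + o(X²)`, where `ζ(2) = π²/6`. -/
theorem count_classes_four_real_roots (C : ℝ) (hC : 0 < C) :
    Tendsto (fun X : ℝ =>
        ((classCount fun f => f.Irred ∧ f.realRoots.ncard = 4 ∧
            max |(f.I : ℝ)| (|(f.J : ℝ)| / C) < X) : ℝ) / X ^ 2)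
      atTop (nhds (C * (Real.pi ^ 2 / 6) / 27)) := by
  exact BQF.real_tendsto C hC
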